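/- Let n ≥ 2 be an integer, let 2 ≤ p < 2(n+1)/(n−1) and let α > (n−1)/(2(n+1)). Then there exists a constant C > 0 such that for every Schwartz function f on ℝⁿ, the maximal Bochner–Riesz function S_*^α f(x) = sup_{R>0} |S_R^α f(x)| satisfies ‖S_*^α f‖_{L^p(ℝⁿ)} ≤ C ‖f‖_{L^p(ℝⁿ)}. -/

import Mathlib

open MeasureTheory Complex Filter
open scoped FourierTransform RealInnerProductSpace ENNReal Topology

/-- The Bochner–Riesz mean of order `α` at level `R` of a function `f` on `ℝⁿ`:
`S_R^α f(x) = ∫ (1 - |ξ|²/R²)₊^α f̂(ξ) e^{2πi⟨x,ξ⟩} dξ`. -/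
noncomputable def bochnerRiesz (n : ℕ) (α R : ℝ) (f : EuclideanSpace ℝ (Fin n) → ℂ)
    (x : EuclideanSpace ℝ (Fin n)) : ℂ :=
  ∫ ξ : EuclideanSpace ℝ (Fin n),
    (((max (1 - ‖ξ‖ ^ 2 / R ^ 2) 0) ^ (α : ℝ) : ℝ) : ℂ) * 𝓕 f ξ *
      Complex.exp (2 * Real.pi * Complex.I * (⟪x, ξ⟫ : ℝ))

section L0
variable {V : Type*} [NormedAddCommGroup V] [InnerProductSpace ℝ V] [FiniteDimensional ℝ V]
  [MeasurableSpace V] [BorelSpace V]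

lemma br_fourier_mul_flip {f g : V → ℂ} (hf : Integrable f) (hg : Integrable g) :
    ∫ ξ, 𝓕 f ξ * g ξ = ∫ x, f x * 𝓕 g x := by
  simpa using! VectorFourier.integral_bilin_fourierIntegral_eq_flip (.mul ℂ ℂ) (L := innerₗ V)
    Real.continuous_fourierChar continuous_inner hf hg

lemma br_fourier_continuous {f : V → ℂ} (hf : Integrable f) : Continuous (𝓕 f) :=
  VectorFourier.fourierIntegral_continuous Real.continuous_fourierChar
    (L := innerₗ V) continuous_inner hf

lemma br_fourier_norm_le {f : V → ℂ} (ξ : V) : ‖𝓕 f ξ‖ ≤ ∫ x, ‖f x‖ :=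
  VectorFourier.norm_fourierIntegral_le_integral_norm _ _ _ _ _

open scoped ContDiff in
lemma br_fourier_ae_eq {u : V → ℂ} (hu : Integrable u) (hu2 : MemLp u 2) :
    (𝓕 (hu2.toLp u) : Lp (α := V) ℂ 2) =ᵐ[volume] 𝓕 u := by
  apply ae_eq_of_integral_contDiff_smul_eq
  · exact (Lp.memLp _).locallyIntegrable (by norm_num)
  · exact (br_fourier_continuous hu).locallyIntegrable
  · intro g g_smooth g_cpt
    have hg₁ : HasCompactSupport (Complex.ofRealCLM ∘ g) := g_cpt.comp_left rfl
    have hg₂ : ContDiff ℝ ∞ (Complex.ofRealCLM ∘ g) := by fun_prop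
    set G := hg₁.toSchwartzMap hg₂ with hG
    have hGx : ∀ x, G x = (g x : ℂ) := fun x => rfl
    have h1 := congrArg (fun T => T G) (Lp.fourier_toTemperedDistribution_eq (hu2.toLp u))
    simp only [TemperedDistribution.fourier_apply, Lp.toTemperedDistribution_apply] at h1
    have h2 : ∫ x, (𝓕 G) x • (hu2.toLp u) x = ∫ x, (𝓕 G) x * u x := by
      apply integral_congr_ae
      filter_upwards [hu2.coeFn_toLp] with x hx
      rw [hx]; rfl
    have h3 := br_fourier_mul_flip (G.integrable (μ := volume)) hu
    have h4 : ∫ x, (𝓕 G) x * u x = ∫ x, G x * 𝓕 u x := by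
      rw [← h3]; rfl
    rw [h2, h4] at h1
    simp only [hGx] at h1
    simpa [Complex.real_smul] using h1.symm

lemma br_plancherel_eLp {u : V → ℂ} (hu : Integrable u) (hu2 : MemLp u 2) :
    eLpNorm (𝓕 u) 2 volume = eLpNorm u 2 volume := by
  rw [← eLpNorm_congr_ae (br_fourier_ae_eq hu hu2)]
  have := Lp.norm_fourier_eq (hu2.toLp u)
  rw [Lp.norm_def, Lp.norm_def, eLpNorm_congr_ae hu2.coeFn_toLp] at this
  rwa [ENNReal.toReal_eq_toReal_iff' (Lp.eLpNorm_ne_top _) hu2.eLpNorm_ne_top] at this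

lemma br_eLp2_sq {u : V → ℂ} : eLpNorm u 2 volume ^ 2 = ∫⁻ x, ‖u x‖ₑ ^ 2 := by
  rw [eLpNorm_eq_lintegral_rpow_enorm_toReal (by norm_num) (by norm_num)]
  simp only [ENNReal.toReal_ofNat, one_div]
  rw [← ENNReal.rpow_natCast, ← ENNReal.rpow_mul]
  norm_num

lemma br_plancherel {u : V → ℂ} (hu : Integrable u) (hu2 : MemLp u 2) :
    ∫⁻ ξ, ‖𝓕 u ξ‖ₑ ^ 2 = ∫⁻ x, ‖u x‖ₑ ^ 2 := by
  rw [← br_eLp2_sq, ← br_eLp2_sq, br_plancherel_eLp hu hu2]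

lemma br_memLp_fourier {u : V → ℂ} (hu : Integrable u) (hu2 : MemLp u 2) :
    MemLp (𝓕 u) 2 volume :=
  ⟨(br_fourier_continuous hu).aestronglyMeasurable, by
    rw [br_plancherel_eLp hu hu2]; exact hu2.2⟩

end L0

section L1

/-- Energy estimate for the Bessel system. -/
lemma br_energy (c : ℝ) (hc : 1 ≤ c) (y z : ℝ → ℝ)
    (hy : ∀ t > 0, HasDerivAt y (z t) t)
    (hz : ∀ t > 0, HasDerivAt z (-y t - 2 * c / t * z t) t) :
    ∃ C : ℝ, 0 < C ∧ ∀ t ≥ 1, |y t| ≤ C * t ^ (-c) ∧ |z t| ≤ C * t ^ (-c) := by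
  set q : ℝ → ℝ := fun t => z t + c * y t / t with hq
  set D : ℝ → ℝ := fun t => q t ^ 2 + y t ^ 2 with hD
  set k : ℝ := c ^ 2 - c with hk
  have hk0 : 0 ≤ k := by nlinarith
  have hq' : ∀ t > 0, HasDerivAt q (-y t - c * q t / t + k * y t / t ^ 2) t := by
    intro t ht
    have := (hz t ht).add (((hy t ht).const_mul c).div (hasDerivAt_id t) ht.ne')
    refine this.congr_deriv ?_
    simp only [hq, id, hk]
    field_simp
    ring
  have hD' : ∀ t > 0, HasDerivAt D (-2 * c * D t / t + 2 * k * q t * y t / t ^ 2) t := by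
    intro t ht
    have := ((hq' t ht).pow 2).add ((hy t ht).pow 2)
    refine this.congr_deriv ?_
    have : z t = q t - c * y t / t := by simp [hq]
    rw [this]
    simp only [hD]
    field_simp
    ring
  set F : ℝ → ℝ := fun t => t ^ (2 * c) * D t * Real.exp (k / t) with hF
  have hF' : ∀ t > 0, HasDerivAt F
      (t ^ (2 * c) * Real.exp (k / t) * (k / t ^ 2) * (2 * q t * y t - D t)) t := by
    intro t ht
    have h1 := (Real.hasDerivAt_rpow_const (x := t) (p := 2 * c) (Or.inl ht.ne'))
    have h2 : HasDerivAt (fun t => Real.exp (k / t)) (Real.exp (k / t) * (-k / t ^ 2)) t := by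
      have := ((hasDerivAt_const t k).div (hasDerivAt_id t) ht.ne').exp
      refine this.congr_deriv ?_
      simp
    have := (h1.mul (hD' t ht)).mul h2
    refine this.congr_deriv ?_
    have e : t ^ (2 * c - 1) = t ^ (2 * c) / t := by
      rw [Real.rpow_sub ht, Real.rpow_one]
    rw [e]
    simp only [Pi.mul_apply]
    field_simp
    ring
  have hanti : AntitoneOn F (Set.Ici 1) := by
    apply antitoneOn_of_deriv_nonpos (convex_Ici 1)
    · intro t ht
      exact (hF' t (lt_of_lt_of_le one_pos ht)).continuousAt.continuousWithinAt
    · intro t ht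
      rw [interior_Ici] at ht
      exact (hF' t (lt_trans one_pos ht)).differentiableAt.differentiableWithinAt
    · intro t ht
      rw [interior_Ici] at ht
      have ht0 : 0 < t := lt_trans one_pos ht
      rw [(hF' t ht0).deriv]
      apply mul_nonpos_of_nonneg_of_nonpos
      · positivity
      · simp only [hD]; nlinarith [sq_nonneg (q t - y t)]
  set A : ℝ := Real.sqrt (F 1) with hA
  have hDt : ∀ t ≥ 1, D t ≤ (A * t ^ (-c)) ^ 2 := by
    intro t ht
    have ht0 : 0 < t := lt_of_lt_of_le one_pos ht
    have h1 : F t ≤ F 1 := hanti (Set.self_mem_Ici) ht ht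
    have hF1 : 0 ≤ F 1 := by simp only [hF, hD]; positivity
    have h2 : t ^ (2 * c) * D t ≤ F t := by
      simp only [hF]
      have : 1 ≤ Real.exp (k / t) := Real.one_le_exp (by positivity)
      have h0 : 0 ≤ t ^ (2 * c) * D t := by simp only [hD]; positivity
      nlinarith
    rw [mul_pow, hA, Real.sq_sqrt hF1, ← Real.rpow_natCast, ← Real.rpow_mul ht0.le]
    have e : t ^ (-c * (2 : ℕ)) = (t ^ (2 * c))⁻¹ := by
      rw [← Real.rpow_neg ht0.le]; congr 1; push_cast; ring
    rw [e, ← div_eq_mul_inv, le_div_iff₀ (by positivity), mul_comm]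
    exact h2.trans h1
  have hA0 : 0 ≤ A := Real.sqrt_nonneg _
  refine ⟨(1 + c) * A + 1, by positivity, ?_⟩
  intro t ht
  have ht0 : 0 < t := lt_of_lt_of_le one_pos ht
  have hP : 0 < t ^ (-c) := by positivity
  have hy1 : |y t| ≤ A * t ^ (-c) := by
    apply abs_le_of_sq_le_sq _ (by positivity)
    have := hDt t ht; simp only [hD] at this; nlinarith [sq_nonneg (q t)]
  have hq1 : |q t| ≤ A * t ^ (-c) := by
    apply abs_le_of_sq_le_sq _ (by positivity)
    have := hDt t ht; simp only [hD] at this; nlinarith [sq_nonneg (y t)]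
  have hz1 : |z t| ≤ |q t| + c * |y t| := by
    have e : z t = q t - c * y t / t := by simp [hq]
    rw [e]
    refine (abs_sub _ _).trans ?_
    gcongr
    rw [abs_div, abs_mul, abs_of_pos (by linarith : 0 < c), abs_of_pos ht0]
    apply div_le_self (by positivity) ht
  have hAP : 0 ≤ A * t ^ (-c) := by positivity
  constructor
  · nlinarith [mul_nonneg (by linarith : 0 ≤ c) hAP]
  · nlinarith [mul_le_mul_of_nonneg_left hy1 (by linarith : 0 ≤ c)]

noncomputable def brI (κ t : ℝ) : ℝ := ∫ v in (-1:ℝ)..1, (1 - v ^ 2) ^ κ * Real.cos (t * v)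
noncomputable def brJ (κ t : ℝ) : ℝ := ∫ v in (-1:ℝ)..1, v * (1 - v ^ 2) ^ κ * Real.sin (t * v)

lemma br_cont_pow (κ : ℝ) (hκ : 0 ≤ κ) : Continuous fun v : ℝ => (1 - v ^ 2) ^ κ :=
  (by fun_prop : Continuous fun v : ℝ => 1 - v ^ 2).rpow_const (fun _ => Or.inr hκ)

lemma br_pow_le (κ : ℝ) (hκ : 0 ≤ κ) (v : ℝ) (hv : v ∈ Set.uIoc (-1 : ℝ) 1) :
    |(1 - v ^ 2) ^ κ| ≤ 1 ∧ |v| ≤ 1 := by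
  rw [Set.uIoc_of_le (by norm_num)] at hv
  have h0 : 0 ≤ 1 - v ^ 2 := by nlinarith [hv.1, hv.2]
  constructor
  · rw [abs_of_nonneg (Real.rpow_nonneg h0 _)]
    exact Real.rpow_le_one h0 (by nlinarith) hκ
  · exact abs_le.2 ⟨hv.1.le, hv.2⟩

lemma brI_deriv (κ : ℝ) (hκ : 0 ≤ κ) (t : ℝ) : HasDerivAt (brI κ) (-brJ κ t) t := by
  have hc := br_cont_pow κ hκ
  have := (intervalIntegral.hasDerivAt_integral_of_dominated_loc_of_deriv_le (𝕜 := ℝ) (μ := volume)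
    (a := -1) (b := 1) (s := Set.univ) (x₀ := t) (bound := fun _ => 1)
    (F := fun t v => (1 - v ^ 2) ^ κ * Real.cos (t * v))
    (F' := fun t v => (1 - v ^ 2) ^ κ * (-Real.sin (t * v) * v)) univ_mem ?_ ?_ ?_ ?_ ?_ ?_).2
  · refine this.congr_deriv ?_
    rw [brJ, ← intervalIntegral.integral_neg]
    congr 1; ext v; ring
  · refine Eventually.of_forall fun x => Continuous.aestronglyMeasurable (by fun_prop)
  · exact Continuous.intervalIntegrable (by fun_prop) _ _
  · exact Continuous.aestronglyMeasurable (by fun_prop)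
  · refine Eventually.of_forall fun v hv x _ => ?_
    obtain ⟨h1, h2⟩ := br_pow_le κ hκ v hv
    rw [Real.norm_eq_abs, abs_mul, abs_mul, abs_neg]
    have h3 := Real.abs_sin_le_one (x * v)
    have : |Real.sin (x * v)| * |v| ≤ 1 * 1 := by gcongr
    calc _ ≤ (1:ℝ) * (1 * 1) := by gcongr
      _ = 1 := by norm_num
  · simp
  · refine Eventually.of_forall fun v _ x _ => ?_
    have : HasDerivAt (fun x => x * v) v x := by simpa using (hasDerivAt_id x).mul_const v
    exact (this.cos.const_mul _)

lemma brJ_deriv (κ : ℝ) (hκ : 0 ≤ κ) (t : ℝ) :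
    HasDerivAt (brJ κ) (brI κ t - brI (κ + 1) t) t := by
  have hc := br_cont_pow κ hκ
  have hc' := br_cont_pow (κ + 1) (by linarith)
  have := (intervalIntegral.hasDerivAt_integral_of_dominated_loc_of_deriv_le (𝕜 := ℝ) (μ := volume)
    (a := -1) (b := 1) (s := Set.univ) (x₀ := t) (bound := fun _ => 1)
    (F := fun t v => v * (1 - v ^ 2) ^ κ * Real.sin (t * v))
    (F' := fun t v => v * (1 - v ^ 2) ^ κ * (Real.cos (t * v) * v)) univ_mem ?_ ?_ ?_ ?_ ?_ ?_).2
  · refine this.congr_deriv ?_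
    rw [brI, brI, ← intervalIntegral.integral_sub]
    · apply intervalIntegral.integral_congr
      intro v hv
      simp only
      rw [Set.uIcc_of_le (by norm_num)] at hv
      have h0 : 0 ≤ 1 - v ^ 2 := by nlinarith [hv.1, hv.2]
      rw [Real.rpow_add_of_nonneg h0 hκ (by norm_num), Real.rpow_one]
      ring
    · exact Continuous.intervalIntegrable (by fun_prop) _ _
    · exact Continuous.intervalIntegrable (by fun_prop) _ _
  · refine Eventually.of_forall fun x => Continuous.aestronglyMeasurable (by fun_prop)
  · exact Continuous.intervalIntegrable (by fun_prop) _ _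
  · exact Continuous.aestronglyMeasurable (by fun_prop)
  · refine Eventually.of_forall fun v hv x _ => ?_
    obtain ⟨h1, h2⟩ := br_pow_le κ hκ v hv
    rw [Real.norm_eq_abs, abs_mul, abs_mul, abs_mul]
    have h3 := Real.abs_cos_le_one (x * v)
    have : |Real.cos (x * v)| * |v| ≤ 1 * 1 := by gcongr
    calc _ ≤ (1 * 1:ℝ) * (1 * 1) := by gcongr
      _ = 1 := by norm_num
  · simp
  · refine Eventually.of_forall fun v _ x _ => ?_
    have : HasDerivAt (fun x => x * v) v x := by simpa using (hasDerivAt_id x).mul_const v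
    exact (this.sin.const_mul _)

lemma brJ_parts (κ : ℝ) (hκ : 0 < κ) (t : ℝ) :
    2 * (κ + 1) * brJ κ t = t * brI (κ + 1) t := by
  have hc := br_cont_pow κ hκ.le
  have hc' := br_cont_pow (κ + 1) (by linarith)
  have h1 : ∀ v ∈ Set.uIcc (-1:ℝ) 1, HasDerivAt (fun v : ℝ => (1 - v ^ 2) ^ (κ + 1))
      (-2 * (κ + 1) * v * (1 - v ^ 2) ^ κ) v := by
    intro v _
    have := (((hasDerivAt_id v).pow 2).const_sub 1).rpow_const (p := κ + 1) (Or.inr (by linarith))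
    refine this.congr_deriv ?_
    rw [add_sub_cancel_right]
    simp only [id, Pi.pow_apply]
    push_cast
    ring
  have h2 : ∀ v ∈ Set.uIcc (-1:ℝ) 1, HasDerivAt (fun v : ℝ => Real.sin (t * v))
      (Real.cos (t * v) * t) v := by
    intro v _
    have : HasDerivAt (fun v => t * v) t v := by simpa using (hasDerivAt_id v).const_mul t
    exact this.sin
  have := intervalIntegral.integral_mul_deriv_eq_deriv_mul h1 h2
    (Continuous.intervalIntegrable (by fun_prop) _ _)
    (Continuous.intervalIntegrable (by fun_prop) _ _)
  have z : (1 - (1:ℝ) ^ 2) ^ (κ + 1) = 0 := by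
    norm_num; exact Real.zero_rpow (by linarith)
  have z' : (1 - (-1:ℝ) ^ 2) ^ (κ + 1) = 0 := by
    norm_num; exact Real.zero_rpow (by linarith)
  rw [z, z', zero_mul, zero_mul, sub_zero, zero_sub, ← intervalIntegral.integral_neg] at this
  rw [brJ, brI, ← intervalIntegral.integral_const_mul, ← intervalIntegral.integral_const_mul]
  calc _ = _ := ?_
    _ = _ := this.symm
    _ = _ := ?_
  · congr 1; ext v; ring
  · congr 1; ext v; ring

lemma br_bessel (κ : ℝ) (hκ : 0 < κ) :
    ∃ C : ℝ, 0 < C ∧ ∀ t ≥ 1, |brI κ t| ≤ C * t ^ (-(κ + 1)) ∧ |brJ κ t| ≤ C * t ^ (-(κ + 1)) := by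
  obtain ⟨C, hC, h⟩ := br_energy (κ + 1) (by linarith) (brI κ) (fun t => -brJ κ t)
    (fun t _ => brI_deriv κ hκ.le t) (fun t ht => by
      refine (brJ_deriv κ hκ.le t).neg.congr_deriv ?_
      have := brJ_parts κ hκ t
      have e : brI (κ + 1) t = 2 * (κ + 1) * brJ κ t / t := by
        rw [this]; field_simp
      rw [e]; ring)
  exact ⟨C, hC, fun t ht => by simpa using h t ht⟩

end L1

section L2

lemma br_ind_congr {X Y : Type*} (s : Set X) (t : Set Y) (a : X) (b : Y) (h : a ∈ s ↔ b ∈ t) :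
    s.indicator (fun _ => (1 : ℂ)) a = t.indicator (fun _ => (1 : ℂ)) b := by
  by_cases hb : b ∈ t
  · rw [Set.indicator_of_mem (h.2 hb), Set.indicator_of_mem hb]
  · rw [Set.indicator_of_notMem (fun ha => hb (h.1 ha)), Set.indicator_of_notMem hb]

/-- Splitting off the `i`-th coordinate. -/
noncomputable def brSplit {m : ℕ} (i : Fin (m + 1)) :
    ℝ × (Fin m → ℝ) ≃ᵐ EuclideanSpace ℝ (Fin (m + 1)) :=
  (MeasurableEquiv.piFinSuccAbove (fun _ : Fin (m + 1) => ℝ) i).symm.trans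
    (MeasurableEquiv.toLp 2 (Fin (m + 1) → ℝ))

lemma brSplit_mp {m : ℕ} (i : Fin (m + 1)) :
    MeasurePreserving (brSplit i) (volume.prod volume) volume :=
  (PiLp.volume_preserving_toLp (Fin (m + 1))).comp
    ((volume_preserving_piFinSuccAbove (fun _ : Fin (m + 1) => ℝ) i).symm _)

lemma brSplit_same {m : ℕ} (i : Fin (m + 1)) (p : ℝ × (Fin m → ℝ)) : brSplit i p i = p.1 := by
  simp [brSplit, MeasurableEquiv.piFinSuccAbove, Fin.insertNthEquiv]

lemma brSplit_succAbove {m : ℕ} (i : Fin (m + 1)) (p : ℝ × (Fin m → ℝ)) (j : Fin m) :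
    brSplit i p (i.succAbove j) = p.2 j := by
  simp [brSplit, MeasurableEquiv.piFinSuccAbove, Fin.insertNthEquiv]

lemma brSplit_norm {m : ℕ} (i : Fin (m + 1)) (p : ℝ × (Fin m → ℝ)) :
    ‖brSplit i p‖ ^ 2 = p.1 ^ 2 + ∑ j, p.2 j ^ 2 := by
  rw [EuclideanSpace.norm_sq_eq, Fin.sum_univ_succAbove _ i]
  simp [brSplit_same, brSplit_succAbove]

/-- volume of slices -/
lemma br_slice_vol (m : ℕ) (hm : 1 ≤ m) : ∃ ω : ℝ, 0 ≤ ω ∧ ∀ c : ℝ, 0 ≤ c →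
    (volume : Measure (Fin m → ℝ)).real {η | ∑ j, η j ^ 2 ≤ c} = ω * c ^ ((m : ℝ) / 2) := by
  refine ⟨(volume : Measure (EuclideanSpace ℝ (Fin m))).real (Metric.ball 0 1), measureReal_nonneg,
    fun c hc => ?_⟩
  have : Nonempty (Fin m) := ⟨⟨0, hm⟩⟩
  have h1 : {η : Fin m → ℝ | ∑ j, η j ^ 2 ≤ c} =
      (WithLp.toLp 2) ⁻¹' (Metric.closedBall (0 : EuclideanSpace ℝ (Fin m)) (Real.sqrt c)) := by
    ext η
    simp only [Set.mem_ofPred_eq, Set.mem_preimage, mem_closedBall_zero_iff]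
    rw [EuclideanSpace.norm_eq, Real.sqrt_le_sqrt_iff hc]
    simp
  rw [h1, Measure.real, (PiLp.volume_preserving_toLp (Fin m)).measure_preimage
    measurableSet_closedBall.nullMeasurableSet, Measure.addHaar_closedBall _ _ (Real.sqrt_nonneg c)]
  rw [ENNReal.toReal_mul, ENNReal.toReal_ofReal (by positivity), mul_comm, finrank_euclideanSpace_fin]
  congr 1
  rw [Real.sqrt_eq_rpow, ← Real.rpow_natCast, ← Real.rpow_mul hc]
  congr 1; ring

lemma br_exp_I (κ : ℝ) (hκ : 0 ≤ κ) (ρ : ℝ) :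
    ∫ u in (-1:ℝ)..1, (((1 - u ^ 2) ^ κ : ℝ) : ℂ) * Complex.exp (-(2 * Real.pi * ρ * u : ℝ) * I)
      = (brI κ (2 * Real.pi * ρ) : ℂ) := by
  have hc := br_cont_pow κ hκ
  have h1 : ∀ u : ℝ, (((1 - u ^ 2) ^ κ : ℝ) : ℂ) * Complex.exp (-(2 * Real.pi * ρ * u : ℝ) * I)
      = (((1 - u ^ 2) ^ κ * Real.cos (2 * Real.pi * ρ * u) : ℝ) : ℂ) -
        (((1 - u ^ 2) ^ κ * Real.sin (2 * Real.pi * ρ * u) : ℝ) : ℂ) * I := by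
    intro u
    rw [neg_mul, ← neg_mul, Complex.exp_mul_I, Complex.cos_neg, Complex.sin_neg]
    push_cast; ring
  simp_rw [h1]
  rw [intervalIntegral.integral_sub, intervalIntegral.integral_mul_const,
    intervalIntegral.integral_ofReal, intervalIntegral.integral_ofReal]
  · have h2 : ∫ u in (-1:ℝ)..1, (1 - u ^ 2) ^ κ * Real.sin (2 * Real.pi * ρ * u) = 0 := by
      have := intervalIntegral.integral_comp_neg (a := -1) (b := 1)
        (fun u : ℝ => (1 - u ^ 2) ^ κ * Real.sin (2 * Real.pi * ρ * u))
      simp only [neg_sq, mul_neg, Real.sin_neg, neg_neg] at this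
      rw [intervalIntegral.integral_neg] at this
      linarith
    rw [h2, brI]; simp
  · exact Continuous.intervalIntegrable (by fun_prop) _ _
  · exact Continuous.intervalIntegrable (by fun_prop) _ _

lemma br_fourier_unitball_axis (m : ℕ) (hm : 1 ≤ m) : ∃ ω : ℝ, 0 ≤ ω ∧ ∀ ρ : ℝ,
    𝓕 ((Metric.closedBall (0 : EuclideanSpace ℝ (Fin (m + 1))) 1).indicator (fun _ => (1 : ℂ)))
      (EuclideanSpace.single 0 ρ) = ω * (brI ((m : ℝ) / 2) (2 * Real.pi * ρ) : ℂ) := by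
  obtain ⟨ω, hω, hv⟩ := br_slice_vol m hm
  refine ⟨ω, hω, fun ρ => ?_⟩
  rw [Real.fourier_eq']
  rw [← (brSplit_mp (0 : Fin (m + 1))).integral_comp (brSplit 0).measurableEmbedding]
  have hIntg : Integrable (fun p : ℝ × (Fin m → ℝ) =>
      Complex.exp (↑(-2 * Real.pi * ⟪brSplit 0 p, EuclideanSpace.single 0 ρ⟫) * I) •
      (Metric.closedBall (0 : EuclideanSpace ℝ (Fin (m + 1))) 1).indicator (fun _ => (1 : ℂ))
        (brSplit 0 p)) (volume.prod volume) := by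
    rw [← Function.comp_def (fun x : EuclideanSpace ℝ (Fin (m + 1)) =>
      Complex.exp (↑(-2 * Real.pi * ⟪x, EuclideanSpace.single 0 ρ⟫) * I) •
      (Metric.closedBall (0 : EuclideanSpace ℝ (Fin (m + 1))) 1).indicator (fun _ => (1 : ℂ)) x)
      (brSplit 0), (brSplit_mp (0 : Fin (m + 1))).integrable_comp_emb
      (brSplit 0).measurableEmbedding]
    have : Integrable ((Metric.closedBall (0 : EuclideanSpace ℝ (Fin (m + 1))) 1).indicator
      (fun _ => (1 : ℂ))) :=
      (integrable_indicator_iff measurableSet_closedBall).2 (integrableOn_const (by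
        exact measure_closedBall_lt_top.ne) (by simp))
    simp only [smul_eq_mul]
    refine this.bdd_mul (c := 1) ?_ ?_
    · exact Continuous.aestronglyMeasurable (by fun_prop)
    · refine Eventually.of_forall fun x => ?_
      rw [Complex.norm_exp_ofReal_mul_I]
  rw [integral_prod _ hIntg]
  have hinner : ∀ u : ℝ, (∫ η : Fin m → ℝ,
      Complex.exp (↑(-2 * Real.pi * ⟪brSplit 0 (u, η), EuclideanSpace.single 0 ρ⟫) * I) •
      (Metric.closedBall (0 : EuclideanSpace ℝ (Fin (m + 1))) 1).indicator (fun _ => (1 : ℂ))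
        (brSplit 0 (u, η))) =
      (Set.Icc (-1:ℝ) 1).indicator (fun u => ω * ((((1 - u ^ 2) ^ ((m : ℝ) / 2) : ℝ) : ℂ) *
        Complex.exp (-(2 * Real.pi * ρ * u : ℝ) * I))) u := by
    intro u
    have e1 : ∀ η : Fin m → ℝ, ⟪brSplit 0 (u, η), EuclideanSpace.single 0 ρ⟫ = u * ρ := by
      intro η
      rw [EuclideanSpace.inner_single_right]
      simp [brSplit_same, mul_comm]
    simp_rw [e1]
    rw [integral_smul]
    have e2 : (fun η : Fin m → ℝ => (Metric.closedBall (0 : EuclideanSpace ℝ (Fin (m + 1))) 1).indicator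
        (fun _ => (1 : ℂ)) (brSplit 0 (u, η))) =
        {η : Fin m → ℝ | ∑ j, η j ^ 2 ≤ 1 - u ^ 2}.indicator (fun _ => (1 : ℂ)) := by
      ext η
      have : ‖brSplit 0 (u, η)‖ ≤ 1 ↔ ∑ j, η j ^ 2 ≤ 1 - u ^ 2 := by
        rw [← sq_le_one_iff₀ (norm_nonneg _), brSplit_norm]
        constructor <;> intro h <;> simp only at * <;> linarith
      exact br_ind_congr _ _ _ _ (by rw [mem_closedBall_zero_iff, this]; rfl)
    rw [e2, integral_indicator_const _ (measurableSet_le (by fun_prop) (by fun_prop))]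
    by_cases hu : u ∈ Set.Icc (-1:ℝ) 1
    · rw [Set.indicator_of_mem hu, hv _ (by nlinarith [hu.1, hu.2])]
      have : (↑(-2 * Real.pi * (u * ρ)) : ℂ) = -((2 * Real.pi * ρ * u : ℝ) : ℂ) := by
        push_cast; ring
      rw [this]
      simp only [smul_eq_mul, real_smul, mul_one]
      push_cast; ring
    · rw [Set.indicator_of_notMem hu]
      have : {η : Fin m → ℝ | ∑ j, η j ^ 2 ≤ 1 - u ^ 2} = ∅ := by
        ext η
        simp only [Set.mem_ofPred_eq, Set.mem_empty_iff_false, iff_false, not_le]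
        have h0 : 0 ≤ ∑ j, η j ^ 2 := Finset.sum_nonneg fun j _ => sq_nonneg _
        have : 1 < u ^ 2 := by
          by_contra hcon
          push Not at hcon
          exact hu (abs_le.1 ((sq_le_one_iff_abs_le_one u).1 hcon))
        linarith
      rw [this]; simp
  simp_rw [hinner]
  rw [integral_indicator measurableSet_Icc, integral_Icc_eq_integral_Ioc,
    ← intervalIntegral.integral_of_le (by norm_num), intervalIntegral.integral_const_mul,
    br_exp_I _ (by positivity)]

lemma br_fourier_ball (m : ℕ) (hm : 1 ≤ m) : ∃ ω : ℝ, 0 ≤ ω ∧ ∀ R > 0,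
    ∀ z : EuclideanSpace ℝ (Fin (m + 1)),
    𝓕 ((Metric.closedBall (0 : EuclideanSpace ℝ (Fin (m + 1))) R).indicator (fun _ => (1 : ℂ))) z
      = ω * ((R ^ (m + 1) * brI ((m : ℝ) / 2) (2 * Real.pi * ‖z‖ * R) : ℝ) : ℂ) := by
  obtain ⟨ω, hω, h⟩ := br_fourier_unitball_axis m hm
  have h1 : ∀ z : EuclideanSpace ℝ (Fin (m + 1)),
    𝓕 ((Metric.closedBall (0 : EuclideanSpace ℝ (Fin (m + 1))) 1).indicator (fun _ => (1 : ℂ))) z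
      = ω * (brI ((m : ℝ) / 2) (2 * Real.pi * ‖z‖) : ℂ) := by
    intro z
    have hz : ‖z‖ = ‖(EuclideanSpace.single 0 ‖z‖ : EuclideanSpace ℝ (Fin (m + 1)))‖ := by simp
    have href := Submodule.reflection_sub hz
    set A := (ℝ ∙ (z - EuclideanSpace.single 0 ‖z‖))ᗮ.reflection with hA
    have := Real.fourier_comp_linearIsometry A
      ((Metric.closedBall (0 : EuclideanSpace ℝ (Fin (m + 1))) 1).indicator (fun _ => (1 : ℂ))) z
    rw [href, h] at this
    rw [← this]
    have hcomp : (Metric.closedBall (0 : EuclideanSpace ℝ (Fin (m + 1))) 1).indicator (fun _ => (1 : ℂ)) ∘ A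
        = (Metric.closedBall (0 : EuclideanSpace ℝ (Fin (m + 1))) 1).indicator (fun _ => (1 : ℂ)) := by
      ext x
      exact br_ind_congr _ _ _ _ (by rw [mem_closedBall_zero_iff, mem_closedBall_zero_iff, A.norm_map])
    rw [hcomp]
  refine ⟨ω, hω, fun R hR z => ?_⟩
  have h2 := h1 (R • z)
  rw [Real.fourier_eq'] at h2 ⊢
  have h3 := Measure.integral_comp_inv_smul (volume : Measure (EuclideanSpace ℝ (Fin (m + 1))))
    (fun v => Complex.exp (↑(-2 * Real.pi * ⟪v, R • z⟫) * I) •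
      (Metric.closedBall (0 : EuclideanSpace ℝ (Fin (m + 1))) 1).indicator (fun _ => (1 : ℂ)) v) R
  rw [h2] at h3
  rw [norm_smul, Real.norm_of_nonneg hR.le] at h3
  calc _ = _ := ?_
    _ = _ := h3
    _ = _ := ?_
  · refine integral_congr_ae (Eventually.of_forall fun v => ?_)
    have e1 : ⟪R⁻¹ • v, R • z⟫ = ⟪v, z⟫ := by
      rw [real_inner_smul_left, real_inner_smul_right]
      field_simp
    have e2 := br_ind_congr (Metric.closedBall (0 : EuclideanSpace ℝ (Fin (m + 1))) R)
      (Metric.closedBall (0 : EuclideanSpace ℝ (Fin (m + 1))) 1) v (R⁻¹ • v) (by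
        rw [mem_closedBall_zero_iff, mem_closedBall_zero_iff, norm_smul, norm_inv,
          Real.norm_of_nonneg hR.le, inv_mul_le_iff₀ hR, mul_one])
    simp only [e1, e2]
  · rw [finrank_euclideanSpace_fin, abs_of_pos (by positivity), real_smul]
    have : 2 * Real.pi * (R * ‖z‖) = 2 * Real.pi * ‖z‖ * R := by ring
    rw [this]; push_cast; ring

def brRing (n : ℕ) (a b : ℝ) : Set (EuclideanSpace ℝ (Fin n)) := {ξ | a < ‖ξ‖ ^ 2 ∧ ‖ξ‖ ^ 2 ≤ b}

lemma brRing_meas (n : ℕ) (a b : ℝ) : MeasurableSet (brRing n a b) :=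
  (measurableSet_lt (measurable_const (a := a)) (by fun_prop : Measurable fun ξ : EuclideanSpace ℝ (Fin n) => ‖ξ‖ ^ 2)).inter
    (measurableSet_le (by fun_prop : Measurable fun ξ : EuclideanSpace ℝ (Fin n) => ‖ξ‖ ^ 2) measurable_const)

lemma brRing_fin (n : ℕ) (a b : ℝ) : volume (brRing n a b) < ∞ := by
  refine (measure_mono ?_).trans_lt (measure_closedBall_lt_top (x := (0 : EuclideanSpace ℝ (Fin n)))
    (r := Real.sqrt b))
  intro ξ hξ
  rw [mem_closedBall_zero_iff]
  exact Real.le_sqrt_of_sq_le hξ.2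

lemma brI_le (κ t : ℝ) (hκ : 0 ≤ κ) : |brI κ t| ≤ 2 := by
  have := intervalIntegral.norm_integral_le_of_norm_le_const (a := (-1:ℝ)) (b := 1)
    (f := fun v => (1 - v ^ 2) ^ κ * Real.cos (t * v)) (C := 1) (fun v hv => by
      rw [Real.norm_eq_abs, abs_mul]
      have := Real.abs_cos_le_one (t * v)
      have h := (br_pow_le κ hκ v hv).1
      calc _ ≤ (1:ℝ) * 1 := by gcongr
        _ = 1 := by norm_num)
  rw [brI]; refine this.trans (by norm_num)

lemma brJ_le (κ t : ℝ) (hκ : 0 ≤ κ) : |brJ κ t| ≤ 2 := by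
  have := intervalIntegral.norm_integral_le_of_norm_le_const (a := (-1:ℝ)) (b := 1)
    (f := fun v => v * (1 - v ^ 2) ^ κ * Real.sin (t * v)) (C := 1) (fun v hv => by
      rw [Real.norm_eq_abs, abs_mul, abs_mul]
      have := Real.abs_sin_le_one (t * v)
      have h := (br_pow_le κ hκ v hv)
      have h1 := h.1
      have h2 := h.2
      calc _ ≤ (1:ℝ) * 1 * 1 := by gcongr
        _ = 1 := by norm_num)
  rw [brJ]; refine this.trans (by norm_num)

/-- Key one-variable derivative bound. -/
lemma br_H_bound (m : ℕ) (hm : 1 ≤ m) : ∃ C : ℝ, 0 < C ∧ ∀ c > 0, ∀ R₁ R₂ : ℝ, 1 / 2 ≤ R₁ → R₁ ≤ R₂ →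
    R₂ ≤ 3 → |R₂ ^ (m + 1) * brI ((m : ℝ) / 2) (c * R₂) - R₁ ^ (m + 1) * brI ((m : ℝ) / 2) (c * R₁)|
      ≤ C * c ^ (-((m : ℝ) / 2)) * (R₂ - R₁) := by
  set κ : ℝ := (m : ℝ) / 2 with hκ
  have hm' : (1 : ℝ) ≤ m := by exact_mod_cast hm
  have hκ0 : 0 < κ := by positivity
  obtain ⟨C₀, hC₀, hb⟩ := br_bessel κ hκ0
  -- uniform bound |I|, |J| ≤ C1 * c^{-κ} / (1+c)
  have hIJ : ∃ C₁ : ℝ, 0 < C₁ ∧ ∀ c > 0, ∀ R : ℝ, 1 / 2 ≤ R → (1 + c) * |brI κ (c * R)| ≤ C₁ * c ^ (-κ) ∧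
      (1 + c) * |brJ κ (c * R)| ≤ C₁ * c ^ (-κ) := by
    refine ⟨max (2 * 3 * 2 ^ κ) (2 * C₀ * (2 ^ (κ + 1))), by positivity, fun c hc R hR => ?_⟩
    have hcκ : 0 < c ^ (-κ) := by positivity
    rcases le_or_gt c 2 with h | h
    · have h1 : (2:ℝ) ^ (-κ) ≤ c ^ (-κ) := Real.rpow_le_rpow_of_nonpos hc h (by linarith)
      have h2 : (1:ℝ) ≤ 2 ^ κ * c ^ (-κ) := by
        calc (1:ℝ) = 2 ^ κ * 2 ^ (-κ) := by rw [← Real.rpow_add (by norm_num)]; simp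
          _ ≤ _ := by gcongr
      have h3 : (1 + c) * 2 ≤ max (2 * 3 * 2 ^ κ) (2 * C₀ * (2 ^ (κ + 1))) * c ^ (-κ) := by
        calc (1 + c) * 2 ≤ 2 * 3 * 1 := by linarith
          _ ≤ 2 * 3 * (2 ^ κ * c ^ (-κ)) := by gcongr
          _ = (2 * 3 * 2 ^ κ) * c ^ (-κ) := by ring
          _ ≤ _ := by gcongr; exact le_max_left _ _
      exact ⟨le_trans (by gcongr; exact brI_le κ _ hκ0.le) h3,
        le_trans (by gcongr; exact brJ_le κ _ hκ0.le) h3⟩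
    · have h1 : c / 2 ≤ c * R := by nlinarith
      have h2 : (c * R) ^ (-(κ + 1)) ≤ (c / 2) ^ (-(κ + 1)) :=
        Real.rpow_le_rpow_of_nonpos (by positivity) h1 (by linarith)
      have h3 : (c / 2) ^ (-(κ + 1)) = 2 ^ (κ + 1) * (c ^ (-κ) / c) := by
        rw [Real.div_rpow hc.le (by norm_num), Real.rpow_neg (by norm_num : (0:ℝ) ≤ 2), div_inv_eq_mul,
          neg_add, ← sub_eq_add_neg, Real.rpow_sub hc, Real.rpow_one, mul_comm]
      have h4 : (1 + c) * (C₀ * (c * R) ^ (-(κ + 1))) ≤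
          max (2 * 3 * 2 ^ κ) (2 * C₀ * (2 ^ (κ + 1))) * c ^ (-κ) := by
        calc (1 + c) * (C₀ * (c * R) ^ (-(κ + 1))) ≤ (2 * c) * (C₀ * (2 ^ (κ + 1) * (c ^ (-κ) / c))) := by
              rw [← h3]; gcongr; linarith
          _ = (2 * C₀ * (2 ^ (κ + 1))) * c ^ (-κ) := by field_simp
          _ ≤ _ := by gcongr; exact le_max_right _ _
      have hx := hb (c * R) (by nlinarith)
      exact ⟨le_trans (by gcongr; exact hx.1) h4, le_trans (by gcongr; exact hx.2) h4⟩
  obtain ⟨C₁, hC₁, hIJ⟩ := hIJ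
  refine ⟨((m + 1) * 3 ^ m + 3 ^ (m + 1)) * C₁, by positivity, fun c hc R₁ R₂ h1 h2 h3 => ?_⟩
  have hder : ∀ R ∈ Set.Icc R₁ R₂, HasDerivWithinAt (fun R : ℝ => R ^ (m + 1) * brI κ (c * R))
      (((m + 1 : ℕ) : ℝ) * R ^ m * brI κ (c * R) + R ^ (m + 1) * (-brJ κ (c * R) * c)) (Set.Icc R₁ R₂) R := by
    intro R _
    have hl : HasDerivAt (fun R => c * R) c R := by simpa using (hasDerivAt_id R).const_mul c
    have := (hasDerivAt_pow (m + 1) R).mul ((brI_deriv κ hκ0.le (c * R)).comp R hl)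
    exact this.hasDerivWithinAt
  have := (convex_Icc R₁ R₂).norm_image_sub_le_of_norm_hasDerivWithin_le
    (C := ((m + 1) * 3 ^ m + 3 ^ (m + 1)) * C₁ * c ^ (-κ)) hder (fun R hR => ?_)
    (Set.left_mem_Icc.2 h2) (Set.right_mem_Icc.2 h2)
  · rwa [Real.norm_eq_abs, Real.norm_eq_abs, abs_of_nonneg (sub_nonneg.2 h2)] at this
  · have hR0 : 0 ≤ R := by linarith [hR.1]
    have hR3 : R ≤ 3 := hR.2.trans h3
    obtain ⟨hi, hj⟩ := hIJ c hc R (h1.trans hR.1)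
    have hi' : |brI κ (c * R)| ≤ C₁ * c ^ (-κ) := by nlinarith [abs_nonneg (brI κ (c * R))]
    have hj' : |brJ κ (c * R)| * c ≤ C₁ * c ^ (-κ) := by nlinarith [abs_nonneg (brJ κ (c * R))]
    refine (norm_add_le _ _).trans ?_
    rw [norm_mul, norm_mul, norm_mul, norm_mul, norm_neg, norm_pow, norm_pow, Real.norm_of_nonneg hR0,
      Real.norm_of_nonneg hc.le]
    simp only [Real.norm_eq_abs, Nat.abs_cast]
    push_cast
    calc _ ≤ ((m:ℝ) + 1) * 3 ^ m * (C₁ * c ^ (-κ)) + 3 ^ (m + 1) * (C₁ * c ^ (-κ)) := by gcongr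
      _ = _ := by ring

/-- Kernel decay for the ring indicator. -/
lemma br_ring_kernel (n : ℕ) (hn : 2 ≤ n) : ∃ C : ℝ, 0 < C ∧ ∀ a b : ℝ, 1 / 4 ≤ a → a ≤ b → b ≤ 9 →
    ∀ z : EuclideanSpace ℝ (Fin n), z ≠ 0 →
    ‖𝓕 ((brRing n a b).indicator (fun _ => (1 : ℂ))) z‖ ≤ C * (b - a) * ‖z‖ ^ (-(((n : ℝ) - 1) / 2)) := by
  obtain ⟨m, rfl⟩ : ∃ m, n = m + 1 := ⟨n - 1, by omega⟩
  obtain ⟨ω, hω, hF⟩ := br_fourier_ball m (by omega)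
  obtain ⟨C, hC, hH⟩ := br_H_bound m (by omega)
  refine ⟨ω * C * (2 * Real.pi) ^ (-((m : ℝ) / 2)) + 1, by positivity, fun a b ha hab hb z hz => ?_⟩
  have hz0 : 0 < ‖z‖ := norm_pos_iff.2 hz
  have hsa : 1 / 2 ≤ Real.sqrt a := by
    apply Real.le_sqrt_of_sq_le; norm_num; linarith
  have hsab : Real.sqrt a ≤ Real.sqrt b := Real.sqrt_le_sqrt hab
  have hsb : Real.sqrt b ≤ 3 := by
    rw [Real.sqrt_le_left (by norm_num)]; norm_num; linarith
  have hind : (brRing (m + 1) a b).indicator (fun _ => (1 : ℂ)) =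
      (Metric.closedBall (0 : EuclideanSpace ℝ (Fin (m + 1))) (Real.sqrt b)).indicator (fun _ => (1 : ℂ)) -
      (Metric.closedBall (0 : EuclideanSpace ℝ (Fin (m + 1))) (Real.sqrt a)).indicator (fun _ => (1 : ℂ)) := by
    ext ξ
    have h1 : ξ ∈ Metric.closedBall (0 : EuclideanSpace ℝ (Fin (m + 1))) (Real.sqrt a) ↔ ‖ξ‖ ^ 2 ≤ a := by
      rw [mem_closedBall_zero_iff]; exact Real.le_sqrt (norm_nonneg ξ) (by linarith)
    have h2 : ξ ∈ Metric.closedBall (0 : EuclideanSpace ℝ (Fin (m + 1))) (Real.sqrt b) ↔ ‖ξ‖ ^ 2 ≤ b := by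
      rw [mem_closedBall_zero_iff]; exact Real.le_sqrt (norm_nonneg ξ) (by linarith)
    rw [Pi.sub_apply]
    by_cases c1 : ‖ξ‖ ^ 2 ≤ a
    · have c2 : ‖ξ‖ ^ 2 ≤ b := c1.trans hab
      rw [Set.indicator_of_mem (h1.2 c1), Set.indicator_of_mem (h2.2 c2),
        Set.indicator_of_notMem (fun h => not_lt.2 c1 h.1), sub_self]
    · rw [Set.indicator_of_notMem (fun h => c1 (h1.1 h)), sub_zero]
      exact br_ind_congr _ _ _ _ (by rw [h2]; exact ⟨fun h => h.2, fun h => ⟨not_le.1 c1, h⟩⟩)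
  have hball : ∀ R, Integrable ((Metric.closedBall (0 : EuclideanSpace ℝ (Fin (m + 1))) R).indicator
      (fun _ => (1 : ℂ))) := fun R =>
      (integrable_indicator_iff measurableSet_closedBall).2 (integrableOn_const (by
        exact measure_closedBall_lt_top.ne) (by simp))
  have hsub : 𝓕 ((brRing (m + 1) a b).indicator (fun _ => (1 : ℂ))) z =
     𝓕 ((Metric.closedBall (0 : EuclideanSpace ℝ (Fin (m + 1))) (Real.sqrt b)).indicator (fun _ => (1 : ℂ))) z -
     𝓕 ((Metric.closedBall (0 : EuclideanSpace ℝ (Fin (m + 1))) (Real.sqrt a)).indicator (fun _ => (1 : ℂ))) z := by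
    rw [hind]
    simp only [Real.fourier_eq, Pi.sub_apply, smul_sub]
    rw [integral_sub]
    · exact (Real.fourierIntegral_convergent_iff z).2 (hball _)
    · exact (Real.fourierIntegral_convergent_iff z).2 (hball _)
  rw [hsub, hF _ (by linarith), hF _ (by linarith), ← mul_sub, ← Complex.ofReal_sub, norm_mul,
    Complex.norm_real, Complex.norm_real, Real.norm_of_nonneg hω, Real.norm_eq_abs]
  have h5 := hH (2 * Real.pi * ‖z‖) (by positivity) _ _ hsa hsab hsb
  have h6 : Real.sqrt b - Real.sqrt a ≤ b - a := by
    have e : b - a = (Real.sqrt b - Real.sqrt a) * (Real.sqrt b + Real.sqrt a) := by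
      ring_nf; rw [Real.sq_sqrt (by linarith), Real.sq_sqrt (by linarith)]
    nlinarith
  have h7 : (2 * Real.pi * ‖z‖) ^ (-((m : ℝ) / 2)) =
      (2 * Real.pi) ^ (-((m : ℝ) / 2)) * ‖z‖ ^ (-((m : ℝ) / 2)) :=
    Real.mul_rpow (by positivity) (by positivity)
  have h8 : (-((((m + 1 : ℕ) : ℝ) - 1) / 2)) = -((m : ℝ) / 2) := by push_cast; ring
  rw [h8]
  rw [h7] at h5
  have hb0 : 0 ≤ b - a := by linarith
  calc _ ≤ ω * (C * ((2 * Real.pi) ^ (-((m : ℝ) / 2)) * ‖z‖ ^ (-((m : ℝ) / 2))) * (b - a)) := by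
        gcongr
        exact h5.trans (by gcongr)
    _ = (ω * C * (2 * Real.pi) ^ (-((m : ℝ) / 2))) * (b - a) * ‖z‖ ^ (-((m : ℝ) / 2)) := by ring
    _ ≤ _ := by gcongr; linarith

end L2

section L3

lemma br_slice_len (c A δ : ℝ) (hc : 0 < c) (hδ : 0 ≤ δ) :
    volume {u : ℝ | c ^ 2 ≤ u ^ 2 ∧ A < u ^ 2 ∧ u ^ 2 ≤ A + δ} ≤ ENNReal.ofReal (δ / c) := by
  set A' := max A (c ^ 2) with hA'
  have h0 : c ^ 2 ≤ A' := le_max_right _ _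
  have hcs : c ≤ Real.sqrt A' := Real.le_sqrt_of_sq_le h0
  have hcs2 : c ≤ Real.sqrt (A' + δ) := Real.le_sqrt_of_sq_le (by linarith)
  have hsq := Real.sq_sqrt (show 0 ≤ A' by positivity)
  have hsq2 := Real.sq_sqrt (show 0 ≤ A' + δ by positivity)
  have hlen : Real.sqrt (A' + δ) - Real.sqrt A' ≤ δ / (2 * c) := by
    rw [le_div_iff₀ (by positivity)]
    have : Real.sqrt A' ≤ Real.sqrt (A' + δ) := Real.sqrt_le_sqrt (by linarith)
    nlinarith
  have hsub : {u : ℝ | c ^ 2 ≤ u ^ 2 ∧ A < u ^ 2 ∧ u ^ 2 ≤ A + δ} ⊆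
      Set.Icc (Real.sqrt A') (Real.sqrt (A' + δ)) ∪ Set.Icc (-Real.sqrt (A' + δ)) (-Real.sqrt A') := by
    rintro u ⟨h1, h2, h3⟩
    have h4 : Real.sqrt A' ≤ |u| := by
      rw [← Real.sqrt_sq_eq_abs]; exact Real.sqrt_le_sqrt (max_le h2.le h1)
    have h5 : |u| ≤ Real.sqrt (A' + δ) := by
      rw [← Real.sqrt_sq_eq_abs]
      exact Real.sqrt_le_sqrt (by linarith [le_max_left A (c ^ 2)])
    rcases le_total 0 u with h | h
    · rw [abs_of_nonneg h] at h4 h5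
      exact Or.inl ⟨h4, h5⟩
    · rw [abs_of_nonpos h] at h4 h5
      exact Or.inr ⟨by linarith, by linarith⟩
  refine (measure_mono hsub).trans ((measure_union_le _ _).trans ?_)
  rw [Real.volume_Icc, Real.volume_Icc, ← ENNReal.ofReal_add]
  · apply ENNReal.ofReal_le_ofReal
    have : δ / c = δ / (2 * c) + δ / (2 * c) := by field_simp; ring
    linarith
  · linarith [Real.sqrt_le_sqrt (show A' ≤ A' + δ by linarith)]
  · linarith [Real.sqrt_le_sqrt (show A' ≤ A' + δ by linarith)]

/-- the one dimensional Poisson weight -/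
noncomputable def brW (r w t : ℝ) : ℝ := r / (1 + r ^ 2 * (t - w) ^ 2)

lemma brW_nonneg (r w t : ℝ) (hr : 0 < r) : 0 ≤ brW r w t := by unfold brW; positivity

lemma brW_le (r w t : ℝ) (hr : 0 < r) : brW r w t ≤ r := by
  unfold brW
  apply div_le_self hr.le
  nlinarith [mul_nonneg (sq_nonneg r) (sq_nonneg (t - w))]

lemma brW_eq (r w t : ℝ) : brW r w t = r * (1 + (r * (t - w)) ^ 2)⁻¹ := by
  unfold brW; rw [mul_pow]; ring

lemma brW_cont (r w : ℝ) : Continuous (brW r w) := by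
  have : ∀ t, brW r w t = r * (1 + (r * (t - w)) ^ 2)⁻¹ := brW_eq r w
  rw [show brW r w = _ from funext this]
  have h : ∀ t : ℝ, 1 + (r * (t - w)) ^ 2 ≠ 0 := fun t => by positivity
  fun_prop (disch := exact h _)

lemma brW_integral (r w : ℝ) (hr : 0 < r) : ∫ t, brW r w t = Real.pi := by
  simp_rw [brW_eq]
  rw [integral_const_mul]
  have := integral_sub_right_eq_self (μ := (volume : Measure ℝ)) (fun t : ℝ => (1 + (r * t) ^ 2)⁻¹) w
  rw [this]
  have := Measure.integral_comp_mul_left (fun t : ℝ => (1 + t ^ 2)⁻¹) r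
  rw [this, integral_univ_inv_one_add_sq, abs_of_pos (by positivity), smul_eq_mul]
  field_simp

lemma brW_integrable (r w : ℝ) (hr : 0 < r) : Integrable (brW r w) := by
  rw [show brW r w = _ from funext (brW_eq r w)]
  refine Integrable.const_mul ?_ _
  have h2 : Integrable (fun t : ℝ => (1 + (r * t) ^ 2)⁻¹) :=
    integrable_inv_one_add_sq.comp_mul_left' hr.ne'
  exact h2.comp_sub_right w

lemma brW_lintegral_prod (m : ℕ) (r : ℝ) (hr : 0 < r) (w : Fin m → ℝ) :
    ∫⁻ η : Fin m → ℝ, ENNReal.ofReal (∏ j, brW r (w j) (η j)) = ENNReal.ofReal (Real.pi ^ m) := by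
  rw [← ofReal_integral_eq_lintegral_ofReal]
  · rw [integral_fintype_prod_volume_eq_prod (fun j => brW r (w j))]
    simp [brW_integral _ _ hr]
  · exact Integrable.fintype_prod (f := fun j => brW r (w j)) (fun j => brW_integrable r (w j) hr)
  · exact Eventually.of_forall fun η => Finset.prod_nonneg fun j _ => brW_nonneg _ _ _ hr

lemma br_L3_piece (m : ℕ) (i : Fin (m + 1)) (c a b r : ℝ) (hc : 0 < c) (hab : a ≤ b) (hr : 0 < r)
    (w : EuclideanSpace ℝ (Fin (m + 1))) :
    ∫⁻ ξ in brRing (m + 1) a b ∩ {ξ | c ^ 2 ≤ ξ i ^ 2}, ENNReal.ofReal (∏ j, brW r (w j) (ξ j)) ≤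
      ENNReal.ofReal ((b - a) / c * r * Real.pi ^ m) := by
  have hms : MeasurableSet (brRing (m + 1) a b ∩ {ξ | c ^ 2 ≤ ξ i ^ 2}) :=
    (brRing_meas _ _ _).inter (measurableSet_le measurable_const
      (by fun_prop : Measurable fun ξ : EuclideanSpace ℝ (Fin (m + 1)) => ξ i ^ 2))
  have hcont : Continuous fun ξ : EuclideanSpace ℝ (Fin (m + 1)) => ∏ j, brW r (w j) (ξ j) :=
    continuous_finsetProd _ fun j _ => (brW_cont _ _).comp (by fun_prop)
  have hmeas : Measurable ((brRing (m + 1) a b ∩ {ξ | c ^ 2 ≤ ξ i ^ 2}).indicator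
      (fun ξ => ENNReal.ofReal (∏ j, brW r (w j) (ξ j)))) :=
    Measurable.indicator (hcont.measurable.ennreal_ofReal) hms
  have hm2 : AEMeasurable (fun p => (brRing (m + 1) a b ∩ {ξ | c ^ 2 ≤ ξ i ^ 2}).indicator
      (fun ξ => ENNReal.ofReal (∏ j, brW r (w j) (ξ j))) (brSplit i p)) (volume.prod volume) :=
    (hmeas.comp (brSplit i).measurable).aemeasurable
  rw [← lintegral_indicator hms, ← (brSplit_mp i).lintegral_comp hmeas,
    lintegral_prod_symm _ hm2]
  have hin : ∀ η : Fin m → ℝ, ∫⁻ u : ℝ, (brRing (m + 1) a b ∩ {ξ | c ^ 2 ≤ ξ i ^ 2}).indicator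
      (fun ξ => ENNReal.ofReal (∏ j, brW r (w j) (ξ j))) (brSplit i (u, η)) ≤
      ENNReal.ofReal ((b - a) / c * r) * ENNReal.ofReal (∏ j, brW r (w (i.succAbove j)) (η j)) := by
    intro η
    have hP : 0 ≤ ∏ j, brW r (w (i.succAbove j)) (η j) :=
      Finset.prod_nonneg fun j _ => brW_nonneg _ _ _ hr
    calc _ ≤ ∫⁻ u : ℝ, ({u : ℝ | c ^ 2 ≤ u ^ 2 ∧ a - ∑ j, η j ^ 2 < u ^ 2 ∧
            u ^ 2 ≤ (a - ∑ j, η j ^ 2) + (b - a)}).indicator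
            (fun _ => ENNReal.ofReal (r * ∏ j, brW r (w (i.succAbove j)) (η j))) u := by
          refine lintegral_mono fun u => ?_
          by_cases hu : brSplit i (u, η) ∈ brRing (m + 1) a b ∩ {ξ | c ^ 2 ≤ ξ i ^ 2}
          · rw [Set.indicator_of_mem hu, Set.indicator_of_mem]
            · apply ENNReal.ofReal_le_ofReal
              rw [Fin.prod_univ_succAbove _ i]
              simp only [brSplit_same, brSplit_succAbove]
              gcongr
              exact brW_le _ _ _ hr
            · obtain ⟨⟨h1, h2⟩, h3⟩ := hu
              rw [brSplit_norm] at h1 h2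
              have h3' : c ^ 2 ≤ (brSplit i (u, η) i) ^ 2 := h3
              rw [brSplit_same] at h3'
              simp only at h1 h2 h3'
              exact ⟨h3', by linarith, by linarith⟩
          · rw [Set.indicator_of_notMem hu]; exact zero_le
      _ ≤ ENNReal.ofReal (r * ∏ j, brW r (w (i.succAbove j)) (η j)) * ENNReal.ofReal ((b - a) / c) := by
          refine (lintegral_indicator_const_le _ _).trans ?_
          gcongr
          exact br_slice_len c _ (b - a) hc (by linarith)
      _ = _ := by
          rw [← ENNReal.ofReal_mul (by positivity), ← ENNReal.ofReal_mul (by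
            have : 0 ≤ b - a := by linarith
            positivity)]
          congr 1; ring
  refine (lintegral_mono hin).trans ?_
  rw [lintegral_const_mul' _ _ (by simp), brW_lintegral_prod _ _ hr (fun j => w (i.succAbove j)),
    ← ENNReal.ofReal_mul (by
            have : 0 ≤ b - a := by linarith
            positivity)]

lemma br_L3 (n : ℕ) (hn : 2 ≤ n) : ∃ C : ℝ, 0 < C ∧ ∀ a b r : ℝ, 1 / 4 ≤ a → a ≤ b → 0 < r →
    ∀ w : EuclideanSpace ℝ (Fin n),
    ∫⁻ ξ in brRing n a b, ENNReal.ofReal (∏ j, brW r (w j) (ξ j)) ≤ ENNReal.ofReal (C * (b - a) * r) := by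
  obtain ⟨m, rfl⟩ : ∃ m, n = m + 1 := ⟨n - 1, by omega⟩
  set c : ℝ := Real.sqrt (1 / 4 / (m + 1)) with hc
  have hc0 : 0 < c := by positivity
  have hc2 : c ^ 2 = 1 / 4 / (m + 1) := Real.sq_sqrt (by positivity)
  refine ⟨(m + 1) * (Real.pi ^ m / c), by positivity, fun a b r ha hab hr w => ?_⟩
  have hcov : brRing (m + 1) a b ⊆ ⋃ i : Fin (m + 1), brRing (m + 1) a b ∩ {ξ | c ^ 2 ≤ ξ i ^ 2} := by
    intro ξ hξ
    rw [Set.mem_iUnion]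
    by_contra hcon
    push Not at hcon
    have h1 : ∀ i, ξ i ^ 2 < c ^ 2 := fun i => by
      by_contra h; exact hcon i ⟨hξ, not_lt.1 h⟩
    have h2 : ‖ξ‖ ^ 2 < 1 / 4 := by
      rw [EuclideanSpace.norm_sq_eq]
      calc _ < ∑ i : Fin (m + 1), c ^ 2 := by
            apply Finset.sum_lt_sum_of_nonempty Finset.univ_nonempty
            intro i _; rw [Real.norm_eq_abs, sq_abs]; exact h1 i
        _ = _ := by rw [hc2]; simp; field_simp
    linarith [hξ.1]
  refine (lintegral_mono_set hcov).trans ((lintegral_iUnion_le _ _).trans ?_)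
  rw [tsum_fintype]
  refine (Finset.sum_le_sum fun i _ => br_L3_piece m i c a b r hc0 hab hr w).trans ?_
  rw [Finset.sum_const, Finset.card_univ, Fintype.card_fin, nsmul_eq_mul, ← ENNReal.ofReal_natCast,
    ← ENNReal.ofReal_mul (by positivity)]
  apply le_of_eq; congr 1; push_cast; ring

end L3

section L4

lemma br_CS {X : Type*} [MeasurableSpace X] {μ : Measure X} {f g : X → ℝ≥0∞} (hf : AEMeasurable f μ)
    (hg : AEMeasurable g μ) : (∫⁻ x, f x * g x ∂μ) ^ 2 ≤ (∫⁻ x, f x ^ 2 ∂μ) * ∫⁻ x, g x ^ 2 ∂μ := by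
  have h := ENNReal.lintegral_mul_le_Lp_mul_Lq μ Real.HolderConjugate.two_two hf hg
  simp only [Pi.mul_apply, ENNReal.rpow_two] at h
  calc _ ≤ ((∫⁻ x, f x ^ 2 ∂μ) ^ (1 / 2 : ℝ) * (∫⁻ x, g x ^ 2 ∂μ) ^ (1 / 2 : ℝ)) ^ 2 := by gcongr
    _ = _ := by
      rw [mul_pow, ← ENNReal.rpow_natCast, ← ENNReal.rpow_natCast, ← ENNReal.rpow_mul,
        ← ENNReal.rpow_mul]
      norm_num

variable {V : Type*} [NormedAddCommGroup V] [InnerProductSpace ℝ V] [FiniteDimensional ℝ V]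
  [MeasurableSpace V] [BorelSpace V]

lemma br_fourier_shift_conj {u : V → ℂ} (x ξ : V) :
    𝓕 (fun y => (starRingEnd ℂ) (u (x - y))) ξ =
      Complex.exp (↑(-2 * Real.pi * ⟪ξ, x⟫) * I) * (starRingEnd ℂ) (𝓕 u ξ) := by
  rw [Real.fourier_eq', Real.fourier_eq', ← integral_conj, ← integral_const_mul]
  rw [← integral_sub_left_eq_self _ volume x]
  refine integral_congr_ae (Eventually.of_forall fun y => ?_)
  simp only [sub_sub_cancel, smul_eq_mul, map_mul, ← Complex.exp_conj, conj_I, conj_ofReal, ← mul_assoc,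
    ← Complex.exp_add]
  congr 2
  rw [inner_sub_left, real_inner_comm x ξ]
  push_cast; ring

lemma br_quad {m u : V → ℂ} (hm : Integrable m) (hu : Integrable u) (K : ℝ)
    (hK : ∀ z, ‖𝓕 m z‖ ≤ K) :
    ‖∫ ξ, m ξ * ((‖𝓕 u ξ‖ ^ 2 : ℝ) : ℂ)‖ₑ ≤ ENNReal.ofReal K * (∫⁻ x, ‖u x‖ₑ) ^ 2 := by
  have hcu := br_fourier_continuous hu
  have hh : Integrable (fun ξ => m ξ * (starRingEnd ℂ) (𝓕 u ξ)) := by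
    refine hm.mul_bdd (c := ∫ x, ‖u x‖) (by fun_prop) ?_
    refine Eventually.of_forall fun ξ => ?_
    rw [RCLike.norm_conj]; exact br_fourier_norm_le ξ
  have e1 : ∫ ξ, m ξ * ((‖𝓕 u ξ‖ ^ 2 : ℝ) : ℂ) = ∫ ξ, 𝓕 u ξ * (m ξ * (starRingEnd ℂ) (𝓕 u ξ)) := by
    refine integral_congr_ae (Eventually.of_forall fun ξ => ?_)
    have := Complex.mul_conj' (𝓕 u ξ)
    simp only
    push_cast
    rw [← this]; ring
  rw [e1, br_fourier_mul_flip hu hh]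
  have hb : ∀ x, ‖𝓕 (fun ξ => m ξ * (starRingEnd ℂ) (𝓕 u ξ)) x‖ₑ ≤ ENNReal.ofReal K * ∫⁻ y, ‖u y‖ₑ := by
    intro x
    have hx : Integrable (fun y => (starRingEnd ℂ) (u (x - y))) := by
      have := hu.comp_sub_left x
      exact this.mono (Complex.continuous_conj.comp_aestronglyMeasurable this.aestronglyMeasurable)
        (Eventually.of_forall fun y => by rw [RCLike.norm_conj])
    have e2 : 𝓕 (fun ξ => m ξ * (starRingEnd ℂ) (𝓕 u ξ)) x = ∫ y, (starRingEnd ℂ) (u (x - y)) * 𝓕 m y := by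
      rw [← br_fourier_mul_flip hx hm, Real.fourier_eq']
      refine integral_congr_ae (Eventually.of_forall fun ξ => ?_)
      simp only [br_fourier_shift_conj, smul_eq_mul]
      ring
    rw [e2]
    refine (enorm_integral_le_lintegral_enorm _).trans ?_
    calc _ ≤ ∫⁻ y, ENNReal.ofReal K * ‖u (x - y)‖ₑ := by
          refine lintegral_mono fun y => ?_
          rw [enorm_mul, mul_comm]
          gcongr
          · rw [← ofReal_norm]; exact ENNReal.ofReal_le_ofReal (hK y)
          · rw [RCLike.enorm_conj]
      _ = _ := by
          rw [lintegral_const_mul' _ _ (by simp), lintegral_sub_left_eq_self (fun y => ‖u y‖ₑ) x]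
  refine (enorm_integral_le_lintegral_enorm _).trans ?_
  calc _ ≤ ∫⁻ x, ‖u x‖ₑ * (ENNReal.ofReal K * ∫⁻ y, ‖u y‖ₑ) := by
        refine lintegral_mono fun x => ?_
        rw [enorm_mul]; gcongr; exact hb x
    _ = _ := by
        rw [lintegral_mul_const'' _ hu.aestronglyMeasurable.enorm]; ring

/-- A smooth cutoff and its (dilated) inverse Fourier transform. -/
lemma br_cutoff (n : ℕ) : ∃ (χ : EuclideanSpace ℝ (Fin n) → ℂ) (C : ℝ), 0 < C ∧
    (∀ z, ‖z‖ ≤ 1 → χ z = 1) ∧ (∀ z, ‖1 - χ z‖ ≤ 1) ∧ ∀ r : ℝ, 0 < r →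
    ∃ Φ : EuclideanSpace ℝ (Fin n) → ℂ, Integrable Φ ∧ Continuous Φ ∧
      (∀ z, 𝓕 Φ z = χ (r⁻¹ • z)) ∧ ∀ x, ‖Φ x‖ ≤ C * ∏ j, brW r 0 (x j) := by
  let b : ContDiffBump (0 : EuclideanSpace ℝ (Fin n)) := ⟨1, 2, by norm_num, by norm_num⟩
  let χ : EuclideanSpace ℝ (Fin n) → ℂ := fun z => (b z : ℂ)
  have hχc : HasCompactSupport χ := b.hasCompactSupport.comp_left (g := fun t : ℝ => (t : ℂ)) rfl
  have hχs : ContDiff ℝ ((⊤ : ℕ∞) : WithTop ℕ∞) χ := Complex.ofRealCLM.contDiff.comp b.contDiff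
  let χS : SchwartzMap (EuclideanSpace ℝ (Fin n)) ℂ := hχc.toSchwartzMap hχs
  let Ψ : SchwartzMap (EuclideanSpace ℝ (Fin n)) ℂ := 𝓕⁻ χS
  have hΨ : 𝓕 (Ψ : EuclideanSpace ℝ (Fin n) → ℂ) = χ := by
    rw [← SchwartzMap.fourier_coe]
    have : 𝓕 Ψ = χS := FourierTransform.fourier_fourierInv_eq χS
    rw [this]; rfl
  obtain ⟨C, hC⟩ : ∃ C, 0 < C ∧ ∀ x, ‖Ψ x‖ ≤ C * ∏ j, (1 + x j ^ 2)⁻¹ := by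
    obtain ⟨C1, h1⟩ := Ψ.decay 0 0
    obtain ⟨C2, h2⟩ := Ψ.decay (2 * n) 0
    refine ⟨2 ^ n * (C1 + C2), by
      have := h1.1; have := h2.1; positivity, fun x => ?_⟩
    have hp : 0 < ∏ j, (1 + x j ^ 2) := Finset.prod_pos fun j _ => by positivity
    rw [Finset.prod_inv_distrib, ← div_eq_mul_inv, le_div_iff₀ hp]
    have hle : ∏ j, (1 + x j ^ 2) ≤ (1 + ‖x‖ ^ 2) ^ n := by
      calc _ ≤ ∏ j : Fin n, (1 + ‖x‖ ^ 2) := by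
            refine Finset.prod_le_prod (fun j _ => by positivity) fun j _ => ?_
            have := PiLp.norm_apply_le x j
            rw [Real.norm_eq_abs] at this
            have h3 := pow_le_pow_left₀ (abs_nonneg _) this 2
            rw [sq_abs] at h3
            linarith
        _ = _ := by simp
    have hle2 : (1 + ‖x‖ ^ 2) ^ n ≤ 2 ^ n * (1 + ‖x‖ ^ (2 * n)) := by
      rcases le_total (‖x‖ ^ 2) 1 with h | h
      · calc (1 + ‖x‖ ^ 2) ^ n ≤ 2 ^ n := by gcongr; linarith
          _ ≤ 2 ^ n * (1 + ‖x‖ ^ (2 * n)) := by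
            apply le_mul_of_one_le_right (by positivity)
            have : 0 ≤ ‖x‖ ^ (2 * n) := by positivity
            linarith
      · calc (1 + ‖x‖ ^ 2) ^ n ≤ (2 * ‖x‖ ^ 2) ^ n := by gcongr; linarith
          _ = 2 ^ n * ‖x‖ ^ (2 * n) := by rw [mul_pow, ← pow_mul]
          _ ≤ _ := by gcongr; linarith
    have a1 := h1.2 x
    have a2 := h2.2 x
    simp only [norm_iteratedFDeriv_zero, pow_zero, one_mul] at a1 a2
    calc _ ≤ ‖Ψ x‖ * (2 ^ n * (1 + ‖x‖ ^ (2 * n))) := by gcongr; exact hle.trans hle2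
      _ = 2 ^ n * (‖Ψ x‖ + ‖x‖ ^ (2 * n) * ‖Ψ x‖) := by ring
      _ ≤ _ := by gcongr
  refine ⟨χ, C, hC.1, fun z hz => ?_, fun z => ?_, fun r hr => ?_⟩
  · have : b z = 1 := b.one_of_mem_closedBall (by rw [mem_closedBall_zero_iff]; exact hz)
    simp [χ, this]
  · have h0 := b.nonneg (x := z)
    have h1 := b.le_one (x := z)
    have : (1 : ℂ) - χ z = ((1 - b z : ℝ) : ℂ) := by simp [χ]
    rw [this, Complex.norm_real, Real.norm_of_nonneg (by linarith)]
    linarith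
  refine ⟨fun x => (r ^ n : ℝ) * Ψ (r • x), ?_, ?_, fun z => ?_, fun x => ?_⟩
  · exact ((integrable_comp_smul_iff volume _ hr.ne').2 Ψ.integrable).const_mul _
  · have := Ψ.continuous
    fun_prop
  · rw [← hΨ, Real.fourier_eq', Real.fourier_eq']
    have h3 := Measure.integral_comp_smul (volume : Measure (EuclideanSpace ℝ (Fin n)))
      (fun v => Complex.exp (↑(-2 * Real.pi * ⟪v, r⁻¹ • z⟫) * I) • Ψ v) r
    rw [finrank_euclideanSpace_fin, abs_of_pos (by positivity)] at h3
    rw [show (∫ v, Complex.exp (↑(-2 * Real.pi * ⟪v, r⁻¹ • z⟫) * I) • Ψ v) = (r ^ n : ℝ) • ∫ x,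
        Complex.exp (↑(-2 * Real.pi * ⟪r • x, r⁻¹ • z⟫) * I) • Ψ (r • x) by
      rw [h3, smul_smul, mul_inv_cancel₀ (by positivity), one_smul], ← integral_smul]
    refine integral_congr_ae (Eventually.of_forall fun v => ?_)
    have e1 : ⟪r • v, r⁻¹ • z⟫ = ⟪v, z⟫ := by
      rw [real_inner_smul_left, real_inner_smul_right]
      field_simp
    simp only [e1, smul_eq_mul, real_smul]
    ring
  · rw [norm_mul, Complex.norm_real, Real.norm_of_nonneg (by positivity)]
    calc _ ≤ r ^ n * (C * ∏ j, (1 + (r • x) j ^ 2)⁻¹) := by gcongr; exact hC.2 _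
      _ = C * ((∏ j : Fin n, r) * ∏ j, (1 + (r • x) j ^ 2)⁻¹) := by simp; ring
      _ = _ := by
        rw [← Finset.prod_mul_distrib]
        congr 1
        refine Finset.prod_congr rfl fun j _ => ?_
        rw [brW_eq]; simp

end L4

section L4b

lemma br_L1_sq {X : Type*} [MeasurableSpace X] {ν : Measure X} (E : Set X) (hE : MeasurableSet E) (μ : ℝ≥0∞)
    (hμ : ν E ≤ μ) {u : X → ℂ} (hu : AEStronglyMeasurable u ν) (h0 : ∀ x, x ∉ E → u x = 0) :
    (∫⁻ x, ‖u x‖ₑ ∂ν) ^ 2 ≤ μ * ∫⁻ x, ‖u x‖ₑ ^ 2 ∂ν := by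
  have h1 : ∀ x, ‖u x‖ₑ = E.indicator (fun _ => (1 : ℝ≥0∞)) x * ‖u x‖ₑ := by
    intro x
    by_cases hx : x ∈ E
    · rw [Set.indicator_of_mem hx, one_mul]
    · rw [h0 x hx]; simp
  calc (∫⁻ x, ‖u x‖ₑ ∂ν) ^ 2 = (∫⁻ x, E.indicator (fun _ => (1 : ℝ≥0∞)) x * ‖u x‖ₑ ∂ν) ^ 2 := by
        congr 1; exact lintegral_congr h1
    _ ≤ _ := br_CS ((measurable_const.indicator hE).aemeasurable) hu.enorm
    _ ≤ _ := by
        gcongr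
        have : ∀ x, E.indicator (fun _ => (1 : ℝ≥0∞)) x ^ 2 = E.indicator (fun _ => (1 : ℝ≥0∞)) x := by
          intro x
          by_cases hx : x ∈ E
          · rw [Set.indicator_of_mem hx, one_pow]
          · rw [Set.indicator_of_notMem hx]; simp
        simp_rw [this]
        rw [lintegral_indicator_const hE, one_mul]; exact hμ

lemma br_ring_one_integrable (n : ℕ) (a b : ℝ) :
    Integrable ((brRing n a b).indicator (fun _ => (1 : ℂ))) :=
  (integrable_indicator_iff (brRing_meas n a b)).2 (integrableOn_const (brRing_fin n a b).ne (by simp))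

open scoped Convolution in
lemma br_L4 (n : ℕ) (hn : 2 ≤ n) : ∃ C : ℝ, 0 < C ∧ ∀ a b : ℝ, 1 / 4 ≤ a → a ≤ b → b ≤ 9 →
    ∀ (E : Set (EuclideanSpace ℝ (Fin n))) (μ : ℝ), MeasurableSet E → 0 < μ → volume E ≤ ENNReal.ofReal μ →
    ∀ u : EuclideanSpace ℝ (Fin n) → ℂ, Integrable u → MemLp u 2 → (∀ x, x ∉ E → u x = 0) →
    ∫⁻ ξ in brRing n a b, ‖𝓕 u ξ‖ₑ ^ 2 ≤
      ENNReal.ofReal (C * (b - a) * μ ^ (2 / ((n : ℝ) + 1))) * ∫⁻ x, ‖u x‖ₑ ^ 2 := by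
  obtain ⟨C2, hC2, hker⟩ := br_ring_kernel n hn
  obtain ⟨C3, hC3, hL3⟩ := br_L3 n hn
  obtain ⟨χ, Cχ, hCχ, hχ1, hχ2, hΦ⟩ := br_cutoff n
  refine ⟨Cχ * C3 + C2, by positivity, fun a b ha hab hb E μ hE hμ hEμ u hu hu2 h0 => ?_⟩
  have hba : 0 ≤ b - a := by linarith
  have hn1 : (0 : ℝ) < (n : ℝ) + 1 := by positivity
  have hn2 : (2 : ℝ) ≤ n := by exact_mod_cast hn
  set r : ℝ := μ ^ (2 / ((n : ℝ) + 1)) with hr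
  have hr0 : 0 < r := by positivity
  obtain ⟨Φ, hΦi, hΦc, hΦF, hΦb⟩ := hΦ r hr0
  set m := (brRing n a b).indicator (fun _ => (1 : ℂ)) with hm
  have hmi : Integrable m := br_ring_one_integrable n a b
  set m1 := m ⋆[ContinuousLinearMap.mul ℂ ℂ] Φ with hm1
  have hm1i : Integrable m1 := hmi.integrable_convolution _ hΦi
  have hcu := br_fourier_continuous hu
  have hF1 : ∀ z, 𝓕 m1 z = 𝓕 m z * χ (r⁻¹ • z) := fun z => by
    rw [hm1, Real.fourier_mul_convolution_eq hmi hΦi, hΦF]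
  -- bound on m1
  have hm1b : ∀ w, ‖m1 w‖ₑ ≤ ENNReal.ofReal (Cχ * C3 * (b - a) * r) := by
    intro w
    rw [hm1, convolution_def]
    refine (enorm_integral_le_lintegral_enorm _).trans ?_
    calc _ ≤ ∫⁻ ξ, (brRing n a b).indicator (fun ξ => ENNReal.ofReal Cχ *
            ENNReal.ofReal (∏ j, brW r (w j) (ξ j))) ξ := by
          refine lintegral_mono fun ξ => ?_
          by_cases hξ : ξ ∈ brRing n a b
          · rw [hm, Set.indicator_of_mem hξ, Set.indicator_of_mem hξ]
            simp only [ContinuousLinearMap.mul_apply', one_mul]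
            rw [← ENNReal.ofReal_mul hCχ.le, ← ofReal_norm]
            apply ENNReal.ofReal_le_ofReal
            refine (hΦb _).trans (le_of_eq ?_)
            congr 1
            refine Finset.prod_congr rfl fun j _ => ?_
            unfold brW
            simp only [PiLp.sub_apply, sub_zero]
            rw [← neg_sub, neg_sq]
          · rw [hm, Set.indicator_of_notMem hξ]
            simp
      _ ≤ _ := by
          rw [lintegral_indicator (brRing_meas n a b), lintegral_const_mul' _ _ (by simp)]
          refine (mul_le_mul_right (hL3 a b r ha hab hr0 w) _).trans ?_
          rw [← ENNReal.ofReal_mul hCχ.le]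
          apply le_of_eq; congr 1; ring
  -- bound on fourier of m - m1
  have hsub : ∀ z, 𝓕 (m - m1) z = 𝓕 m z * (1 - χ (r⁻¹ • z)) := by
    intro z
    have : 𝓕 (m - m1) z = 𝓕 m z - 𝓕 m1 z := by
      simp only [Real.fourier_eq, Pi.sub_apply, smul_sub]
      rw [integral_sub]
      · exact (Real.fourierIntegral_convergent_iff z).2 hmi
      · exact (Real.fourierIntegral_convergent_iff z).2 hm1i
    rw [this, hF1]; ring
  have hK : ∀ z, ‖𝓕 (m - m1) z‖ ≤ C2 * (b - a) * r ^ (-(((n : ℝ) - 1) / 2)) := by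
    intro z
    rw [hsub, norm_mul]
    rcases le_or_gt ‖z‖ r with h | h
    · have : ‖r⁻¹ • z‖ ≤ 1 := by
        rw [norm_smul, norm_inv, Real.norm_of_nonneg hr0.le, inv_mul_le_iff₀ hr0, mul_one]; exact h
      rw [hχ1 _ this]; simp only [sub_self, norm_zero, mul_zero]; positivity
    · have hz : z ≠ 0 := norm_pos_iff.1 (hr0.trans h)
      calc _ ≤ (C2 * (b - a) * ‖z‖ ^ (-(((n : ℝ) - 1) / 2))) * 1 := by
            gcongr
            · exact hker a b ha hab hb z hz
            · exact hχ2 _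
        _ ≤ _ := by
            rw [mul_one]
            gcongr ?_ * ?_
            exact Real.rpow_le_rpow_of_nonpos hr0 h.le (by linarith)
  have hbdd : ∀ᵐ ξ : EuclideanSpace ℝ (Fin n), ‖((‖𝓕 u ξ‖ ^ 2 : ℝ) : ℂ)‖ ≤ (∫ x, ‖u x‖) ^ 2 := by
    refine Eventually.of_forall fun ξ => ?_
    rw [Complex.norm_real, Real.norm_of_nonneg (by positivity)]
    gcongr; exact br_fourier_norm_le ξ
  have hms : AEStronglyMeasurable (fun ξ => ((‖𝓕 u ξ‖ ^ 2 : ℝ) : ℂ))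
      (volume : Measure (EuclideanSpace ℝ (Fin n))) :=
    Continuous.aestronglyMeasurable (by fun_prop)
  have hi1 : Integrable (fun ξ => m1 ξ * ((‖𝓕 u ξ‖ ^ 2 : ℝ) : ℂ)) := hm1i.mul_bdd hms hbdd
  have hi2 : Integrable (fun ξ => (m - m1) ξ * ((‖𝓕 u ξ‖ ^ 2 : ℝ) : ℂ)) := (hmi.sub hm1i).mul_bdd hms hbdd
  have hi0 : IntegrableOn (fun ξ => ‖𝓕 u ξ‖ ^ 2) (brRing n a b) := by
    have := (hmi.mul_bdd hms hbdd).norm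
    rw [← integrable_indicator_iff (brRing_meas n a b)]
    refine this.congr (Eventually.of_forall fun ξ => ?_)
    by_cases hξ : ξ ∈ brRing n a b
    · simp only [hm]; rw [Set.indicator_of_mem hξ, Set.indicator_of_mem hξ]; simp
    · simp only [hm]; rw [Set.indicator_of_notMem hξ, Set.indicator_of_notMem hξ]; simp
  have e0 : ∫⁻ ξ in brRing n a b, ‖𝓕 u ξ‖ₑ ^ 2 = ‖∫ ξ, m ξ * ((‖𝓕 u ξ‖ ^ 2 : ℝ) : ℂ)‖ₑ := by
    have h1 : ∫ ξ, m ξ * ((‖𝓕 u ξ‖ ^ 2 : ℝ) : ℂ) = ((∫ ξ in brRing n a b, ‖𝓕 u ξ‖ ^ 2 : ℝ) : ℂ) := by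
      rw [← integral_complex_ofReal, ← integral_indicator (brRing_meas n a b)]
      refine integral_congr_ae (Eventually.of_forall fun ξ => ?_)
      by_cases hξ : ξ ∈ brRing n a b
      · simp only [hm]; rw [Set.indicator_of_mem hξ, Set.indicator_of_mem hξ]; simp
      · simp only [hm]; rw [Set.indicator_of_notMem hξ, Set.indicator_of_notMem hξ]; simp
    rw [h1, ← ofReal_norm, Complex.norm_real, Real.norm_of_nonneg (by positivity),
      ofReal_integral_eq_lintegral_ofReal hi0 (Eventually.of_forall fun ξ => by positivity)]
    refine lintegral_congr fun ξ => ?_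
    rw [ENNReal.ofReal_pow (norm_nonneg _), ofReal_norm]
  have e1 : ∫ ξ, m ξ * ((‖𝓕 u ξ‖ ^ 2 : ℝ) : ℂ) = (∫ ξ, m1 ξ * ((‖𝓕 u ξ‖ ^ 2 : ℝ) : ℂ)) +
      ∫ ξ, (m - m1) ξ * ((‖𝓕 u ξ‖ ^ 2 : ℝ) : ℂ) := by
    rw [← integral_add hi1 hi2]
    refine integral_congr_ae (Eventually.of_forall fun ξ => ?_)
    simp only [Pi.sub_apply]; ring
  have b1 : ‖∫ ξ, m1 ξ * ((‖𝓕 u ξ‖ ^ 2 : ℝ) : ℂ)‖ₑ ≤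
      ENNReal.ofReal (Cχ * C3 * (b - a) * r) * ∫⁻ x, ‖u x‖ₑ ^ 2 := by
    refine (enorm_integral_le_lintegral_enorm _).trans ?_
    rw [← br_plancherel hu hu2, ← lintegral_const_mul' _ _ (by simp)]
    refine lintegral_mono fun ξ => ?_
    rw [enorm_mul]
    refine mul_le_mul' (hm1b ξ) (le_of_eq ?_)
    rw [← ofReal_norm, Complex.norm_real, Real.norm_of_nonneg (by positivity),
      ENNReal.ofReal_pow (norm_nonneg _), ofReal_norm]
  have b2 : ‖∫ ξ, (m - m1) ξ * ((‖𝓕 u ξ‖ ^ 2 : ℝ) : ℂ)‖ₑ ≤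
      ENNReal.ofReal (C2 * (b - a) * r) * ∫⁻ x, ‖u x‖ₑ ^ 2 := by
    refine (br_quad (hmi.sub hm1i) hu _ hK).trans ?_
    refine (mul_le_mul_right (br_L1_sq E hE _ hEμ hu.aestronglyMeasurable h0) _).trans ?_
    rw [← mul_assoc, ← ENNReal.ofReal_mul (by positivity)]
    apply le_of_eq; congr 2
    rw [mul_assoc]; congr 1
    rw [hr, ← Real.rpow_mul hμ.le]
    nth_rw 2 [← Real.rpow_one μ]
    rw [← Real.rpow_add hμ]
    congr 1; field_simp; ring
  rw [e0, e1]
  refine (enorm_add_le _ _).trans ((add_le_add b1 b2).trans ?_)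
  rw [← add_mul, ← ENNReal.ofReal_add (by positivity) (by positivity)]
  apply le_of_eq; congr 2; ring

end L4b

section L5

/-- The smooth frequency-localised operator. -/
noncomputable def brF {n : ℕ} (φ : ℝ → ℝ) (δ s : ℝ) (G : EuclideanSpace ℝ (Fin n) → ℂ)
    (x : EuclideanSpace ℝ (Fin n)) : ℂ :=
  𝓕⁻ (fun ξ => ((φ ((s - ‖ξ‖ ^ 2) / δ) : ℝ) : ℂ) * 𝓕 G ξ) x

lemma br_sq_cancel {X Q : ℝ≥0∞} (hX : X ≠ ∞) (h : X ^ 2 ≤ Q * X) : X ≤ Q := by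
  by_cases h0 : X = 0
  · rw [h0]; exact zero_le
  · rw [sq] at h
    exact (ENNReal.mul_le_mul_iff_left h0 hX).1 h

variable {n : ℕ}

lemma br_supp {φ : ℝ → ℝ} (hsupp : ∀ t, t ∉ Set.Icc (1 / 2 : ℝ) 2 → φ t = 0) {δ s : ℝ} (hδ : 0 < δ)
    {ξ : EuclideanSpace ℝ (Fin n)} (hξ : ξ ∉ brRing n (s - 3 * δ) s) : φ ((s - ‖ξ‖ ^ 2) / δ) = 0 := by
  apply hsupp
  intro ⟨h1, h2⟩
  rw [le_div_iff₀ hδ] at h1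
  rw [div_le_iff₀ hδ] at h2
  exact hξ ⟨by linarith, by linarith⟩

lemma br_mult_integrable {φ : ℝ → ℝ} (hφ : Continuous φ) (hsupp : ∀ t, t ∉ Set.Icc (1 / 2 : ℝ) 2 → φ t = 0)
    {A : ℝ} (hA : ∀ t, |φ t| ≤ A) {δ : ℝ} (hδ : 0 < δ) (s : ℝ) :
    Integrable (fun ξ : EuclideanSpace ℝ (Fin n) => ((φ ((s - ‖ξ‖ ^ 2) / δ) : ℝ) : ℂ)) := by
  have hc : Continuous fun ξ : EuclideanSpace ℝ (Fin n) => ((φ ((s - ‖ξ‖ ^ 2) / δ) : ℝ) : ℂ) := by fun_prop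
  refine ((br_ring_one_integrable n (s - 3 * δ) s).const_mul (A : ℂ)).mono hc.aestronglyMeasurable ?_
  refine Eventually.of_forall fun ξ => ?_
  by_cases hξ : ξ ∈ brRing n (s - 3 * δ) s
  · rw [Set.indicator_of_mem hξ, mul_one, Complex.norm_real, Complex.norm_real]
    exact (hA _).trans (le_abs_self A)
  · rw [br_supp hsupp hδ hξ, Complex.ofReal_zero, norm_zero]; positivity

lemma br_multG_integrable {φ : ℝ → ℝ} (hφ : Continuous φ) (hsupp : ∀ t, t ∉ Set.Icc (1 / 2 : ℝ) 2 → φ t = 0)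
    {A : ℝ} (hA : ∀ t, |φ t| ≤ A) {δ : ℝ} (hδ : 0 < δ) (s : ℝ) {G : EuclideanSpace ℝ (Fin n) → ℂ}
    (hG : Integrable G) :
    Integrable (fun ξ : EuclideanSpace ℝ (Fin n) => ((φ ((s - ‖ξ‖ ^ 2) / δ) : ℝ) : ℂ) * 𝓕 G ξ) :=
  (br_mult_integrable hφ hsupp hA hδ s).mul_bdd (br_fourier_continuous hG).aestronglyMeasurable
    (Eventually.of_forall fun ξ => br_fourier_norm_le ξ)

lemma br_fourierInv_eq {h : EuclideanSpace ℝ (Fin n) → ℂ} : 𝓕⁻ h = 𝓕 (fun ξ => h (-ξ)) := by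
  ext x
  rw [Real.fourierInv_eq_fourier_comp_neg]

lemma br_L5a (n : ℕ) (hn : 2 ≤ n) : ∃ C : ℝ, 0 < C ∧ ∀ (φ : ℝ → ℝ) (A : ℝ), Continuous φ →
    (∀ t, t ∉ Set.Icc (1 / 2 : ℝ) 2 → φ t = 0) → (∀ t, |φ t| ≤ A) → ∀ δ s : ℝ, 0 < δ → δ ≤ 1 / 4 →
    1 ≤ s → s ≤ 4 → ∀ G : EuclideanSpace ℝ (Fin n) → ℂ, Integrable G →
    ∀ (E : Set (EuclideanSpace ℝ (Fin n))) (μ : ℝ), MeasurableSet E → 0 < μ → volume E ≤ ENNReal.ofReal μ →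
    ∫⁻ x in E, ‖brF φ δ s G x‖ₑ ^ 2 ≤ ENNReal.ofReal (C * A ^ 2 * δ * μ ^ (2 / ((n : ℝ) + 1))) *
      ∫⁻ ξ in brRing n (s - 3 * δ) s, ‖𝓕 G ξ‖ₑ ^ 2 := by
  obtain ⟨C, hC, h4⟩ := br_L4 n hn
  refine ⟨C * 3, by positivity, fun φ A hφ hsupp hA δ s hδ hδ4 hs1 hs4 G hG E μ hE hμ hEμ => ?_⟩
  have hA0 : 0 ≤ A := (abs_nonneg _).trans (hA 0)
  set h : EuclideanSpace ℝ (Fin n) → ℂ := fun ξ => ((φ ((s - ‖ξ‖ ^ 2) / δ) : ℝ) : ℂ) * 𝓕 G ξ with hh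
  have hi : Integrable h := br_multG_integrable hφ hsupp hA hδ s hG
  have hi' : Integrable (fun ξ => h (-ξ)) := hi.comp_neg
  have hF : ∀ x, brF φ δ s G x = 𝓕 (fun ξ => h (-ξ)) x := fun x => by
    rw [brF, ← br_fourierInv_eq]
  set F := 𝓕 (fun ξ => h (-ξ)) with hFdef
  have hFc : Continuous F := br_fourier_continuous hi'
  have hFb : ∀ x, ‖F x‖ ≤ ∫ ξ, ‖h (-ξ)‖ := fun x => br_fourier_norm_le x
  set u : EuclideanSpace ℝ (Fin n) → ℂ := E.indicator (fun x => (starRingEnd ℂ) (F x)) with hu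
  have hEtop : volume E ≠ ∞ := (hEμ.trans_lt ENNReal.ofReal_lt_top).ne
  have hum : AEStronglyMeasurable u volume :=
    AEStronglyMeasurable.indicator (Continuous.aestronglyMeasurable (by fun_prop)) hE
  have hmem : ∀ p : ℝ≥0∞, MemLp u p := by
    intro p
    rw [hu, memLp_indicator_iff_restrict hE]
    have : IsFiniteMeasure (volume.restrict E) := ⟨by simpa using hEtop.lt_top⟩
    refine MemLp.of_bound (Continuous.aestronglyMeasurable (by fun_prop)) (∫ ξ, ‖h (-ξ)‖)
      (Eventually.of_forall fun x => ?_)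
    rw [RCLike.norm_conj]; exact hFb x
  have hu1 : Integrable u := memLp_one_iff_integrable.1 (hmem 1)
  have hU : ∫⁻ x, ‖u x‖ₑ ^ 2 = ∫⁻ x in E, ‖F x‖ₑ ^ 2 := by
    rw [← lintegral_indicator hE]
    refine lintegral_congr fun x => ?_
    by_cases hx : x ∈ E
    · rw [hu, Set.indicator_of_mem hx, Set.indicator_of_mem hx, RCLike.enorm_conj]
    · rw [hu, Set.indicator_of_notMem hx, Set.indicator_of_notMem hx]; simp
  have hUtop : ∫⁻ x in E, ‖F x‖ₑ ^ 2 ≠ ∞ := by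
    rw [← hU, ← br_eLp2_sq]
    exact (ENNReal.pow_lt_top (hmem 2).2).ne
  have e1 : ∫⁻ x in E, ‖F x‖ₑ ^ 2 = ‖∫ x, u x * F x‖ₑ := by
    have h1 : ∫ x, u x * F x = ((∫ x in E, ‖F x‖ ^ 2 : ℝ) : ℂ) := by
      rw [← integral_complex_ofReal, ← integral_indicator hE]
      refine integral_congr_ae (Eventually.of_forall fun x => ?_)
      by_cases hx : x ∈ E
      · simp only [hu]; rw [Set.indicator_of_mem hx, Set.indicator_of_mem hx, Complex.conj_mul']; simp
      · simp only [hu]; rw [Set.indicator_of_notMem hx, Set.indicator_of_notMem hx]; simp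
    have hIntg : Integrable (fun x => ‖F x‖ ^ 2) (volume.restrict E) := by
      have : IsFiniteMeasure (volume.restrict E) := ⟨by simpa using hEtop.lt_top⟩
      refine Integrable.of_bound (Continuous.aestronglyMeasurable (by fun_prop)) ((∫ ξ, ‖h (-ξ)‖) ^ 2)
        (Eventually.of_forall fun x => ?_)
      rw [Real.norm_of_nonneg (by positivity)]
      gcongr; exact hFb x
    rw [h1, ← ofReal_norm, Complex.norm_real, Real.norm_of_nonneg (by positivity),
      ofReal_integral_eq_lintegral_ofReal hIntg (Eventually.of_forall fun ξ => by positivity)]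
    refine lintegral_congr fun ξ => ?_
    rw [ENNReal.ofReal_pow (norm_nonneg _), ofReal_norm]
  have e2 : ∫⁻ x in E, ‖F x‖ₑ ^ 2 ≤ ∫⁻ ξ in brRing n (s - 3 * δ) s,
      ‖𝓕 u ξ‖ₑ * (ENNReal.ofReal A * ‖𝓕 G (-ξ)‖ₑ) := by
    rw [e1, hFdef, ← br_fourier_mul_flip hu1 hi']
    refine (enorm_integral_le_lintegral_enorm _).trans ?_
    rw [← lintegral_indicator (brRing_meas _ _ _)]
    refine lintegral_mono fun ξ => ?_
    by_cases hξ : ξ ∈ brRing n (s - 3 * δ) s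
    · rw [Set.indicator_of_mem hξ, enorm_mul, hh, enorm_mul]
      gcongr
      rw [← ofReal_norm, Complex.norm_real]
      exact ENNReal.ofReal_le_ofReal (hA _)
    · have : h (-ξ) = 0 := by
        simp only [hh, norm_neg]; rw [br_supp hsupp hδ hξ]; simp
      rw [this]; simp
  have hneg : ∫⁻ ξ in brRing n (s - 3 * δ) s, ‖𝓕 G (-ξ)‖ₑ ^ 2 =
      ∫⁻ ξ in brRing n (s - 3 * δ) s, ‖𝓕 G ξ‖ₑ ^ 2 := by
    rw [← lintegral_indicator (brRing_meas _ _ _), ← lintegral_indicator (brRing_meas _ _ _)]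
    rw [← lintegral_neg_eq_self]
    refine lintegral_congr fun ξ => ?_
    by_cases hξ : ξ ∈ brRing n (s - 3 * δ) s
    · have hξ' : -ξ ∈ brRing n (s - 3 * δ) s := by
        simpa only [brRing, Set.mem_ofPred_eq, norm_neg] using hξ
      rw [Set.indicator_of_mem hξ, Set.indicator_of_mem hξ', neg_neg]
    · have hξ' : -ξ ∉ brRing n (s - 3 * δ) s := by
        simpa only [brRing, Set.mem_ofPred_eq, norm_neg] using hξ
      rw [Set.indicator_of_notMem hξ, Set.indicator_of_notMem hξ']
  have hGc := br_fourier_continuous hG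
  have huc := br_fourier_continuous hu1
  simp_rw [hF]
  apply br_sq_cancel hUtop
  calc (∫⁻ x in E, ‖F x‖ₑ ^ 2) ^ 2 ≤ _ := pow_le_pow_left' e2 2
    _ ≤ _ := br_CS (Continuous.aemeasurable (by fun_prop))
      ((Continuous.aemeasurable (by fun_prop)).const_mul _)
    _ ≤ (ENNReal.ofReal (C * (s - (s - 3 * δ)) * μ ^ (2 / ((n : ℝ) + 1))) * ∫⁻ x, ‖u x‖ₑ ^ 2) *
        (ENNReal.ofReal (A ^ 2) * ∫⁻ ξ in brRing n (s - 3 * δ) s, ‖𝓕 G ξ‖ₑ ^ 2) := by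
        gcongr
        · exact h4 _ _ (by linarith) (by linarith) (by linarith) E μ hE hμ hEμ u hu1 (hmem 2)
            (fun x hx => by rw [hu, Set.indicator_of_notMem hx])
        · simp_rw [mul_pow]
          rw [lintegral_const_mul' _ _ (by simp), hneg, ENNReal.ofReal_pow hA0]
    _ = _ := by
        have hP : ENNReal.ofReal (C * 3 * A ^ 2 * δ * μ ^ (2 / ((n : ℝ) + 1))) =
            ENNReal.ofReal (C * (s - (s - 3 * δ)) * μ ^ (2 / ((n : ℝ) + 1))) * ENNReal.ofReal (A ^ 2) := by
          rw [← ENNReal.ofReal_mul' (by positivity)]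
          congr 1; ring
        rw [hU, hP]
        ring

end L5

section L5b

lemma br_sobolev (f f' : ℝ → ℂ) (hf : ∀ s, HasDerivAt f (f' s) s) (hf' : Continuous f') (δ : ℝ) (hδ : 0 < δ)
    (hδ4 : δ ≤ 1 / 4) (s : ℝ) (hs : s ∈ Set.Icc (1:ℝ) 4) :
    ‖f s‖ ^ 2 ≤ ∫ t in (1:ℝ)..4, (2 * δ⁻¹ * ‖f t‖ ^ 2 + δ * ‖f' t‖ ^ 2) := by
  have hfc : Continuous f := continuous_iff_continuousAt.2 fun s => (hf s).continuousAt
  set h : ℝ → ℝ := fun t => δ⁻¹ * ‖f t‖ ^ 2 + δ * ‖f' t‖ ^ 2 with hh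
  have hhc : Continuous h := by fun_prop
  have hg : ∀ t, HasDerivAt (fun t => ‖f t‖ ^ 2) (2 * ⟪f t, f' t⟫) t := fun t => (hf t).norm_sq
  have hb : ∀ t, |2 * ⟪f t, f' t⟫| ≤ h t := by
    intro t
    have h1 := abs_real_inner_le_norm (f t) (f' t)
    rw [abs_mul, abs_of_pos (by norm_num : (0:ℝ) < 2)]
    have h2 : 0 ≤ δ * (δ⁻¹ * ‖f t‖ - ‖f' t‖) ^ 2 := by positivity
    have h3 : δ * (δ⁻¹ * ‖f t‖ - ‖f' t‖) ^ 2 = h t - 2 * (‖f t‖ * ‖f' t‖) := by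
      simp only [hh]; field_simp; ring
    linarith
  have hgc : Continuous fun t => 2 * ⟪f t, f' t⟫ := by fun_prop
  have key : ∀ t ∈ Set.Icc (1:ℝ) 4, ‖f s‖ ^ 2 ≤ ‖f t‖ ^ 2 + ∫ t in (1:ℝ)..4, h t := by
    intro t ht
    have e := intervalIntegral.integral_eq_sub_of_hasDerivAt (a := t) (b := s) (fun x _ => hg x)
      (hgc.intervalIntegrable _ _)
    have h1 := intervalIntegral.norm_integral_le_abs_of_norm_le (a := t) (b := s) (μ := volume)
      (f := fun t => 2 * ⟪f t, f' t⟫) (g := h)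
      (Eventually.of_forall fun x => hb x) (hhc.intervalIntegrable _ _)
    have h2 := intervalIntegral.abs_integral_mono_interval (a := t) (b := s) (c := 1) (d := 4) (μ := volume)
      (f := h) (by
        rw [Set.uIoc_of_le (by norm_num : (1:ℝ) ≤ 4)]
        exact Set.Ioc_subset_Ioc (le_min ht.1 hs.1) (max_le ht.2 hs.2))
      (Eventually.of_forall fun x => by simp only [hh, Pi.zero_apply]; positivity) (hhc.intervalIntegrable _ _)
    have h3 : 0 ≤ ∫ t in (1:ℝ)..4, h t :=
      intervalIntegral.integral_nonneg (by norm_num) fun x _ => by simp only [hh]; positivity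
    rw [abs_of_nonneg h3] at h2
    rw [e] at h1
    have := (le_abs_self _).trans (h1.trans h2)
    linarith
  have hIntg := intervalIntegral.integral_mono_on (a := (1:ℝ)) (b := 4) (μ := volume) (by norm_num)
    (f := fun _ => ‖f s‖ ^ 2) (g := fun t => ‖f t‖ ^ 2 + ∫ t in (1:ℝ)..4, h t)
    (continuous_const.intervalIntegrable _ _) (Continuous.intervalIntegrable (by fun_prop) _ _) key
  rw [intervalIntegral.integral_const, intervalIntegral.integral_add
    (Continuous.intervalIntegrable (by fun_prop) _ _) (continuous_const.intervalIntegrable _ _),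
    intervalIntegral.integral_const, smul_eq_mul, smul_eq_mul] at hIntg
  have h4 : 0 ≤ ∫ t in (1:ℝ)..4, ‖f t‖ ^ 2 :=
    intervalIntegral.integral_nonneg (by norm_num) fun x _ => by positivity
  have e2 : ∫ t in (1:ℝ)..4, (2 * δ⁻¹ * ‖f t‖ ^ 2 + δ * ‖f' t‖ ^ 2) =
      δ⁻¹ * (∫ t in (1:ℝ)..4, ‖f t‖ ^ 2) + ∫ t in (1:ℝ)..4, h t := by
    rw [← intervalIntegral.integral_const_mul, ← intervalIntegral.integral_add
      (Continuous.intervalIntegrable (by fun_prop) _ _) (hhc.intervalIntegrable _ _)]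
    congr 1; ext t; simp only [hh]; ring
  rw [e2]
  have h5 : 1 ≤ δ⁻¹ := (one_le_inv₀ hδ).2 (by linarith)
  nlinarith

variable {n : ℕ}

lemma br_bound_local {φ : ℝ → ℝ} (hsupp : ∀ t, t ∉ Set.Icc (1 / 2 : ℝ) 2 → φ t = 0)
    {A : ℝ} (hA : ∀ t, |φ t| ≤ A) {δ : ℝ} (hδ : 0 < δ) {s M : ℝ} (hs : s ≤ M)
    {G : EuclideanSpace ℝ (Fin n) → ℂ} (x ξ : EuclideanSpace ℝ (Fin n)) :
    ‖Complex.exp (↑(2 * Real.pi * ⟪ξ, x⟫) * I) • (((φ ((s - ‖ξ‖ ^ 2) / δ) : ℝ) : ℂ) * 𝓕 G ξ)‖ ≤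
      (brRing n (-1) M).indicator (fun _ => A * ∫ x, ‖G x‖) ξ := by
  rw [norm_smul, Complex.norm_exp_ofReal_mul_I, one_mul, norm_mul, Complex.norm_real]
  have hA0 : 0 ≤ A := (abs_nonneg _).trans (hA 0)
  by_cases hξ : ξ ∈ brRing n (-1) M
  · rw [Set.indicator_of_mem hξ]
    gcongr
    · exact hA _
    · exact br_fourier_norm_le ξ
  · have : ξ ∉ brRing n (s - 3 * δ) s := by
      intro h
      exact hξ ⟨by nlinarith [norm_nonneg ξ], h.2.trans hs⟩
    rw [br_supp hsupp hδ this, Set.indicator_of_notMem hξ]; simp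

lemma brF_continuous {φ : ℝ → ℝ} (hφ : Continuous φ) (hsupp : ∀ t, t ∉ Set.Icc (1 / 2 : ℝ) 2 → φ t = 0)
    {A : ℝ} (hA : ∀ t, |φ t| ≤ A) {δ : ℝ} (hδ : 0 < δ) {G : EuclideanSpace ℝ (Fin n) → ℂ}
    (hG : Integrable G) :
    Continuous fun p : ℝ × EuclideanSpace ℝ (Fin n) => brF φ δ p.1 G p.2 := by
  have hGc := br_fourier_continuous hG
  rw [continuous_iff_continuousAt]
  rintro ⟨s0, x0⟩
  simp only [brF, Real.fourierInv_eq']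
  refine continuousAt_of_dominated (bound := (brRing n (-1) (s0 + 1)).indicator (fun _ => A * ∫ x, ‖G x‖))
    (Eventually.of_forall fun p => Continuous.aestronglyMeasurable (by fun_prop)) ?_ ?_ ?_
  · have : ∀ᶠ p : ℝ × EuclideanSpace ℝ (Fin n) in 𝓝 (s0, x0), p.1 < s0 + 1 :=
      (continuous_fst.tendsto (s0, x0)).eventually (Iio_mem_nhds (by simp))
    filter_upwards [this] with p hp
    exact Eventually.of_forall fun ξ => br_bound_local hsupp hA hδ hp.le p.2 ξ
  · exact (integrable_indicator_iff (brRing_meas _ _ _)).2 (integrableOn_const (brRing_fin _ _ _).ne enorm_ne_top)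
  · refine Eventually.of_forall fun ξ => Continuous.continuousAt (by fun_prop)

lemma brF_deriv {φ : ℝ → ℝ} (hφ : ContDiff ℝ 1 φ) (hsupp : ∀ t, t ∉ Set.Icc (1 / 2 : ℝ) 2 → φ t = 0)
    (hsupp' : ∀ t, t ∉ Set.Icc (1 / 2 : ℝ) 2 → deriv φ t = 0)
    {A : ℝ} (hA : ∀ t, |φ t| ≤ A) (hA' : ∀ t, |deriv φ t| ≤ A) {δ : ℝ} (hδ : 0 < δ)
    {G : EuclideanSpace ℝ (Fin n) → ℂ}
    (hG : Integrable G) (x : EuclideanSpace ℝ (Fin n)) (s : ℝ) :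
    HasDerivAt (fun s => brF φ δ s G x) ((δ⁻¹ : ℝ) * brF (deriv φ) δ s G x) s := by
  have hGc := br_fourier_continuous hG
  have hφc := hφ.continuous
  have hφ'c : Continuous (deriv φ) := hφ.continuous_deriv le_rfl
  simp only [brF, Real.fourierInv_eq']
  rw [← integral_const_mul]
  refine (hasDerivAt_integral_of_dominated_loc_of_deriv_le (s := Set.Iio (s + 1))
    (bound := fun ξ => δ⁻¹ * (brRing n (-1) (s + 1)).indicator (fun _ => A * ∫ x, ‖G x‖) ξ)
    (Iio_mem_nhds (by simp))
    (Eventually.of_forall fun p => Continuous.aestronglyMeasurable (by fun_prop)) ?_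
    (F' := fun s ξ => ((δ⁻¹ : ℝ) : ℂ) * Complex.exp (↑(2 * Real.pi * ⟪ξ, x⟫) * I) •
      (((deriv φ ((s - ‖ξ‖ ^ 2) / δ) : ℝ) : ℂ) * 𝓕 G ξ)) ?_ ?_ ?_ ?_).2
  · refine Integrable.mono' (g := (brRing n (-1) (s + 1)).indicator (fun _ => A * ∫ x, ‖G x‖)) ?_
      (Continuous.aestronglyMeasurable (by fun_prop))
      (Eventually.of_forall fun ξ => br_bound_local hsupp hA hδ (by linarith) x ξ)
    exact (integrable_indicator_iff (brRing_meas _ _ _)).2 (integrableOn_const (brRing_fin _ _ _).ne enorm_ne_top)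
  · exact Continuous.aestronglyMeasurable (by fun_prop)
  · refine Eventually.of_forall fun ξ t ht => ?_
    rw [norm_mul, Complex.norm_real, Real.norm_of_nonneg (by positivity)]
    gcongr
    exact br_bound_local hsupp' hA' hδ (le_of_lt ht) x ξ
  · exact ((integrable_indicator_iff (brRing_meas _ _ _)).2
      (integrableOn_const (brRing_fin _ _ _).ne enorm_ne_top)).const_mul _
  · refine Eventually.of_forall fun ξ t ht => ?_
    have h1 : HasDerivAt (fun t : ℝ => (t - ‖ξ‖ ^ 2) / δ) (1 / δ) t :=
      ((hasDerivAt_id t).sub_const _).div_const δ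
    have h2 := ((hφ.differentiable one_ne_zero _).hasDerivAt.comp t h1).ofReal_comp
    have h3 := (h2.mul_const (𝓕 G ξ)).const_mul (Complex.exp (↑(2 * Real.pi * ⟪ξ, x⟫) * I))
    refine h3.congr_deriv ?_
    simp only [smul_eq_mul]; push_cast; ring

lemma br_deriv_supp {φ : ℝ → ℝ} (hsupp : ∀ t, t ∉ Set.Icc (1 / 2 : ℝ) 2 → φ t = 0) :
    ∀ t, t ∉ Set.Icc (1 / 2 : ℝ) 2 → deriv φ t = 0 := by
  intro t ht
  have : φ =ᶠ[𝓝 t] fun _ => 0 := by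
    filter_upwards [isClosed_Icc.isOpen_compl.mem_nhds ht] with x hx using hsupp x hx
  rw [this.deriv_eq]; simp

lemma br_bdd_of_supp {φ : ℝ → ℝ} (hφ : Continuous φ) (hsupp : ∀ t, t ∉ Set.Icc (1 / 2 : ℝ) 2 → φ t = 0) :
    ∃ A : ℝ, 0 < A ∧ ∀ t, |φ t| ≤ A := by
  obtain ⟨A, hA⟩ := isCompact_Icc.exists_bound_of_continuousOn (hφ.continuousOn (s := Set.Icc (1 / 2 : ℝ) 2))
  refine ⟨|A| + 1, by positivity, fun t => ?_⟩
  by_cases ht : t ∈ Set.Icc (1 / 2 : ℝ) 2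
  · exact (hA t ht).trans (by linarith [le_abs_self A])
  · rw [hsupp t ht]; simp; positivity

lemma br_ring_avg (δ : ℝ) (hδ : 0 < δ) {H : EuclideanSpace ℝ (Fin n) → ℝ≥0∞} (hH : Measurable H) :
    ∫⁻ s in Set.Icc (1:ℝ) 4, ∫⁻ ξ in brRing n (s - 3 * δ) s, H ξ ≤ ENNReal.ofReal (3 * δ) * ∫⁻ ξ, H ξ := by
  have h1 : ∀ s, ∫⁻ ξ in brRing n (s - 3 * δ) s, H ξ = ∫⁻ ξ, {p : ℝ × EuclideanSpace ℝ (Fin n) |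
      p.1 - 3 * δ < ‖p.2‖ ^ 2 ∧ ‖p.2‖ ^ 2 ≤ p.1}.indicator (fun p => H p.2) (s, ξ) := by
    intro s
    rw [← lintegral_indicator (brRing_meas _ _ _)]
    rfl
  have hms : MeasurableSet {p : ℝ × EuclideanSpace ℝ (Fin n) |
      p.1 - 3 * δ < ‖p.2‖ ^ 2 ∧ ‖p.2‖ ^ 2 ≤ p.1} :=
    (measurableSet_lt (by fun_prop : Measurable fun p : ℝ × EuclideanSpace ℝ (Fin n) => p.1 - 3 * δ)
      (by fun_prop : Measurable fun p : ℝ × EuclideanSpace ℝ (Fin n) => ‖p.2‖ ^ 2)).inter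
    (measurableSet_le (by fun_prop : Measurable fun p : ℝ × EuclideanSpace ℝ (Fin n) => ‖p.2‖ ^ 2)
      measurable_fst)
  simp_rw [h1]
  rw [lintegral_lintegral_swap]
  · rw [← lintegral_const_mul' _ _ ENNReal.ofReal_ne_top]
    refine lintegral_mono fun ξ => ?_
    calc _ ≤ ∫⁻ s : ℝ, (Set.Icc (‖ξ‖ ^ 2) (‖ξ‖ ^ 2 + 3 * δ)).indicator (fun _ => H ξ) s := by
          refine (lintegral_mono' Measure.restrict_le_self le_rfl).trans ?_
          refine lintegral_mono fun s => ?_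
          by_cases hs : (s, ξ) ∈ {p : ℝ × EuclideanSpace ℝ (Fin n) |
            p.1 - 3 * δ < ‖p.2‖ ^ 2 ∧ ‖p.2‖ ^ 2 ≤ p.1}
          · rw [Set.indicator_of_mem hs, Set.indicator_of_mem]
            exact ⟨hs.2, by have := hs.1; simp only at this; linarith⟩
          · rw [Set.indicator_of_notMem hs]; exact zero_le
      _ = _ := by
          rw [lintegral_indicator_const measurableSet_Icc, Real.volume_Icc, mul_comm]
          congr 2; ring
  · exact (Measurable.indicator (hH.comp measurable_snd) hms).aemeasurable

end L5b

section L5c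

lemma br_sobolev_ennreal (f f' : ℝ → ℂ) (δ : ℝ) (hδ : 0 < δ)
    (hf : ∀ s, HasDerivAt f ((δ⁻¹ : ℝ) * f' s) s) (hf' : Continuous f')
    (hδ4 : δ ≤ 1 / 4) (s : ℝ) (hs : s ∈ Set.Icc (1:ℝ) 4) :
    ‖f s‖ₑ ^ 2 ≤ ∫⁻ t in Set.Icc (1:ℝ) 4,
      (ENNReal.ofReal (2 * δ⁻¹) * ‖f t‖ₑ ^ 2 + ENNReal.ofReal δ⁻¹ * ‖f' t‖ₑ ^ 2) := by
  have hfc : Continuous f := continuous_iff_continuousAt.2 fun s => (hf s).continuousAt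
  have h := br_sobolev f (fun s => (δ⁻¹ : ℝ) * f' s) hf (by fun_prop) δ hδ hδ4 s hs
  have he : ∀ z : ℂ, ‖z‖ₑ ^ 2 = ENNReal.ofReal (‖z‖ ^ 2) := by
    intro z
    rw [← ofReal_norm, ENNReal.ofReal_pow (norm_nonneg _)]
  have hδi : 0 < δ⁻¹ := inv_pos.2 hδ
  rw [he, intervalIntegral.integral_of_le (by norm_num), ← integral_Icc_eq_integral_Ioc] at *
  refine (ENNReal.ofReal_le_ofReal h).trans ?_
  rw [ofReal_integral_eq_lintegral_ofReal]
  · refine lintegral_mono fun t => ?_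
    rw [he, he, ← ENNReal.ofReal_mul (by positivity), ← ENNReal.ofReal_mul (by positivity),
      ← ENNReal.ofReal_add (by positivity) (by positivity)]
    refine ENNReal.ofReal_le_ofReal (le_of_eq ?_)
    rw [norm_mul, Complex.norm_real, Real.norm_of_nonneg hδi.le]
    field_simp
  · exact Continuous.integrableOn_Icc (by fun_prop)
  · exact Eventually.of_forall fun t => by positivity

lemma br_L5 (n : ℕ) (hn : 2 ≤ n) (φ : ℝ → ℝ) (hφ : ContDiff ℝ 1 φ)
    (hsupp : ∀ t, t ∉ Set.Icc (1 / 2 : ℝ) 2 → φ t = 0) :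
    ∃ C : ℝ, 0 < C ∧ ∀ δ : ℝ, 0 < δ → δ ≤ 1 / 4 → ∀ G : EuclideanSpace ℝ (Fin n) → ℂ,
      Integrable G → MemLp G 2 → ∃ W : EuclideanSpace ℝ (Fin n) → ℝ≥0∞, Measurable W ∧
      (∀ x, ∀ s ∈ Set.Icc (1:ℝ) 4, ‖brF φ δ s G x‖ₑ ^ 2 ≤ W x) ∧
      ∀ (E : Set (EuclideanSpace ℝ (Fin n))) (μ : ℝ), MeasurableSet E → 0 < μ →
        volume E ≤ ENNReal.ofReal μ →
        ∫⁻ x in E, W x ≤ ENNReal.ofReal (C * δ * μ ^ (2 / ((n:ℝ) + 1))) * ∫⁻ x, ‖G x‖ₑ ^ 2 := by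
  obtain ⟨C, hC, hL5⟩ := br_L5a n hn
  have hsupp' := br_deriv_supp hsupp
  have hφ'c : Continuous (deriv φ) := hφ.continuous_deriv le_rfl
  obtain ⟨A1, hA1, hb1⟩ := br_bdd_of_supp hφ.continuous hsupp
  obtain ⟨A2, hA2, hb2⟩ := br_bdd_of_supp hφ'c hsupp'
  obtain ⟨A, hA, hbA, hbA'⟩ : ∃ A : ℝ, 0 < A ∧ (∀ t, |φ t| ≤ A) ∧ ∀ t, |deriv φ t| ≤ A :=
    ⟨A1 + A2, by positivity, fun t => (hb1 t).trans (by linarith), fun t => (hb2 t).trans (by linarith)⟩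
  refine ⟨9 * C * A ^ 2, by positivity, fun δ hδ hδ4 G hG hG2 => ?_⟩
  have hc1 := brF_continuous hφ.continuous hsupp hbA hδ hG
  have hc2 := brF_continuous hφ'c hsupp' hbA' hδ hG
  have hδi : 0 < δ⁻¹ := inv_pos.2 hδ
  obtain ⟨w, hw⟩ : ∃ w : ℝ × EuclideanSpace ℝ (Fin n) → ℝ≥0∞, w = fun q =>
    ENNReal.ofReal (2 * δ⁻¹) * ‖brF φ δ q.1 G q.2‖ₑ ^ 2 +
      ENNReal.ofReal δ⁻¹ * ‖brF (deriv φ) δ q.1 G q.2‖ₑ ^ 2 := ⟨_, rfl⟩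
  have hwm : Measurable w := by
    rw [hw]
    have := hc1.measurable
    have := hc2.measurable
    fun_prop
  refine ⟨fun x => ∫⁻ t in Set.Icc (1:ℝ) 4, w (t, x), ?_, ?_, ?_⟩
  · have hm2 : Measurable fun q : EuclideanSpace ℝ (Fin n) × ℝ => w (q.2, q.1) :=
      hwm.comp measurable_swap
    have := hm2.lintegral_prod_right' (ν := (volume : Measure ℝ).restrict (Set.Icc (1:ℝ) 4))
    exact this
  · intro x s hs
    rw [hw]
    refine br_sobolev_ennreal (fun s => brF φ δ s G x) (fun s => brF (deriv φ) δ s G x) δ hδ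
      (fun s => brF_deriv hφ hsupp hsupp' hbA hbA' hδ hG x s) ?_ hδ4 s hs
    have hc3 : Continuous fun s : ℝ => (s, x) := by fun_prop
    have hc4 := hc2.comp hc3
    simp only [Function.comp_def] at hc4
    exact hc4
  · intro E μ hE hμ hEμ
    have hsw : ∫⁻ x in E, ∫⁻ t in Set.Icc (1:ℝ) 4, w (t, x) =
        ∫⁻ t in Set.Icc (1:ℝ) 4, ∫⁻ x in E, w (t, x) :=
      lintegral_lintegral_swap (hwm.comp measurable_swap).aemeasurable
    rw [hsw]
    set H : EuclideanSpace ℝ (Fin n) → ℝ≥0∞ := fun ξ => ‖𝓕 G ξ‖ₑ ^ 2 with hH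
    have hHm : Measurable H := by
      have := (br_fourier_continuous hG).measurable
      fun_prop
    set K : ℝ := C * A ^ 2 * δ * μ ^ (2 / ((n:ℝ) + 1)) with hK
    have hK0 : 0 ≤ K := by positivity
    have hstep : ∀ t ∈ Set.Icc (1:ℝ) 4, ∫⁻ x in E, w (t, x) ≤
        ENNReal.ofReal (3 * δ⁻¹ * K) * ∫⁻ ξ in brRing n (t - 3 * δ) t, H ξ := by
      intro t ht
      have e1 := hL5 φ A hφ.continuous hsupp hbA δ t hδ hδ4 ht.1 ht.2 G hG E μ hE hμ hEμ
      have e2 := hL5 (deriv φ) A hφ'c hsupp' hbA' δ t hδ hδ4 ht.1 ht.2 G hG E μ hE hμ hEμ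
      have m1 : Measurable fun x => ‖brF φ δ t G x‖ₑ ^ 2 := by
        have hc3 : Continuous fun x : EuclideanSpace ℝ (Fin n) => (t, x) := by fun_prop
        have hc4 := (hc1.comp hc3).measurable
        simp only [Function.comp_def] at hc4
        exact hc4.enorm.pow_const 2
      simp only [hw]
      rw [lintegral_add_left (m1.const_mul _), lintegral_const_mul' _ _ ENNReal.ofReal_ne_top,
        lintegral_const_mul' _ _ ENNReal.ofReal_ne_top]
      calc _ ≤ ENNReal.ofReal (2 * δ⁻¹) * (ENNReal.ofReal K * ∫⁻ ξ in brRing n (t - 3 * δ) t, H ξ) +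
            ENNReal.ofReal δ⁻¹ * (ENNReal.ofReal K * ∫⁻ ξ in brRing n (t - 3 * δ) t, H ξ) := by
            gcongr
        _ = _ := by
            rw [← mul_assoc, ← mul_assoc, ← ENNReal.ofReal_mul (by positivity),
              ← ENNReal.ofReal_mul (by positivity), ← add_mul, ← ENNReal.ofReal_add (by positivity) (by positivity)]
            congr 2; ring
    refine (setLIntegral_mono' measurableSet_Icc hstep).trans ?_
    rw [lintegral_const_mul' _ _ ENNReal.ofReal_ne_top]
    refine (mul_le_mul_right (br_ring_avg δ hδ hHm) _).trans ?_
    rw [br_plancherel hG hG2, ← mul_assoc, ← ENNReal.ofReal_mul (by positivity)]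
    refine mul_le_mul_left (ENNReal.ofReal_le_ofReal (le_of_eq ?_)) _
    rw [hK]; field_simp; ring

end L5c

section L6

lemma br_int_pow {β A : ℝ} (hβ : 0 < β) (hA : 0 ≤ A) :
    ∫⁻ t in Set.Ioc (0:ℝ) A, ENNReal.ofReal (t ^ (β - 1)) = ENNReal.ofReal (A ^ β / β) := by
  have hi : IntervalIntegrable (fun t : ℝ => t ^ (β - 1)) volume 0 A :=
    intervalIntegral.intervalIntegrable_rpow' (by linarith)
  rw [← ofReal_integral_eq_lintegral_ofReal]
  · rw [← intervalIntegral.integral_of_le hA, integral_rpow (Or.inl (by linarith))]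
    rw [sub_add_cancel, Real.zero_rpow hβ.ne', sub_zero]
  · exact (intervalIntegrable_iff_integrableOn_Ioc_of_le hA).1 hi
  · filter_upwards [ae_restrict_mem measurableSet_Ioc] with t ht
    exact Real.rpow_nonneg ht.1.le _

lemma br_int_tail {γ A : ℝ} (hγ : 0 < γ) (hA : 0 < A) :
    ∫⁻ t in Set.Ioi A, ENNReal.ofReal (t ^ (-γ - 1)) = ENNReal.ofReal (A ^ (-γ) / γ) := by
  rw [← ofReal_integral_eq_lintegral_ofReal]
  · rw [integral_Ioi_rpow_of_lt (by linarith) hA]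
    congr 1
    rw [sub_add_cancel, div_neg, neg_div, neg_neg]
  · exact integrableOn_Ioi_rpow_of_lt (by linarith) hA
  · filter_upwards [ae_restrict_mem measurableSet_Ioi] with t ht
    exact Real.rpow_nonneg (hA.le.trans (le_of_lt ht)) _

lemma br_pow_le_int {q : ℝ} (hq : 0 < q) (a : ℝ≥0∞) :
    a ^ q ≤ ∫⁻ t in Set.Ioi (0:ℝ), ENNReal.ofReal (q * t ^ (q - 1)) *
      (Set.Iio a).indicator 1 (ENNReal.ofReal t) := by
  have key : ∀ b : ℝ, 0 < b → ENNReal.ofReal b < a → ENNReal.ofReal b ^ q ≤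
      ∫⁻ t in Set.Ioi (0:ℝ), ENNReal.ofReal (q * t ^ (q - 1)) *
      (Set.Iio a).indicator 1 (ENNReal.ofReal t) := by
    intro b hb hba
    calc ENNReal.ofReal b ^ q = ∫⁻ t in Set.Ioc (0:ℝ) b, ENNReal.ofReal (q * t ^ (q - 1)) := by
          simp_rw [ENNReal.ofReal_mul hq.le]
          rw [lintegral_const_mul' _ _ ENNReal.ofReal_ne_top, br_int_pow hq hb.le,
            ← ENNReal.ofReal_mul hq.le, ENNReal.ofReal_rpow_of_pos hb]
          congr 1; field_simp
      _ ≤ ∫⁻ t in Set.Ioc (0:ℝ) b, ENNReal.ofReal (q * t ^ (q - 1)) *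
            (Set.Iio a).indicator 1 (ENNReal.ofReal t) := by
          refine setLIntegral_mono' measurableSet_Ioc fun t ht => ?_
          rw [Set.indicator_of_mem]
          · simp
          · exact (ENNReal.ofReal_le_ofReal ht.2).trans_lt hba
      _ ≤ _ := lintegral_mono_set Set.Ioc_subset_Ioi_self
  refine le_of_forall_lt fun c hc => ?_
  obtain ⟨c', hcc', hc'⟩ := exists_between hc
  have h1 : c' ^ (1 / q) < a := by
    rw [← ENNReal.rpow_lt_rpow_iff hq, ← ENNReal.rpow_mul]
    simpa [hq.ne'] using hc'
  have h2 : 0 < c' ^ (1 / q) := ENNReal.rpow_pos (bot_le.trans_lt hcc') hc'.ne_top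
  have h3 := key (c' ^ (1 / q)).toReal (ENNReal.toReal_pos h2.ne' h1.ne_top)
    (by rwa [ENNReal.ofReal_toReal h1.ne_top])
  rw [ENNReal.ofReal_toReal h1.ne_top, ← ENNReal.rpow_mul] at h3
  simp only [one_div, inv_mul_cancel₀ hq.ne', ENNReal.rpow_one] at h3
  exact hcc'.trans_le h3

lemma br_layer {X : Type*} [MeasurableSpace X] (ν : Measure X) [SFinite ν] {F : X → ℝ≥0∞}
    (hF : Measurable F) {q : ℝ} (hq : 0 < q) :
    ∫⁻ x, F x ^ q ∂ν ≤ ∫⁻ t in Set.Ioi (0:ℝ), ENNReal.ofReal (q * t ^ (q - 1)) *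
      ν {x | ENNReal.ofReal t < F x} := by
  refine (lintegral_mono fun x => br_pow_le_int hq (F x)).trans (le_of_eq ?_)
  have hms : MeasurableSet {z : X × ℝ | ENNReal.ofReal z.2 < F z.1} :=
    measurableSet_lt (by fun_prop) (by fun_prop)
  have hind : ∀ x t, (Set.Iio (F x)).indicator (1 : ℝ≥0∞ → ℝ≥0∞) (ENNReal.ofReal t) =
      {z : X × ℝ | ENNReal.ofReal z.2 < F z.1}.indicator 1 (x, t) := fun x t => rfl
  have hm : Measurable fun z : X × ℝ => ENNReal.ofReal (q * z.2 ^ (q - 1)) *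
      (Set.Iio (F z.1)).indicator (1 : ℝ≥0∞ → ℝ≥0∞) (ENNReal.ofReal z.2) := by
    simp_rw [hind]
    exact (by fun_prop : Measurable fun z : X × ℝ => ENNReal.ofReal (q * z.2 ^ (q - 1))).mul
      (measurable_one.indicator hms)
  rw [lintegral_lintegral_swap hm.aemeasurable]
  refine lintegral_congr fun t => ?_
  rw [lintegral_const_mul' _ _ ENNReal.ofReal_ne_top]
  congr 1
  have h1 : MeasurableSet {x | ENNReal.ofReal t < F x} := measurableSet_lt measurable_const hF
  rw [← lintegral_indicator_one h1]
  rfl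

/-- Marcinkiewicz-type lemma. -/
lemma br_marcinkiewicz {X Y : Type*} [MeasurableSpace X] [MeasurableSpace Y] (ν : Measure X) [SFinite ν]
    (τ : Measure Y) [SFinite τ] {F : X → ℝ≥0∞} (hF : Measurable F) {u : Y → ℝ≥0∞} (hu : Measurable u)
    {r q c K : ℝ} (hr : 0 < r) (hrq : r < q) (hc : 0 < c) (hK : 0 ≤ K)
    (h : ∀ t : ℝ, 0 < t → ENNReal.ofReal (t ^ r) * ν {x | ENNReal.ofReal t < F x} ≤
      ENNReal.ofReal K * ∫⁻ y in {y | ENNReal.ofReal (c * t) < u y}, u y ^ r ∂τ) :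
    ∫⁻ x, F x ^ q ∂ν ≤ ENNReal.ofReal (K * q / (q - r) * c ^ (-(q - r))) * ∫⁻ y, u y ^ q ∂τ := by
  have hq : 0 < q := hr.trans hrq
  have hqr : 0 < q - r := by linarith
  refine (br_layer ν hF hq).trans ?_
  have h1 : ∀ t ∈ Set.Ioi (0:ℝ), ENNReal.ofReal (q * t ^ (q - 1)) * ν {x | ENNReal.ofReal t < F x} ≤
      ENNReal.ofReal (q * K) * (∫⁻ y, ENNReal.ofReal (t ^ (q - r - 1)) *
        {z : ℝ × Y | ENNReal.ofReal (c * z.1) < u z.2}.indicator (fun z => u z.2 ^ r) (t, y) ∂τ) := by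
    intro t ht
    have ht0 : 0 < t := ht
    have e1 : q * t ^ (q - 1) = q * t ^ (q - r - 1) * t ^ r := by
      rw [mul_assoc, ← Real.rpow_add ht0]; congr 2; ring
    rw [e1, ENNReal.ofReal_mul (by positivity), mul_assoc]
    refine (mul_le_mul_right (h t ht0) _).trans (le_of_eq ?_)
    rw [lintegral_const_mul' _ _ ENNReal.ofReal_ne_top, ← mul_assoc, ← mul_assoc,
      ← ENNReal.ofReal_mul (by positivity), ← ENNReal.ofReal_mul (by positivity)]
    have hm : MeasurableSet {y | ENNReal.ofReal (c * t) < u y} := measurableSet_lt measurable_const hu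
    rw [← lintegral_indicator hm]
    congr 2
    ring
  refine (setLIntegral_mono' measurableSet_Ioi h1).trans ?_
  rw [lintegral_const_mul' _ _ ENNReal.ofReal_ne_top, lintegral_lintegral_swap]
  swap
  · have hms : MeasurableSet {z : ℝ × Y | ENNReal.ofReal (c * z.1) < u z.2} :=
      measurableSet_lt (by fun_prop) (by fun_prop)
    refine Measurable.aemeasurable ?_
    exact (by fun_prop : Measurable fun z : ℝ × Y => ENNReal.ofReal (z.1 ^ (q - r - 1))).mul
      (Measurable.indicator (by fun_prop) hms)
  have h2 : ∀ y, ∫⁻ t in Set.Ioi (0:ℝ), ENNReal.ofReal (t ^ (q - r - 1)) *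
        {z : ℝ × Y | ENNReal.ofReal (c * z.1) < u z.2}.indicator (fun z => u z.2 ^ r) (t, y) ≤
      ENNReal.ofReal (c ^ (-(q - r)) / (q - r)) * u y ^ q := by
    intro y
    rcases eq_or_ne (u y) ⊤ with hy | hy
    · rw [hy, ENNReal.top_rpow_of_pos hq, ENNReal.mul_top]
      · exact le_top
      · rw [Ne, ENNReal.ofReal_eq_zero, not_le]; positivity
    · calc _ ≤ ∫⁻ t in Set.Ioi (0:ℝ), (Set.Ioc 0 ((u y).toReal / c)).indicator
            (fun t => ENNReal.ofReal (t ^ (q - r - 1)) * u y ^ r) t := by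
            refine setLIntegral_mono' measurableSet_Ioi fun t ht => ?_
            by_cases hz : (t, y) ∈ {z : ℝ × Y | ENNReal.ofReal (c * z.1) < u z.2}
            · have hz' : ENNReal.ofReal (c * t) < u y := hz
              rw [Set.indicator_of_mem hz, Set.indicator_of_mem]
              refine ⟨ht, ?_⟩
              rw [le_div_iff₀ hc, mul_comm]
              exact ((ENNReal.ofReal_lt_iff_lt_toReal (mul_nonneg hc.le (le_of_lt ht)) hy).1 hz').le
            · rw [Set.indicator_of_notMem hz, mul_zero]; exact zero_le
        _ ≤ ∫⁻ t, (Set.Ioc 0 ((u y).toReal / c)).indicator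
            (fun t => ENNReal.ofReal (t ^ (q - r - 1)) * u y ^ r) t := setLIntegral_le_lintegral _ _
        _ = _ := by
            rw [lintegral_indicator measurableSet_Ioc, lintegral_mul_const' _ _
              (ENNReal.rpow_ne_top_of_nonneg hr.le hy), br_int_pow hqr (by positivity)]
            rw [Real.div_rpow (by positivity) hc.le, Real.rpow_neg hc.le]
            have e2 : u y ^ q = ENNReal.ofReal ((u y).toReal ^ (q - r)) * u y ^ r := by
              rw [← ENNReal.ofReal_rpow_of_nonneg (by positivity) hqr.le, ENNReal.ofReal_toReal hy,
                ← ENNReal.rpow_add_of_nonneg _ _ hqr.le hr.le]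
              congr 1; ring
            rw [e2, ← mul_assoc, ← ENNReal.ofReal_mul (by positivity)]
            congr 2
            field_simp
  refine (mul_le_mul_right (lintegral_mono h2) _).trans (le_of_eq ?_)
  rw [lintegral_const_mul' _ _ ENNReal.ofReal_ne_top, ← mul_assoc, ← ENNReal.ofReal_mul (by positivity)]
  congr 2
  field_simp

lemma br_L6 {X : Type*} [MeasurableSpace X] (ν : Measure X) [SFinite ν] {W : X → ℝ≥0∞} (hW : Measurable W)
    {θ q : ℝ} (hθ : 0 < θ) (hθ1 : θ < 1) (hq : 0 < q) (hq2 : q * (1 - θ) < 1) {D : ℝ} (hD : 0 < D)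
    (h : ∀ (E : Set X) (m : ℝ), MeasurableSet E → 0 < m → ν E ≤ ENNReal.ofReal m →
      ∫⁻ x in E, W x ∂ν ≤ ENNReal.ofReal (D * m ^ θ))
    {B : Set X} (hB : MeasurableSet B) {m : ℝ} (hm : 0 < m) (hBm : ν B ≤ ENNReal.ofReal m) :
    ∫⁻ x in B, W x ^ q ∂ν ≤ ENNReal.ofReal ((1 + q * (1 - θ) / (1 - q * (1 - θ))) *
      D ^ q * m ^ (1 - q * (1 - θ))) := by
  have hθ' : 0 < 1 - θ := by linarith
  set r : ℝ := 1 / (1 - θ) with hr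
  have hrq : q < r := by rw [hr, lt_div_iff₀ hθ']; exact hq2
  have hr0 : 0 < r := hq.trans hrq
  -- measure of super level sets
  have hlev : ∀ t : ℝ, 0 < t → (ν.restrict B) {x | ENNReal.ofReal t < W x} ≤
      ENNReal.ofReal (D ^ r * t ^ (-r)) := by
    intro t ht
    have hms : MeasurableSet {x | ENNReal.ofReal t < W x} := measurableSet_lt measurable_const hW
    rw [Measure.restrict_apply hms]
    set E := {x | ENNReal.ofReal t < W x} ∩ B with hE
    have hEfin : ν E ≠ ⊤ := ((measure_mono Set.inter_subset_right).trans_lt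
      (hBm.trans_lt ENNReal.ofReal_lt_top)).ne
    rcases eq_or_ne (ν E) 0 with h0 | h0
    · rw [h0]; exact zero_le
    have hμ : 0 < (ν E).toReal := ENNReal.toReal_pos h0 hEfin
    have h1 := h E (ν E).toReal (hms.inter hB) hμ (by rw [ENNReal.ofReal_toReal hEfin])
    have h2 : ENNReal.ofReal t * ν E ≤ ∫⁻ x in E, W x ∂ν := by
      rw [← setLIntegral_const]
      exact setLIntegral_mono' (hms.inter hB) fun x hx => le_of_lt hx.1
    have h3 := h2.trans h1
    generalize hm' : (ν E).toReal = a at *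
    have hνa : ν E = ENNReal.ofReal a := by rw [← hm', ENNReal.ofReal_toReal hEfin]
    rw [hνa, ← ENNReal.ofReal_mul ht.le, ENNReal.ofReal_le_ofReal_iff (by positivity)] at h3
    rw [hνa]
    refine ENNReal.ofReal_le_ofReal ?_
    have h4 : a ^ (1 - θ) ≤ D * t⁻¹ := by
      rw [Real.rpow_sub hμ, Real.rpow_one, ← div_eq_mul_inv, div_le_div_iff₀ (by positivity) ht]
      linarith
    calc a = (a ^ (1 - θ)) ^ r := by
          rw [← Real.rpow_mul hμ.le, hr, mul_one_div_cancel hθ'.ne', Real.rpow_one]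
      _ ≤ (D * t⁻¹) ^ r := by gcongr
      _ = _ := by rw [Real.mul_rpow hD.le (by positivity), Real.inv_rpow ht.le, Real.rpow_neg ht.le]
  set l : ℝ := D * m ^ (θ - 1) with hl
  have hl0 : 0 < l := by positivity
  refine (br_layer (ν.restrict B) hW hq).trans ?_
  rw [← Set.Ioc_union_Ioi_eq_Ioi hl0.le, lintegral_union measurableSet_Ioi (Set.Ioc_disjoint_Ioi le_rfl)]
  have p1 : ∫⁻ t in Set.Ioc (0:ℝ) l, ENNReal.ofReal (q * t ^ (q - 1)) *
      (ν.restrict B) {x | ENNReal.ofReal t < W x} ≤ ENNReal.ofReal (l ^ q * m) := by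
    calc _ ≤ ∫⁻ t in Set.Ioc (0:ℝ) l, ENNReal.ofReal q * ENNReal.ofReal (t ^ (q - 1)) * ENNReal.ofReal m := by
          refine lintegral_mono fun t => ?_
          rw [ENNReal.ofReal_mul hq.le]
          gcongr
          exact (measure_mono (Set.subset_univ _)).trans (by rwa [Measure.restrict_apply_univ])
      _ = _ := by
          rw [lintegral_mul_const' _ _ ENNReal.ofReal_ne_top, lintegral_const_mul' _ _ ENNReal.ofReal_ne_top,
            br_int_pow hq hl0.le, ← ENNReal.ofReal_mul hq.le, ← ENNReal.ofReal_mul (by positivity)]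
          congr 1; field_simp
  have p2 : ∫⁻ t in Set.Ioi l, ENNReal.ofReal (q * t ^ (q - 1)) *
      (ν.restrict B) {x | ENNReal.ofReal t < W x} ≤ ENNReal.ofReal (q * D ^ r * (l ^ (-(r - q)) / (r - q))) := by
    have hrq' : 0 < r - q := by linarith
    calc _ ≤ ∫⁻ t in Set.Ioi l, ENNReal.ofReal (q * D ^ r) * ENNReal.ofReal (t ^ (-(r - q) - 1)) := by
          refine setLIntegral_mono' measurableSet_Ioi fun t ht => ?_
          have ht0 : 0 < t := hl0.trans ht
          refine (mul_le_mul_right (hlev t ht0) _).trans (le_of_eq ?_)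
          rw [← ENNReal.ofReal_mul (by positivity), ← ENNReal.ofReal_mul (by positivity)]
          congr 1
          have : -(r - q) - 1 = (q - 1) + (-r) := by ring
          rw [this, Real.rpow_add ht0]; ring
      _ = _ := by
          rw [lintegral_const_mul' _ _ ENNReal.ofReal_ne_top, br_int_tail hrq' hl0,
            ← ENNReal.ofReal_mul (by positivity)]
  refine (add_le_add p1 p2).trans ?_
  have hrq' : 0 < r - q := by linarith
  rw [← ENNReal.ofReal_add (by positivity) (by positivity)]
  refine ENNReal.ofReal_le_ofReal (le_of_eq ?_)
  have e1 : l ^ q * m = D ^ q * m ^ (1 - q * (1 - θ)) := by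
    rw [hl, Real.mul_rpow hD.le (by positivity), ← Real.rpow_mul hm.le, mul_assoc]
    nth_rw 2 [← Real.rpow_one m]
    rw [← Real.rpow_add hm]
    congr 2; ring
  have e2 : D ^ r * l ^ (-(r - q)) = D ^ q * m ^ (1 - q * (1 - θ)) := by
    rw [hl, Real.mul_rpow hD.le (by positivity), ← Real.rpow_mul hm.le, ← mul_assoc, ← Real.rpow_add hD]
    have e3 : (θ - 1) * (-(r - q)) = 1 - q * (1 - θ) := by
      have : r * (1 - θ) = 1 := by rw [hr]; field_simp
      linear_combination this
    rw [e3]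
    congr 2; ring
  have e4 : q / (r - q) = q * (1 - θ) / (1 - q * (1 - θ)) := by
    have : 0 < 1 - q * (1 - θ) := by linarith
    rw [div_eq_div_iff hrq'.ne' this.ne']
    have : r * (1 - θ) = 1 := by rw [hr]; field_simp
    linear_combination (-q) * this
  rw [e1, ← e4]
  have : q * D ^ r * (l ^ (-(r - q)) / (r - q)) = q / (r - q) * (D ^ r * l ^ (-(r - q))) := by ring
  rw [this, e2]; ring

end L6

section L7

variable {n : ℕ}

lemma br_iter_g (s : ℝ) {δ : ℝ} (hδ : 0 < δ) (hδ1 : δ ≤ 1) {ξ : EuclideanSpace ℝ (Fin n)} (hξ : ‖ξ‖ ≤ 3)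
    (i : ℕ) (hi : 1 ≤ i) :
    ‖iteratedFDeriv ℝ i (fun ξ : EuclideanSpace ℝ (Fin n) => (s - ‖ξ‖ ^ 2) / δ) ξ‖ ≤ (6 / δ) ^ i := by
  obtain ⟨i, rfl⟩ := Nat.exists_eq_add_of_le' hi
  set L : EuclideanSpace ℝ (Fin n) →L[ℝ] (EuclideanSpace ℝ (Fin n) →L[ℝ] ℝ) := (-(2 / δ)) • innerSL ℝ with hL
  have hf : fderiv ℝ (fun ξ : EuclideanSpace ℝ (Fin n) => (s - ‖ξ‖ ^ 2) / δ) = L := by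
    ext1 ξ
    have h1 : HasFDerivAt (fun ξ : EuclideanSpace ℝ (Fin n) => ‖ξ‖ ^ 2) (2 • (innerSL ℝ ξ)) ξ :=
      (hasStrictFDerivAt_norm_sq ξ).hasFDerivAt
    have h2 := (h1.const_sub s).mul_const δ⁻¹
    simp only [← div_eq_mul_inv] at h2
    rw [h2.fderiv, hL]
    ext v
    simp
    field_simp
    exact (innerSL_apply_apply ℝ ξ v).symm
  have hLn : ‖L‖ ≤ 2 / δ := by
    refine L.opNorm_le_bound (by positivity) fun v => ?_
    have : L v = (-(2 / δ)) • innerSL ℝ v := rfl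
    rw [this, norm_smul, norm_neg, Real.norm_of_nonneg (by positivity), innerSL_apply_norm]
  have h6 : 1 ≤ 6 / δ := by rw [le_div_iff₀ hδ]; linarith
  rw [← norm_iteratedFDeriv_fderiv, hf]
  rcases i with _ | i
  · rw [norm_iteratedFDeriv_zero, zero_add, pow_one]
    calc ‖L ξ‖ ≤ ‖L‖ * ‖ξ‖ := L.le_opNorm ξ
      _ ≤ 2 / δ * 3 := by gcongr
      _ = _ := by ring
  · rw [← norm_iteratedFDeriv_fderiv]
    have hf2 : fderiv ℝ (L : EuclideanSpace ℝ (Fin n) → _) = fun _ => L := by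
      ext1 x; exact L.fderiv
    rw [hf2]
    rcases i with _ | i
    · rw [norm_iteratedFDeriv_zero, zero_add]
      refine hLn.trans ?_
      calc 2 / δ ≤ 6 / δ := by gcongr; norm_num
        _ ≤ _ := le_self_pow₀ h6 (by norm_num)
    · rw [iteratedFDeriv_const_of_ne (by omega)]
      simp only [Pi.zero_apply, norm_zero]
      positivity

lemma br_symbol_support {φ : ℝ → ℝ} (hsupp : ∀ t, t ∉ Set.Icc (0 : ℝ) 8 → φ t = 0) {δ s : ℝ} (hδ : 0 < δ)
    (hs : s ≤ 8) : Function.support (fun ξ : EuclideanSpace ℝ (Fin n) => ((φ ((s - ‖ξ‖ ^ 2) / δ) : ℝ) : ℂ)) ⊆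
      Metric.closedBall 0 3 := by
  intro ξ hξ
  rw [Function.mem_support] at hξ
  rw [mem_closedBall_zero_iff]
  by_contra hcon
  apply hξ
  rw [hsupp, Complex.ofReal_zero]
  intro h
  have h1 := h.1
  rw [le_div_iff₀ hδ] at h1
  nlinarith [norm_nonneg ξ]

lemma br_symbol_smooth {φ : ℝ → ℝ} (hφ : ContDiff ℝ (⊤ : ℕ∞) φ) (δ s : ℝ) :
    ContDiff ℝ (⊤ : ℕ∞) (fun ξ : EuclideanSpace ℝ (Fin n) => ((φ ((s - ‖ξ‖ ^ 2) / δ) : ℝ) : ℂ)) := by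
  have h1 : ContDiff ℝ (⊤ : ℕ∞) (fun ξ : EuclideanSpace ℝ (Fin n) => (s - ‖ξ‖ ^ 2) / δ) :=
    (contDiff_const.sub (contDiff_norm_sq ℝ)).div_const δ
  exact Complex.ofRealCLM.contDiff.comp (hφ.comp h1)

lemma br_symbol_compact {φ : ℝ → ℝ} (hsupp : ∀ t, t ∉ Set.Icc (0 : ℝ) 8 → φ t = 0) {δ s : ℝ} (hδ : 0 < δ)
    (hs : s ≤ 8) : HasCompactSupport (fun ξ : EuclideanSpace ℝ (Fin n) => ((φ ((s - ‖ξ‖ ^ 2) / δ) : ℝ) : ℂ)) :=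
  HasCompactSupport.of_support_subset_isCompact (isCompact_closedBall 0 3) (br_symbol_support hsupp hδ hs)

lemma br_symbol_deriv {φ : ℝ → ℝ} (hφ : ContDiff ℝ (⊤ : ℕ∞) φ)
    (hsupp : ∀ t, t ∉ Set.Icc (0 : ℝ) 8 → φ t = 0) (N : ℕ) :
    ∃ C : ℝ, 0 < C ∧ ∀ δ s : ℝ, 0 < δ → δ ≤ 1 → s ≤ 8 → ∀ i ≤ N, ∀ ξ : EuclideanSpace ℝ (Fin n),
      ‖iteratedFDeriv ℝ i (fun ξ : EuclideanSpace ℝ (Fin n) => ((φ ((s - ‖ξ‖ ^ 2) / δ) : ℝ) : ℂ)) ξ‖ ≤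
        (Metric.closedBall 0 3).indicator (fun _ => C * (δ⁻¹) ^ i) ξ := by
  have hΦ : ContDiff ℝ (⊤ : ℕ∞) (fun t : ℝ => (φ t : ℂ)) := Complex.ofRealCLM.contDiff.comp hφ
  have hΦs : HasCompactSupport (fun t : ℝ => (φ t : ℂ)) := by
    refine HasCompactSupport.of_support_subset_isCompact (isCompact_Icc (a := (0:ℝ)) (b := 8)) ?_
    intro t ht
    by_contra hcon
    exact ht (by simp [hsupp t hcon])
  have hb : ∀ i : ℕ, ∃ A : ℝ, 0 ≤ A ∧ ∀ t, ‖iteratedFDeriv ℝ i (fun t : ℝ => (φ t : ℂ)) t‖ ≤ A := by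
    intro i
    obtain ⟨A, hA⟩ := (hΦs.iteratedFDeriv (𝕜 := ℝ) i).exists_bound_of_continuous
      (hΦ.continuous_iteratedFDeriv (m := i) (by exact_mod_cast le_top))
    exact ⟨A, (norm_nonneg _).trans (hA 0), hA⟩
  choose A hA0 hA using hb
  set C0 : ℝ := 1 + ∑ i ∈ Finset.range (N + 1), A i with hC0
  have hC0p : 0 < C0 := by
    have : 0 ≤ ∑ i ∈ Finset.range (N + 1), A i := Finset.sum_nonneg fun i _ => hA0 i
    linarith
  refine ⟨(N.factorial : ℝ) * C0 * 6 ^ N, by positivity, fun δ s hδ hδ1 hs i hi ξ => ?_⟩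
  by_cases hξ : ξ ∈ Metric.closedBall (0 : EuclideanSpace ℝ (Fin n)) 3
  · rw [Set.indicator_of_mem hξ]
    have h1 : ContDiff ℝ (⊤ : ℕ∞) (fun ξ : EuclideanSpace ℝ (Fin n) => (s - ‖ξ‖ ^ 2) / δ) :=
      (contDiff_const.sub (contDiff_norm_sq ℝ)).div_const δ
    have h2 := norm_iteratedFDeriv_comp_le (n := i) hΦ h1 (by exact_mod_cast le_top) ξ (C := C0) (D := 6 / δ)
      (fun j hj => (hA j _).trans (by
        have := Finset.single_le_sum (f := A) (fun k _ => hA0 k)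
          (Finset.mem_range.2 (by omega : j < N + 1))
        linarith))
      (fun j hj _ => br_iter_g s hδ hδ1 (mem_closedBall_zero_iff.1 hξ) j hj)
    refine h2.trans ?_
    rw [div_eq_mul_inv, mul_pow, ← mul_assoc]
    have : (i.factorial : ℝ) ≤ N.factorial := by exact_mod_cast Nat.factorial_le hi
    have h6 : (6:ℝ) ^ i ≤ 6 ^ N := pow_le_pow_right₀ (by norm_num) hi
    gcongr
  · rw [Set.indicator_of_notMem hξ]
    have : ξ ∉ tsupport (fun ξ : EuclideanSpace ℝ (Fin n) => ((φ ((s - ‖ξ‖ ^ 2) / δ) : ℝ) : ℂ)) := fun h =>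
      hξ (closure_minimal (br_symbol_support hsupp hδ hs) Metric.isClosed_closedBall h)
    have h2 : ξ ∉ Function.support (iteratedFDeriv ℝ i
      (fun ξ : EuclideanSpace ℝ (Fin n) => ((φ ((s - ‖ξ‖ ^ 2) / δ) : ℝ) : ℂ))) := fun h =>
      this (support_iteratedFDeriv_subset i h)
    rw [Function.notMem_support.1 h2, norm_zero]

lemma br_kernel_tail {φ : ℝ → ℝ} (hφ : ContDiff ℝ (⊤ : ℕ∞) φ)
    (hsupp : ∀ t, t ∉ Set.Icc (0 : ℝ) 8 → φ t = 0) (N : ℕ) :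
    ∃ C : ℝ, 0 < C ∧ ∀ δ s : ℝ, 0 < δ → δ ≤ 1 → s ≤ 8 → ∀ x : EuclideanSpace ℝ (Fin n),
      ‖x‖ ^ N * ‖𝓕⁻ (fun ξ : EuclideanSpace ℝ (Fin n) => ((φ ((s - ‖ξ‖ ^ 2) / δ) : ℝ) : ℂ)) x‖ ≤
        C * (δ⁻¹) ^ N := by
  obtain ⟨C, hC, hder⟩ := br_symbol_deriv (n := n) hφ hsupp N
  set B : ℝ := (volume (Metric.closedBall (0 : EuclideanSpace ℝ (Fin n)) 3)).toReal with hB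
  have hB0 : 0 ≤ B := ENNReal.toReal_nonneg
  refine ⟨2 ^ N * ((N + 1) * (C * (B + 1))), by positivity, fun δ s hδ hδ1 hs x => ?_⟩
  have hm := br_symbol_smooth (n := n) hφ δ s
  have hmc := br_symbol_compact (n := n) hsupp hδ hs
  set m := (fun ξ : EuclideanSpace ℝ (Fin n) => ((φ ((s - ‖ξ‖ ^ 2) / δ) : ℝ) : ℂ)) with hmdef
  have hIntg : ∀ (k i : ℕ), k ≤ (0 : ℕ∞) → i ≤ (⊤ : ℕ∞) →
      Integrable (fun v ↦ ‖v‖ ^ k * ‖iteratedFDeriv ℝ i m v‖) := by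
    intro k i _ _
    have hci := hm.continuous_iteratedFDeriv (m := i) (by exact_mod_cast le_top)
    refine Continuous.integrable_of_hasCompactSupport (by fun_prop) ?_
    exact (hmc.iteratedFDeriv (𝕜 := ℝ) i).norm.mul_left
  have h := Real.pow_mul_norm_iteratedFDeriv_fourier_le hm hIntg (k := 0) (n := N) (by simp) (by simp) (-x)
  rw [norm_iteratedFDeriv_zero, norm_neg] at h
  rw [Real.fourierInv_eq_fourier_neg]
  refine h.trans ?_
  simp only [pow_zero, one_mul, Nat.cast_zero, mul_zero, zero_add, Finset.range_one]
  rw [Finset.singleton_product, Finset.sum_map]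
  simp only [Function.Embedding.coeFn_mk, pow_zero, one_mul]
  rw [mul_assoc]
  gcongr
  have hδi : 1 ≤ δ⁻¹ := (one_le_inv₀ hδ).2 hδ1
  calc ∑ i ∈ Finset.range (N + 1), ∫ v, ‖iteratedFDeriv ℝ i m v‖
      ≤ ∑ i ∈ Finset.range (N + 1), (C * (B + 1) * (δ⁻¹) ^ N) := by
        refine Finset.sum_le_sum fun i hi => ?_
        have hiN : i ≤ N := by have := Finset.mem_range.1 hi; omega
        have hI : Integrable ((Metric.closedBall (0 : EuclideanSpace ℝ (Fin n)) 3).indicator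
            (fun _ => C * (δ⁻¹) ^ i)) :=
          (integrable_indicator_iff Metric.isClosed_closedBall.measurableSet).2
            (integrableOn_const (isCompact_closedBall _ _).measure_lt_top.ne enorm_ne_top)
        have h0 := hIntg 0 i (by simp) (by simp)
        simp only [pow_zero, one_mul] at h0
        refine (integral_mono h0 hI (fun v => hder δ s hδ hδ1 hs i hiN v)).trans ?_
        rw [integral_indicator Metric.isClosed_closedBall.measurableSet, setIntegral_const, smul_eq_mul]
        have : (δ⁻¹) ^ i ≤ (δ⁻¹) ^ N := pow_le_pow_right₀ hδi hiN
        calc _ = C * B * (δ⁻¹) ^ i := by rw [hB, Measure.real]; ring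
          _ ≤ C * (B + 1) * (δ⁻¹) ^ N := by gcongr; linarith
    _ = _ := by
        rw [Finset.sum_const, Finset.card_range, nsmul_eq_mul]; push_cast; ring

lemma br_conv {m G : EuclideanSpace ℝ (Fin n) → ℂ} (hm : Integrable m) (hG : Integrable G)
    (x : EuclideanSpace ℝ (Fin n)) :
    𝓕⁻ (fun ξ => m ξ * 𝓕 G ξ) x = ∫ y, G y * 𝓕⁻ m (x - y) := by
  have hc : Continuous fun ξ : EuclideanSpace ℝ (Fin n) => Complex.exp (↑(2 * Real.pi * ⟪ξ, x⟫) * I) := by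
    fun_prop
  have hg : Integrable fun ξ => Complex.exp (↑(2 * Real.pi * ⟪ξ, x⟫) * I) * m ξ :=
    hm.bdd_mul hc.aestronglyMeasurable (Eventually.of_forall fun ξ => (Complex.norm_exp_ofReal_mul_I _).le)
  have h := br_fourier_mul_flip hG hg
  rw [Real.fourierInv_eq']
  calc _ = ∫ ξ, 𝓕 G ξ * (Complex.exp (↑(2 * Real.pi * ⟪ξ, x⟫) * I) * m ξ) := by
        refine integral_congr_ae (Eventually.of_forall fun ξ => ?_)
        simp only [smul_eq_mul]; ring
    _ = _ := by
        rw [h]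
        refine integral_congr_ae (Eventually.of_forall fun y => ?_)
        simp only
        congr 1
        rw [Real.fourier_eq', Real.fourierInv_eq']
        refine integral_congr_ae (Eventually.of_forall fun ξ => ?_)
        simp only [smul_eq_mul]
        rw [← mul_assoc, ← Complex.exp_add, inner_sub_right]
        congr 2
        push_cast; ring

end L7

section L8

variable {n : ℕ}

/-- The (dyadic radii) Hardy–Littlewood maximal function. -/
noncomputable def brM (u : EuclideanSpace ℝ (Fin n) → ℝ≥0∞) (x : EuclideanSpace ℝ (Fin n)) : ℝ≥0∞ :=
  ⨆ i : ℤ, ENNReal.ofReal ((((2:ℝ) ^ i) ^ n)⁻¹) * ∫⁻ y in Metric.closedBall x ((2:ℝ) ^ i), u y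

lemma br_ball_meas {u : EuclideanSpace ℝ (Fin n) → ℝ≥0∞} (hu : Measurable u) (r : ℝ) :
    Measurable fun x => ∫⁻ y in Metric.closedBall x r, u y := by
  have hms : MeasurableSet {z : EuclideanSpace ℝ (Fin n) × EuclideanSpace ℝ (Fin n) | dist z.2 z.1 ≤ r} :=
    measurableSet_le (by fun_prop) (by fun_prop)
  have h : ∀ x, ∫⁻ y in Metric.closedBall x r, u y = ∫⁻ y,
      {z : EuclideanSpace ℝ (Fin n) × EuclideanSpace ℝ (Fin n) | dist z.2 z.1 ≤ r}.indicator
        (fun z => u z.2) (x, y) := by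
    intro x
    rw [← lintegral_indicator Metric.isClosed_closedBall.measurableSet]
    rfl
  simp_rw [h]
  have hm : Measurable ({z : EuclideanSpace ℝ (Fin n) × EuclideanSpace ℝ (Fin n) | dist z.2 z.1 ≤ r}.indicator
        (fun z => u z.2)) := Measurable.indicator (by fun_prop) hms
  exact hm.lintegral_prod_right'

lemma brM_measurable {u : EuclideanSpace ℝ (Fin n) → ℝ≥0∞} (hu : Measurable u) : Measurable (brM u) := by
  unfold brM
  exact Measurable.iSup fun i => (br_ball_meas hu _).const_mul _

lemma br_vol_ball (x : EuclideanSpace ℝ (Fin n)) {r : ℝ} (hr : 0 ≤ r) :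
    volume (Metric.closedBall x r) =
      ENNReal.ofReal (r ^ n) * volume (Metric.ball (0 : EuclideanSpace ℝ (Fin n)) 1) := by
  rw [Measure.addHaar_closedBall _ x hr]
  simp

lemma brM_weak (hn : 1 ≤ n) {u : EuclideanSpace ℝ (Fin n) → ℝ≥0∞}
    (hI : ∫⁻ x, u x ≠ ⊤) {t : ℝ} (ht : 0 < t) :
    ENNReal.ofReal t * volume {x | ENNReal.ofReal t < brM u x} ≤
      ENNReal.ofReal (4 ^ n) * volume (Metric.ball (0 : EuclideanSpace ℝ (Fin n)) 1) * ∫⁻ x, u x := by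
  have hch : ∀ x : EuclideanSpace ℝ (Fin n), ∃ i : ℤ, ENNReal.ofReal t < brM u x →
      ENNReal.ofReal (t * ((2:ℝ) ^ i) ^ n) ≤ ∫⁻ y in Metric.closedBall x ((2:ℝ) ^ i), u y := by
    intro x
    by_cases hx : ENNReal.ofReal t < brM u x
    · obtain ⟨i, hi⟩ := lt_iSup_iff.1 hx
      refine ⟨i, fun _ => ?_⟩
      have h2 : (0:ℝ) < ((2:ℝ) ^ i) ^ n := by positivity
      calc ENNReal.ofReal (t * ((2:ℝ) ^ i) ^ n) = ENNReal.ofReal t * ENNReal.ofReal (((2:ℝ) ^ i) ^ n) :=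
            ENNReal.ofReal_mul ht.le
        _ ≤ ENNReal.ofReal ((((2:ℝ) ^ i) ^ n)⁻¹) * (∫⁻ y in Metric.closedBall x ((2:ℝ) ^ i), u y) *
            ENNReal.ofReal (((2:ℝ) ^ i) ^ n) := mul_le_mul_left hi.le _
        _ = _ := by
            rw [mul_right_comm, ← ENNReal.ofReal_mul (by positivity), inv_mul_cancel₀ h2.ne',
              ENNReal.ofReal_one, one_mul]
    · exact ⟨0, fun h => absurd h hx⟩
  choose i hi using hch
  set I := (∫⁻ x, u x).toReal with hIdef
  have hR : ∀ x ∈ {x | ENNReal.ofReal t < brM u x}, (2:ℝ) ^ (i x) ≤ 1 + I / t := by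
    intro x hx
    have h1 : ENNReal.ofReal (t * ((2:ℝ) ^ (i x)) ^ n) ≤ ENNReal.ofReal I := by
      rw [hIdef, ENNReal.ofReal_toReal hI]
      exact (hi x hx).trans (setLIntegral_le_lintegral _ _)
    rw [ENNReal.ofReal_le_ofReal_iff ENNReal.toReal_nonneg] at h1
    have hI0 : 0 ≤ I / t := div_nonneg ENNReal.toReal_nonneg ht.le
    rcases le_total ((2:ℝ) ^ (i x)) 1 with h | h
    · linarith
    · have h3 : (2:ℝ) ^ (i x) ≤ ((2:ℝ) ^ (i x)) ^ n := le_self_pow₀ h (by omega)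
      have h4 : ((2:ℝ) ^ (i x)) ^ n ≤ I / t := by rw [le_div_iff₀ ht]; linarith
      linarith
  obtain ⟨w, hwt, hdis, hcov⟩ := Vitali.exists_disjoint_subfamily_covering_enlargement_closedBall
    {x | ENNReal.ofReal t < brM u x} (fun x => x) (fun x => (2:ℝ) ^ (i x)) (1 + I / t) hR 4 (by norm_num)
  have hwc : w.Countable := hdis.countable_of_nonempty_interior fun x _ =>
    ⟨x, by
      have : (0:ℝ) < (2:ℝ) ^ (i x) := by positivity
      exact Metric.ball_subset_interior_closedBall (Metric.mem_ball_self this)⟩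
  have hsub : {x | ENNReal.ofReal t < brM u x} ⊆ ⋃ b ∈ w, Metric.closedBall b (4 * (2:ℝ) ^ (i b)) := by
    intro x hx
    obtain ⟨b, hb, hxb⟩ := hcov x hx
    exact Set.mem_biUnion hb (hxb (Metric.mem_closedBall_self (by positivity)))
  set v := volume (Metric.ball (0 : EuclideanSpace ℝ (Fin n)) 1)
  calc _ ≤ ENNReal.ofReal t * ∑' b : w, volume (Metric.closedBall (b : EuclideanSpace ℝ (Fin n)) (4 * (2:ℝ) ^ (i b))) :=
        mul_le_mul_right ((measure_mono hsub).trans (measure_biUnion_le _ hwc _)) _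
    _ = ∑' b : w, ENNReal.ofReal (4 ^ n) * v * ENNReal.ofReal (t * ((2:ℝ) ^ (i b)) ^ n) := by
        rw [← ENNReal.tsum_mul_left]
        refine tsum_congr fun b => ?_
        rw [br_vol_ball _ (by positivity), mul_pow, ENNReal.ofReal_mul (by positivity), ENNReal.ofReal_mul ht.le]
        ring
    _ ≤ ∑' b : w, ENNReal.ofReal (4 ^ n) * v * ∫⁻ y in Metric.closedBall (b : EuclideanSpace ℝ (Fin n)) ((2:ℝ) ^ (i b)), u y :=
        ENNReal.tsum_le_tsum fun b => mul_le_mul_right (hi b (hwt b.2)) _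
    _ = ENNReal.ofReal (4 ^ n) * v * ∫⁻ y in ⋃ b ∈ w, Metric.closedBall b ((2:ℝ) ^ (i b)), u y := by
        rw [ENNReal.tsum_mul_left, lintegral_biUnion hwc (fun b _ => Metric.isClosed_closedBall.measurableSet) hdis]
    _ ≤ _ := mul_le_mul_right (setLIntegral_le_lintegral _ _) _

lemma brM_strong (hn : 1 ≤ n) {p : ℝ} (hp : 1 < p) : ∃ C : ℝ, 0 < C ∧
    ∀ u : EuclideanSpace ℝ (Fin n) → ℝ≥0∞, Measurable u → ∫⁻ x, u x ≠ ⊤ →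
      ∫⁻ x, brM u x ^ p ≤ ENNReal.ofReal C * ∫⁻ x, u x ^ p := by
  set v := (volume (Metric.ball (0 : EuclideanSpace ℝ (Fin n)) 1)).toReal with hv
  have hvfin : volume (Metric.ball (0 : EuclideanSpace ℝ (Fin n)) 1) ≠ ⊤ := measure_ball_lt_top.ne
  have hv0 : 0 < v := ENNReal.toReal_pos (Metric.measure_ball_pos _ _ one_pos).ne' hvfin
  have hv' : volume (Metric.ball (0 : EuclideanSpace ℝ (Fin n)) 1) = ENNReal.ofReal v :=
    (ENNReal.ofReal_toReal hvfin).symm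
  have hp1 : 0 < p - 1 := by linarith
  refine ⟨(2 * (4 ^ n * v)) * p / (p - 1) * (1 / (2 * v)) ^ (-(p - 1)), by positivity, fun u hu hI => ?_⟩
  refine br_marcinkiewicz volume volume (brM_measurable hu) hu (r := 1) one_pos hp (by positivity)
    (by positivity) fun t ht => ?_
  simp only [Real.rpow_one, ENNReal.rpow_one]
  set E := {y | ENNReal.ofReal (1 / (2 * v) * t) < u y} with hE
  have hEm : MeasurableSet E := measurableSet_lt measurable_const hu
  have hle : ∀ x, brM u x ≤ brM (E.indicator u) x + ENNReal.ofReal (t / 2) := by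
    intro x
    refine iSup_le fun i => ?_
    have h2 : (0:ℝ) < ((2:ℝ) ^ i) ^ n := by positivity
    calc _ ≤ ENNReal.ofReal ((((2:ℝ) ^ i) ^ n)⁻¹) * ∫⁻ y in Metric.closedBall x ((2:ℝ) ^ i),
          (E.indicator u y + ENNReal.ofReal (1 / (2 * v) * t)) := by
          refine mul_le_mul_right (lintegral_mono fun y => ?_) _
          by_cases hy : y ∈ E
          · rw [Set.indicator_of_mem hy]; exact le_self_add
          · rw [Set.indicator_of_notMem hy, zero_add]; exact not_lt.1 hy
      _ = ENNReal.ofReal ((((2:ℝ) ^ i) ^ n)⁻¹) * (∫⁻ y in Metric.closedBall x ((2:ℝ) ^ i), E.indicator u y) +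
          ENNReal.ofReal (t / 2) := by
          rw [lintegral_add_right _ measurable_const, setLIntegral_const, br_vol_ball _ (by positivity), hv',
            mul_add]
          congr 1
          rw [← ENNReal.ofReal_mul (by positivity), ← ENNReal.ofReal_mul (by positivity),
            ← ENNReal.ofReal_mul (by positivity)]
          congr 1; field_simp
      _ ≤ _ := by
          gcongr
          exact le_iSup (fun i : ℤ => ENNReal.ofReal ((((2:ℝ) ^ i) ^ n)⁻¹) *
            ∫⁻ y in Metric.closedBall x ((2:ℝ) ^ i), E.indicator u y) i
  have hsub : {x | ENNReal.ofReal t < brM u x} ⊆ {x | ENNReal.ofReal (t / 2) < brM (E.indicator u) x} := by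
    intro x hx
    by_contra hcon
    have h1 : brM (E.indicator u) x ≤ ENNReal.ofReal (t / 2) := not_lt.1 hcon
    have h2 : brM u x ≤ ENNReal.ofReal t := by
      refine (hle x).trans ((add_le_add_left h1 _).trans (le_of_eq ?_))
      rw [← ENNReal.ofReal_add (by positivity) (by positivity)]; congr 1; ring
    exact absurd hx (not_lt.2 h2)
  have hIE : ∫⁻ x, E.indicator u x ≠ ⊤ :=
    ((lintegral_mono fun x => Set.indicator_le_self E u x).trans_lt hI.lt_top).ne
  have hw := brM_weak hn hIE (half_pos ht)
  rw [lintegral_indicator hEm, hv'] at hw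
  calc _ ≤ ENNReal.ofReal 2 * (ENNReal.ofReal (t / 2) * volume {x | ENNReal.ofReal (t / 2) < brM (E.indicator u) x}) := by
        rw [← mul_assoc, ← ENNReal.ofReal_mul (by norm_num), mul_div_cancel₀ t (by norm_num : (2:ℝ) ≠ 0)]
        exact mul_le_mul_right (measure_mono hsub) _
    _ ≤ _ := by
        refine (mul_le_mul_right hw _).trans (le_of_eq ?_)
        rw [← mul_assoc, ← ENNReal.ofReal_mul (by positivity), ← ENNReal.ofReal_mul (by positivity)]

end L8

section L9

variable {n : ℕ}

lemma br_annuli (n : ℕ) {a : ℝ} (ha : 0 ≤ a) :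
    ENNReal.ofReal (((1 + a) ^ (n + 1))⁻¹) ≤
      ∑' i : ℕ, ENNReal.ofReal (2 ^ (n + 1) * (((2:ℝ) ^ i) ^ (n + 1))⁻¹) *
        (Set.Iic ((2:ℝ) ^ i)).indicator 1 a := by
  have hex : ∃ i : ℕ, a ≤ (2:ℝ) ^ i := by
    obtain ⟨i, hi⟩ := pow_unbounded_of_one_lt a (by norm_num : (1:ℝ) < 2)
    exact ⟨i, hi.le⟩
  classical
  set i := Nat.find hex with hi
  have h1 : a ≤ (2:ℝ) ^ i := Nat.find_spec hex
  refine le_trans ?_ (ENNReal.le_tsum i)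
  rw [Set.indicator_of_mem (show a ∈ Set.Iic ((2:ℝ) ^ i) from h1), Pi.one_apply, mul_one]
  refine ENNReal.ofReal_le_ofReal ?_
  have h2 : (2:ℝ) ^ i ≤ 2 * (1 + a) := by
    rcases Nat.eq_zero_or_pos i with h0 | h0
    · rw [h0]; simp; linarith
    · have := Nat.find_min hex (show i - 1 < Nat.find hex by rw [← hi]; omega)
      rw [not_le] at this
      have h3 : (2:ℝ) ^ i = 2 * 2 ^ (i - 1) := by
        rw [← pow_succ']; congr 1; omega
      rw [h3]; linarith
  rw [← inv_inv ((2:ℝ) ^ (n + 1)), ← mul_inv, inv_le_inv₀ (by positivity) (by positivity), ← inv_pow, ← mul_pow]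
  gcongr
  linarith

lemma br_maj_le_M {u : EuclideanSpace ℝ (Fin n) → ℝ≥0∞} (hu : Measurable u) (k : ℤ) (x : EuclideanSpace ℝ (Fin n)) :
    ∫⁻ y, u y * ENNReal.ofReal (((2:ℝ) ^ k) ^ n * ((1 + (2:ℝ) ^ k * ‖x - y‖) ^ (n + 1))⁻¹) ≤
      ENNReal.ofReal (2 ^ (n + 2)) * brM u x := by
  have h2k : (0:ℝ) < (2:ℝ) ^ k := by positivity
  calc _ ≤ ∫⁻ y, ∑' i : ℕ, (Metric.closedBall x ((2:ℝ) ^ ((i:ℤ) - k))).indicator (fun y =>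
        ENNReal.ofReal (((2:ℝ) ^ k) ^ n * (2 ^ (n + 1) * (((2:ℝ) ^ i) ^ (n + 1))⁻¹)) * u y) y := by
        refine lintegral_mono fun y => ?_
        rw [ENNReal.ofReal_mul (by positivity)]
        refine (mul_le_mul_right (mul_le_mul_right (br_annuli n (by positivity)) _) _).trans (le_of_eq ?_)
        rw [← ENNReal.tsum_mul_left, ← ENNReal.tsum_mul_left]
        refine tsum_congr fun i => ?_
        by_cases hy : y ∈ Metric.closedBall x ((2:ℝ) ^ ((i:ℤ) - k))
        · rw [Set.indicator_of_mem hy, Set.indicator_of_mem, ENNReal.ofReal_mul (p := ((2:ℝ) ^ k) ^ n) (by positivity), Pi.one_apply]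
          · generalize ENNReal.ofReal (2 ^ (n + 1) * (((2:ℝ) ^ i) ^ (n + 1))⁻¹) = Q
            ring
          · rw [Metric.mem_closedBall, dist_comm, dist_eq_norm, zpow_sub₀ (by norm_num), le_div_iff₀ h2k] at hy
            rw [Set.mem_Iic]
            rw [zpow_natCast] at hy; linarith
        · rw [Set.indicator_of_notMem hy, Set.indicator_of_notMem]
          · ring
          · intro hcon
            apply hy
            rw [Metric.mem_closedBall, dist_comm, dist_eq_norm, zpow_sub₀ (by norm_num), le_div_iff₀ h2k, zpow_natCast]
            rw [Set.mem_Iic] at hcon; linarith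
    _ = ∑' i : ℕ, ENNReal.ofReal (((2:ℝ) ^ k) ^ n * (2 ^ (n + 1) * (((2:ℝ) ^ i) ^ (n + 1))⁻¹)) *
        ∫⁻ y in Metric.closedBall x ((2:ℝ) ^ ((i:ℤ) - k)), u y := by
        rw [lintegral_tsum]
        · refine tsum_congr fun i => ?_
          rw [lintegral_indicator Metric.isClosed_closedBall.measurableSet,
            lintegral_const_mul' _ _ ENNReal.ofReal_ne_top]
        · exact fun i => ((hu.const_mul _).indicator Metric.isClosed_closedBall.measurableSet).aemeasurable
    _ ≤ ∑' i : ℕ, ENNReal.ofReal (2 ^ (n + 1)) * ENNReal.ofReal ((1 / 2) ^ i) * brM u x := by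
        refine ENNReal.tsum_le_tsum fun i => ?_
        have h1 := le_iSup (fun j : ℤ => ENNReal.ofReal ((((2:ℝ) ^ j) ^ n)⁻¹) *
            ∫⁻ y in Metric.closedBall x ((2:ℝ) ^ j), u y) ((i:ℤ) - k)
        refine le_trans (le_of_eq ?_) (mul_le_mul_right h1 _)
        rw [← ENNReal.ofReal_mul (by positivity), ← mul_assoc (ENNReal.ofReal _) (ENNReal.ofReal _) (lintegral _ _),
          ← ENNReal.ofReal_mul (by positivity)]
        congr 2
        rw [zpow_sub₀ (by norm_num), zpow_natCast, div_pow, div_pow, one_pow]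
        generalize (2:ℝ) ^ k = a at h2k ⊢
        have hb : (0:ℝ) < (2:ℝ) ^ i := by positivity
        generalize (2:ℝ) ^ i = b at hb ⊢
        rw [pow_succ b n]
        field_simp
    _ = _ := by
        rw [ENNReal.tsum_mul_right, ENNReal.tsum_mul_left, ← ENNReal.ofReal_tsum_of_nonneg (fun i => by positivity)
          summable_geometric_two, tsum_geometric_two, ← ENNReal.ofReal_mul (by positivity)]
        congr 2

lemma br_one_add_pow (a : ℝ) (ha : 0 ≤ a) (m : ℕ) : (1 + a) ^ (m + 1) ≤ 2 ^ m * (1 + a ^ (m + 1)) := by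
  have := add_pow_le (zero_le_one' ℝ) ha (m + 1)
  simpa using this

lemma br_kernel_maj {φ : ℝ → ℝ} (hφ : ContDiff ℝ (⊤ : ℕ∞) φ)
    (hsupp : ∀ t, t ∉ Set.Icc (0 : ℝ) 8 → φ t = 0) :
    ∃ C : ℝ, 0 < C ∧ ∀ s : ℝ, s ≤ 8 → ∀ x : EuclideanSpace ℝ (Fin n),
      ‖𝓕⁻ (fun ξ : EuclideanSpace ℝ (Fin n) => ((φ ((s - ‖ξ‖ ^ 2) / 1) : ℝ) : ℂ)) x‖ ≤
        C * ((1 + ‖x‖) ^ (n + 1))⁻¹ := by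
  obtain ⟨C0, hC0, h0⟩ := br_kernel_tail (n := n) hφ hsupp 0
  obtain ⟨C1, hC1, h1⟩ := br_kernel_tail (n := n) hφ hsupp (n + 1)
  refine ⟨2 ^ n * (C0 + C1), by positivity, fun s hs x => ?_⟩
  have e0 := h0 1 s one_pos le_rfl hs x
  have e1 := h1 1 s one_pos le_rfl hs x
  simp only [inv_one, one_pow, mul_one, pow_zero, one_mul] at e0 e1
  generalize ‖𝓕⁻ (fun ξ : EuclideanSpace ℝ (Fin n) => ((φ ((s - ‖ξ‖ ^ 2) / 1) : ℝ) : ℂ)) x‖ = A at *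
  rw [← div_eq_mul_inv, le_div_iff₀ (by positivity)]
  have hA : 0 ≤ ‖x‖ ^ (n + 1) := by positivity
  rcases le_or_gt 0 A with hA0 | hA0
  · calc _ ≤ A * (2 ^ n * (1 + ‖x‖ ^ (n + 1))) := by gcongr; exact br_one_add_pow _ (norm_nonneg _) _
      _ = 2 ^ n * (A + ‖x‖ ^ (n + 1) * A) := by ring
      _ ≤ _ := by gcongr
  · have : A * (1 + ‖x‖) ^ (n + 1) ≤ 0 := mul_nonpos_of_nonpos_of_nonneg hA0.le (by positivity)
    refine this.trans (by positivity)

lemma br_kernel_far {φ : ℝ → ℝ} (hφ : ContDiff ℝ (⊤ : ℕ∞) φ)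
    (hsupp : ∀ t, t ∉ Set.Icc (0 : ℝ) 8 → φ t = 0) {ε : ℝ} (hε : 0 < ε) :
    ∃ C : ℝ, 0 < C ∧ ∀ δ s : ℝ, 0 < δ → δ ≤ 1 → s ≤ 8 → ∀ x : EuclideanSpace ℝ (Fin n),
      δ ^ (-(1 + ε)) ≤ ‖x‖ →
      ‖𝓕⁻ (fun ξ : EuclideanSpace ℝ (Fin n) => ((φ ((s - ‖ξ‖ ^ 2) / δ) : ℝ) : ℂ)) x‖ ≤
        C * ((1 + ‖x‖) ^ (n + 1))⁻¹ := by
  obtain ⟨M, hM⟩ := exists_nat_ge (((n:ℝ) + 1) / ε)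
  obtain ⟨C, hC, h⟩ := br_kernel_tail (n := n) hφ hsupp (M + (n + 1))
  refine ⟨C * 2 ^ (n + 1), by positivity, fun δ s hδ hδ1 hs x hx => ?_⟩
  have e := h δ s hδ hδ1 hs x
  generalize ‖𝓕⁻ (fun ξ : EuclideanSpace ℝ (Fin n) => ((φ ((s - ‖ξ‖ ^ 2) / δ) : ℝ) : ℂ)) x‖ = A at *
  have hx1 : 1 ≤ ‖x‖ := le_trans (Real.one_le_rpow_of_pos_of_le_one_of_nonpos hδ hδ1 (by linarith)) hx
  have hx0 : 0 < ‖x‖ := by linarith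
  have hpow : (δ⁻¹) ^ (M + (n + 1)) ≤ ‖x‖ ^ M := by
    calc (δ⁻¹) ^ (M + (n + 1)) = δ ^ (-((M:ℝ) + (n + 1))) := by
          rw [Real.rpow_neg hδ.le, ← Real.inv_rpow hδ.le, ← Real.rpow_natCast]; push_cast; rfl
      _ ≤ δ ^ (-(1 + ε) * M) := by
          refine Real.rpow_le_rpow_of_exponent_ge hδ hδ1 ?_
          rw [div_le_iff₀ hε] at hM
          linarith
      _ = (δ ^ (-(1 + ε))) ^ M := by rw [Real.rpow_mul hδ.le, Real.rpow_natCast]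
      _ ≤ _ := by gcongr
  have h2 : ‖x‖ ^ (n + 1) * A ≤ C := by
    have h3 : ‖x‖ ^ M * (‖x‖ ^ (n + 1) * A) ≤ ‖x‖ ^ M * C := by
      calc _ = ‖x‖ ^ (M + (n + 1)) * A := by rw [pow_add]; ring
        _ ≤ C * (δ⁻¹) ^ (M + (n + 1)) := e
        _ ≤ C * ‖x‖ ^ M := by gcongr
        _ = _ := mul_comm _ _
    exact le_of_mul_le_mul_left h3 (by positivity)
  rw [← div_eq_mul_inv, le_div_iff₀ (by positivity)]
  rcases le_or_gt 0 A with hA0 | hA0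
  · calc A * (1 + ‖x‖) ^ (n + 1) ≤ A * (2 * ‖x‖) ^ (n + 1) := by gcongr; linarith
      _ = (‖x‖ ^ (n + 1) * A) * 2 ^ (n + 1) := by rw [mul_pow]; ring
      _ ≤ _ := by gcongr
  · have : A * (1 + ‖x‖) ^ (n + 1) ≤ 0 := mul_nonpos_of_nonpos_of_nonneg hA0.le (by positivity)
    refine this.trans (by positivity)

end L9

section L10

variable {n : ℕ}

lemma br_near (n : ℕ) (hn : 2 ≤ n) {p : ℝ} (hp1 : 2 ≤ p) (hp2 : p < 2 * ((n : ℝ) + 1) / ((n : ℝ) - 1))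
    {φ : ℝ → ℝ} (hφ : ContDiff ℝ 1 φ) (hsupp : ∀ t, t ∉ Set.Icc (1 / 2 : ℝ) 2 → φ t = 0) :
    ∃ C : ℝ, 0 < C ∧ ∀ δ : ℝ, 0 < δ → δ ≤ 1 / 4 → ∀ G : EuclideanSpace ℝ (Fin n) → ℂ,
      Integrable G → MemLp G 2 → ∀ (B : Set (EuclideanSpace ℝ (Fin n))) (m : ℝ), MeasurableSet B → 0 < m →
        volume B ≤ ENNReal.ofReal m →
        ∫⁻ x in B, (⨆ s ∈ Set.Icc (1:ℝ) 4, ‖brF φ δ s G x‖ₑ) ^ p ≤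
          ENNReal.ofReal (C * δ ^ (p / 2) * m ^ (1 - (p / 2) * (1 - 2 / ((n:ℝ) + 1)))) *
            (∫⁻ x, ‖G x‖ₑ ^ 2) ^ (p / 2) := by
  obtain ⟨C, hC, h5⟩ := br_L5 n hn φ hφ hsupp
  have hn' : (2:ℝ) ≤ n := by exact_mod_cast hn
  set θ : ℝ := 2 / ((n:ℝ) + 1) with hθ
  have hθ0 : 0 < θ := by positivity
  have hθ1 : θ < 1 := by rw [hθ, div_lt_one (by positivity)]; linarith
  have hq : 0 < p / 2 := by linarith
  have hq2 : p / 2 * (1 - θ) < 1 := by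
    rw [lt_div_iff₀ (by linarith)] at hp2
    have : 1 - θ = ((n:ℝ) - 1) / (n + 1) := by rw [hθ]; field_simp; ring
    rw [this, ← mul_div_assoc, div_lt_one (by positivity)]
    linarith
  have hc : 0 < 1 + p / 2 * (1 - θ) / (1 - p / 2 * (1 - θ)) := by
    have h1 : 0 < 1 - θ := by linarith
    have h2 : 0 < 1 - p / 2 * (1 - θ) := by linarith
    positivity
  refine ⟨(1 + p / 2 * (1 - θ) / (1 - p / 2 * (1 - θ))) * C ^ (p / 2), by positivity,
    fun δ hδ hδ4 G hG hG2 B m hB hm hBm => ?_⟩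
  obtain ⟨W, hWm, hsup, hW⟩ := h5 δ hδ hδ4 G hG hG2
  have hIfin : ∫⁻ x, ‖G x‖ₑ ^ 2 ≠ ⊤ := by
    rw [← br_eLp2_sq]; exact ENNReal.pow_ne_top hG2.eLpNorm_ne_top
  have h1 : ∫⁻ x in B, (⨆ s ∈ Set.Icc (1:ℝ) 4, ‖brF φ δ s G x‖ₑ) ^ p ≤ ∫⁻ x in B, W x ^ (p / 2) := by
    refine lintegral_mono fun x => ?_
    have h2 : (⨆ s ∈ Set.Icc (1:ℝ) 4, ‖brF φ δ s G x‖ₑ) ≤ W x ^ (1 / 2 : ℝ) := by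
      refine iSup₂_le fun s hs => ?_
      rw [one_div, ENNReal.le_rpow_inv_iff (by norm_num)]
      have := hsup x s hs
      rwa [← ENNReal.rpow_natCast] at this
    calc _ ≤ (W x ^ (1 / 2 : ℝ)) ^ p := ENNReal.rpow_le_rpow h2 (by linarith)
      _ = _ := by rw [← ENNReal.rpow_mul]; congr 1; ring
  refine h1.trans ?_
  rcases eq_or_ne (∫⁻ x, ‖G x‖ₑ ^ 2) 0 with hI | hI
  · have h2 := hW B m hB hm hBm
    rw [hI, mul_zero, nonpos_iff_eq_zero, lintegral_eq_zero_iff hWm] at h2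
    have h3 : ∫⁻ x in B, W x ^ (p / 2) = 0 := by
      rw [lintegral_eq_zero_iff (hWm.pow_const _)]
      filter_upwards [h2] with x hx
      simp only [Pi.zero_apply] at hx ⊢
      rw [hx, ENNReal.zero_rpow_of_pos hq]
    rw [h3]; exact zero_le
  · set I := (∫⁻ x, ‖G x‖ₑ ^ 2).toReal with hIdef
    have hI0 : 0 < I := ENNReal.toReal_pos hI hIfin
    have hIe : ∫⁻ x, ‖G x‖ₑ ^ 2 = ENNReal.ofReal I := (ENNReal.ofReal_toReal hIfin).symm
    have h6 := br_L6 volume hWm hθ0 hθ1 hq hq2 (D := C * δ * I) (by positivity) (fun E m hE hm hEm => by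
      refine (hW E m hE hm hEm).trans (le_of_eq ?_)
      rw [hIe, ← ENNReal.ofReal_mul (by positivity)]
      congr 1; ring) hB hm hBm
    refine h6.trans (le_of_eq ?_)
    rw [hIe, ENNReal.ofReal_rpow_of_pos hI0, ← ENNReal.ofReal_mul (by positivity),
      Real.mul_rpow (by positivity) hI0.le, Real.mul_rpow hC.le hδ.le]
    congr 1; ring

lemma br_holder {p : ℝ} (hp : 2 ≤ p) {g : EuclideanSpace ℝ (Fin n) → ℂ} (hg : AEStronglyMeasurable g)
    (A : Set (EuclideanSpace ℝ (Fin n))) :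
    (∫⁻ x in A, ‖g x‖ₑ ^ 2) ^ (p / 2) ≤ (∫⁻ x in A, ‖g x‖ₑ ^ p) * volume A ^ (p / 2 - 1) := by
  have hp0 : 0 < p := by linarith
  have h := eLpNorm'_le_eLpNorm'_mul_rpow_measure_univ (μ := volume.restrict A) (p := 2) (q := p)
    (by norm_num) hp hg.restrict
  unfold eLpNorm' at h
  have h2 := ENNReal.rpow_le_rpow h hp0.le
  rw [ENNReal.mul_rpow_of_nonneg _ _ hp0.le, ← ENNReal.rpow_mul, ← ENNReal.rpow_mul, ← ENNReal.rpow_mul,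
    Measure.restrict_apply_univ, one_div_mul_cancel hp0.ne', ENNReal.rpow_one] at h2
  have e1 : (1 / 2 - 1 / p) * p = p / 2 - 1 := by field_simp
  have e2 : 1 / 2 * p = p / 2 := by ring
  rw [e1, e2] at h2
  simpa using h2

lemma br_avg {H : EuclideanSpace ℝ (Fin n) → ℝ≥0∞} (hH : Measurable H) {r : ℝ} (hr : 0 ≤ r) :
    ∫⁻ y, ∫⁻ x in Metric.closedBall y r, H x =
      ENNReal.ofReal (r ^ n) * volume (Metric.ball (0 : EuclideanSpace ℝ (Fin n)) 1) * ∫⁻ x, H x := by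
  have hms : MeasurableSet {z : EuclideanSpace ℝ (Fin n) × EuclideanSpace ℝ (Fin n) | dist z.2 z.1 ≤ r} :=
    measurableSet_le (by fun_prop) (by fun_prop)
  have h : ∀ x, ∫⁻ y in Metric.closedBall x r, H y = ∫⁻ y,
      {z : EuclideanSpace ℝ (Fin n) × EuclideanSpace ℝ (Fin n) | dist z.2 z.1 ≤ r}.indicator
        (fun z => H z.2) (x, y) := by
    intro x
    rw [← lintegral_indicator Metric.isClosed_closedBall.measurableSet]
    rfl
  have hm : Measurable ({z : EuclideanSpace ℝ (Fin n) × EuclideanSpace ℝ (Fin n) | dist z.2 z.1 ≤ r}.indicator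
        (fun z => H z.2)) := Measurable.indicator (by fun_prop) hms
  simp_rw [h]
  have hsw := lintegral_lintegral_swap (μ := volume) (ν := volume) (f := fun x y : EuclideanSpace ℝ (Fin n) =>
    {z : EuclideanSpace ℝ (Fin n) × EuclideanSpace ℝ (Fin n) | dist z.2 z.1 ≤ r}.indicator
        (fun z => H z.2) (x, y)) hm.aemeasurable
  rw [hsw, ← lintegral_const_mul _ hH]
  refine lintegral_congr fun x => ?_
  rw [← br_vol_ball x hr, mul_comm, ← setLIntegral_const,
    ← lintegral_indicator Metric.isClosed_closedBall.measurableSet]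
  refine lintegral_congr fun y => ?_
  by_cases hy : y ∈ Metric.closedBall x r
  · rw [Set.indicator_of_mem hy, Set.indicator_of_mem]
    rw [Metric.mem_closedBall, dist_comm] at hy; exact hy
  · rw [Set.indicator_of_notMem hy, Set.indicator_of_notMem]
    rw [Metric.mem_closedBall, dist_comm] at hy; exact hy

lemma br_supp_weaken {φ : ℝ → ℝ} (hsupp : ∀ t, t ∉ Set.Icc (1 / 2 : ℝ) 2 → φ t = 0) :
    ∀ t, t ∉ Set.Icc (0 : ℝ) 8 → φ t = 0 := fun t ht => hsupp t fun h =>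
  ht ⟨by linarith [h.1], by linarith [h.2]⟩

lemma br_symbol_integrable {φ : ℝ → ℝ} (hφ : ContDiff ℝ (⊤ : ℕ∞) φ)
    (hsupp : ∀ t, t ∉ Set.Icc (0 : ℝ) 8 → φ t = 0) {δ s : ℝ} (hδ : 0 < δ) (hs : s ≤ 8) :
    Integrable (fun ξ : EuclideanSpace ℝ (Fin n) => ((φ ((s - ‖ξ‖ ^ 2) / δ) : ℝ) : ℂ)) :=
  (br_symbol_smooth hφ δ s).continuous.integrable_of_hasCompactSupport (br_symbol_compact hsupp hδ hs)

lemma brF_conv_le {φ : ℝ → ℝ} (hφ : ContDiff ℝ (⊤ : ℕ∞) φ)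
    (hsupp : ∀ t, t ∉ Set.Icc (0 : ℝ) 8 → φ t = 0) {δ s : ℝ} (hδ : 0 < δ) (hs : s ≤ 8)
    {G : EuclideanSpace ℝ (Fin n) → ℂ} (hG : Integrable G) (x : EuclideanSpace ℝ (Fin n)) :
    ‖brF φ δ s G x‖ₑ ≤ ∫⁻ y, ‖G y‖ₑ *
      ‖𝓕⁻ (fun ξ : EuclideanSpace ℝ (Fin n) => ((φ ((s - ‖ξ‖ ^ 2) / δ) : ℝ) : ℂ)) (x - y)‖ₑ := by
  unfold brF
  rw [br_conv (br_symbol_integrable hφ hsupp hδ hs) hG]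
  refine (enorm_integral_le_lintegral_enorm _).trans (le_of_eq ?_)
  exact lintegral_congr fun y => enorm_mul _ _

lemma brF_add {φ : ℝ → ℝ} (hφ : ContDiff ℝ (⊤ : ℕ∞) φ)
    (hsupp : ∀ t, t ∉ Set.Icc (0 : ℝ) 8 → φ t = 0) {δ s : ℝ} (hδ : 0 < δ) (hs : s ≤ 8)
    {G H : EuclideanSpace ℝ (Fin n) → ℂ} (hG : Integrable G) (hH : Integrable H) (x : EuclideanSpace ℝ (Fin n)) :
    brF φ δ s (G + H) x = brF φ δ s G x + brF φ δ s H x := by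
  have hm := br_symbol_integrable (n := n) hφ hsupp hδ hs
  have hb : ∀ K : EuclideanSpace ℝ (Fin n) → ℂ, Integrable K → Integrable (fun ξ =>
      Complex.exp (↑(2 * Real.pi * ⟪ξ, x⟫) * I) • (((φ ((s - ‖ξ‖ ^ 2) / δ) : ℝ) : ℂ) * 𝓕 K ξ)) := by
    intro K hK
    have h1 := hm.mul_bdd (br_fourier_continuous hK).aestronglyMeasurable
      (Eventually.of_forall fun ξ => br_fourier_norm_le ξ)
    have hc : Continuous fun ξ : EuclideanSpace ℝ (Fin n) => Complex.exp (↑(2 * Real.pi * ⟪ξ, x⟫) * I) := by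
      fun_prop
    exact h1.bdd_mul hc.aestronglyMeasurable
      (Eventually.of_forall fun ξ => (Complex.norm_exp_ofReal_mul_I _).le)
  unfold brF
  simp only [Real.fourierInv_eq']
  rw [← integral_add (hb G hG) (hb H hH)]
  refine integral_congr_ae (Eventually.of_forall fun ξ => ?_)
  have h2 : 𝓕 (G + H) ξ = 𝓕 G ξ + 𝓕 H ξ := by
    simp only [Real.fourier_eq', Pi.add_apply, smul_add]
    have hb2 : ∀ K : EuclideanSpace ℝ (Fin n) → ℂ, Integrable K → Integrable (fun v =>
        Complex.exp (↑(-2 * Real.pi * ⟪v, ξ⟫) * I) • K v) := by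
      intro K hK
      have hc : Continuous fun v : EuclideanSpace ℝ (Fin n) => Complex.exp (↑(-2 * Real.pi * ⟪v, ξ⟫) * I) := by
        fun_prop
      exact hK.bdd_mul hc.aestronglyMeasurable
        (Eventually.of_forall fun ξ => (Complex.norm_exp_ofReal_mul_I _).le)
    exact integral_add (hb2 G hG) (hb2 H hH)
  simp only [h2, smul_eq_mul]
  ring

end L10

section L10b

variable {n : ℕ}

lemma brF_sup_measurable {φ : ℝ → ℝ} (hφ : Continuous φ) (hsupp : ∀ t, t ∉ Set.Icc (1 / 2 : ℝ) 2 → φ t = 0)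
    {δ : ℝ} (hδ : 0 < δ) {G : EuclideanSpace ℝ (Fin n) → ℂ} (hG : Integrable G) :
    Measurable fun x => ⨆ s ∈ Set.Icc (1:ℝ) 4, ‖brF φ δ s G x‖ₑ := by
  obtain ⟨A, -, hA⟩ := br_bdd_of_supp hφ hsupp
  have hc := brF_continuous hφ hsupp hA hδ hG
  refine LowerSemicontinuous.measurable (lowerSemicontinuous_biSup fun s _ => Continuous.lowerSemicontinuous ?_)
  have h3 : Continuous fun x : EuclideanSpace ℝ (Fin n) => ((s, x) : ℝ × EuclideanSpace ℝ (Fin n)) := by fun_prop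
  have h4 := hc.comp h3
  simp only [Function.comp_def] at h4
  exact h4.enorm

lemma br_local {φ : ℝ → ℝ} (hφ : ContDiff ℝ (⊤ : ℕ∞) φ)
    (hsupp : ∀ t, t ∉ Set.Icc (1 / 2 : ℝ) 2 → φ t = 0) {ε : ℝ} (hε : 0 < ε) :
    ∃ C : ℝ, 0 < C ∧ ∀ δ : ℝ, 0 < δ → δ ≤ 1 → ∀ g : EuclideanSpace ℝ (Fin n) → ℂ, Measurable g → Integrable g →
      ∀ x y, x ∈ Metric.closedBall y (δ ^ (-(1 + ε))) →
        (⨆ s ∈ Set.Icc (1:ℝ) 4, ‖brF φ δ s g x‖ₑ) ≤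
        (⨆ s ∈ Set.Icc (1:ℝ) 4,
          ‖brF φ δ s ((Metric.closedBall y (2 * δ ^ (-(1 + ε)))).indicator g) x‖ₑ) +
          ENNReal.ofReal C * brM (fun z => ‖g z‖ₑ) x := by
  have hs8 := br_supp_weaken hsupp
  obtain ⟨C, hC, hK⟩ := br_kernel_far (n := n) hφ hs8 hε
  refine ⟨C * 2 ^ (n + 2), by positivity, fun δ hδ hδ1 g hgm hg x y hx => ?_⟩
  set ρ := δ ^ (-(1 + ε)) with hρ
  have hA : MeasurableSet (Metric.closedBall y (2 * ρ)) := Metric.isClosed_closedBall.measurableSet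
  refine iSup₂_le fun s hs => ?_
  have hs' : s ≤ 8 := by linarith [hs.2]
  have hsplit : g = (Metric.closedBall y (2 * ρ)).indicator g + (Metric.closedBall y (2 * ρ))ᶜ.indicator g :=
    (Set.indicator_self_add_compl _ g).symm
  have hadd := brF_add hφ hs8 hδ hs' (hg.indicator hA) (hg.indicator hA.compl) x
  rw [← hsplit] at hadd
  rw [hadd]
  refine (enorm_add_le _ _).trans (add_le_add (le_iSup₂_of_le s hs le_rfl) ?_)
  refine (brF_conv_le hφ hs8 hδ hs' (hg.indicator hA.compl) x).trans ?_
  have hmaj := br_maj_le_M (u := fun z => ‖g z‖ₑ) hgm.enorm 0 x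
  rw [ENNReal.ofReal_mul hC.le, mul_assoc]
  refine le_trans ?_ (mul_le_mul_right hmaj _)
  rw [← lintegral_const_mul' _ _ ENNReal.ofReal_ne_top]
  refine lintegral_mono fun z => ?_
  by_cases hz : z ∈ Metric.closedBall y (2 * ρ)
  · simp [hz]
  · rw [Set.indicator_of_mem (by exact hz)]
    have hd : ρ ≤ ‖x - z‖ := by
      rw [Metric.mem_closedBall] at hz hx
      rw [← dist_eq_norm]
      have := dist_triangle z x y
      rw [dist_comm z x] at this
      push Not at hz
      linarith
    have h1 := hK δ s hδ hδ1 hs' (x - z) hd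
    have h2 := ENNReal.ofReal_le_ofReal h1
    rw [ofReal_norm, ENNReal.ofReal_mul hC.le] at h2
    calc _ ≤ ‖g z‖ₑ * (ENNReal.ofReal C * ENNReal.ofReal (((1 + ‖x - z‖) ^ (n + 1))⁻¹)) := mul_le_mul_right h2 _
      _ = _ := by simp only [zpow_zero, one_pow, one_mul]; ring

lemma br_claimS (n : ℕ) (hn : 2 ≤ n) {p β : ℝ} (hp1 : 2 ≤ p)
    (hp2 : p < 2 * ((n : ℝ) + 1) / ((n : ℝ) - 1)) (hβ : ((n : ℝ) - 1) / (2 * ((n : ℝ) + 1)) < β)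
    {φ : ℝ → ℝ} (hφ : ContDiff ℝ (⊤ : ℕ∞) φ) (hsupp : ∀ t, t ∉ Set.Icc (1 / 2 : ℝ) 2 → φ t = 0) :
    ∃ C : ℝ, 0 < C ∧ ∀ δ : ℝ, 0 < δ → δ ≤ 1 / 4 → ∀ g : EuclideanSpace ℝ (Fin n) → ℂ,
      Measurable g → Integrable g → MemLp g 2 →
        ∫⁻ x, (⨆ s ∈ Set.Icc (1:ℝ) 4, ‖brF φ δ s g x‖ₑ) ^ p ≤
          ENNReal.ofReal (C * δ ^ (-(p * β))) * ∫⁻ x, ‖g x‖ₑ ^ p := by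
  have hp0 : 0 < p := by linarith
  have hn' : (2:ℝ) ≤ n := by exact_mod_cast hn
  set β0 := ((n : ℝ) - 1) / (2 * ((n : ℝ) + 1)) with hβ0
  have hβ00 : 0 < β0 := by
    have : (0:ℝ) < n - 1 := by linarith
    positivity
  set ε := (β - β0) * (n + 1) / n with hεd
  have hε : 0 < ε := by
    have : 0 < β - β0 := by linarith
    positivity
  set v := (volume (Metric.ball (0 : EuclideanSpace ℝ (Fin n)) 1)).toReal with hv
  have hvfin : volume (Metric.ball (0 : EuclideanSpace ℝ (Fin n)) 1) ≠ ⊤ := measure_ball_lt_top.ne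
  have hv0 : 0 < v := ENNReal.toReal_pos (Metric.measure_ball_pos _ _ one_pos).ne' hvfin
  have hve : volume (Metric.ball (0 : EuclideanSpace ℝ (Fin n)) 1) = ENNReal.ofReal v :=
    (ENNReal.ofReal_toReal hvfin).symm
  obtain ⟨C1, hC1, hloc⟩ := br_local (n := n) hφ hsupp hε
  obtain ⟨C2, hC2, hnear⟩ := br_near n hn hp1 hp2 (hφ.of_le (by exact_mod_cast le_top)) hsupp
  obtain ⟨C3, hC3, hM⟩ := brM_strong (n := n) (by lia) (p := p) (by linarith)
  set θ : ℝ := 2 / ((n:ℝ) + 1) with hθ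
  refine ⟨2 ^ (p - 1) * (C2 * ((2:ℝ) ^ n) ^ (p / 2) * v ^ (p / 2 * θ) + C1 ^ p * C3), by positivity,
    fun δ hδ hδ4 g hgm hg hg2 => ?_⟩
  set ρ := δ ^ (-(1 + ε)) with hρ
  have hρ0 : 0 < ρ := by positivity
  set m := ρ ^ n * v with hm
  have hm0 : 0 < m := by positivity
  set S := fun x => ⨆ s ∈ Set.Icc (1:ℝ) 4, ‖brF φ δ s g x‖ₑ with hS
  have hSm : Measurable S := brF_sup_measurable hφ.continuous hsupp hδ hg
  set M := fun x => brM (fun z => ‖g z‖ₑ) x with hMd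
  have hMm : Measurable M := brM_measurable hgm.enorm
  have hvol : ∀ y : EuclideanSpace ℝ (Fin n), volume (Metric.closedBall y ρ) = ENNReal.ofReal m := fun y => by
    rw [br_vol_ball y hρ0.le, hve, ← ENNReal.ofReal_mul (by positivity)]
  have hvol2 : ∀ y : EuclideanSpace ℝ (Fin n), volume (Metric.closedBall y (2 * ρ)) = ENNReal.ofReal (2 ^ n * m) :=
    fun y => by
      rw [br_vol_ball y (by positivity), hve, ← ENNReal.ofReal_mul (by positivity)]
      congr 1; rw [hm, mul_pow]; ring
  set D := C2 * δ ^ (p / 2) * m ^ (1 - (p / 2) * (1 - θ)) * (2 ^ n * m) ^ (p / 2 - 1) with hD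
  have hD0 : 0 < D := by positivity
  have hstep : ∀ y, ∫⁻ x in Metric.closedBall y ρ, S x ^ p ≤ ENNReal.ofReal (2 ^ (p - 1)) *
      (ENNReal.ofReal D * (∫⁻ x in Metric.closedBall y (2 * ρ), ‖g x‖ₑ ^ p) +
        ENNReal.ofReal (C1 ^ p) * ∫⁻ x in Metric.closedBall y ρ, M x ^ p) := by
    intro y
    have hB : MeasurableSet (Metric.closedBall y ρ) := Metric.isClosed_closedBall.measurableSet
    have hA : MeasurableSet (Metric.closedBall y (2 * ρ)) := Metric.isClosed_closedBall.measurableSet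
    set Gy := (Metric.closedBall y (2 * ρ)).indicator g with hGy
    set Sy := fun x => ⨆ s ∈ Set.Icc (1:ℝ) 4, ‖brF φ δ s Gy x‖ₑ with hSy
    have h1 : ∫⁻ x in Metric.closedBall y ρ, S x ^ p ≤ ∫⁻ x in Metric.closedBall y ρ,
        ENNReal.ofReal (2 ^ (p - 1)) * (Sy x ^ p + ENNReal.ofReal (C1 ^ p) * M x ^ p) := by
      refine setLIntegral_mono' hB fun x hx => ?_
      have h2 := hloc δ hδ (by linarith) g hgm hg x y hx
      refine (ENNReal.rpow_le_rpow h2 hp0.le).trans ?_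
      refine (ENNReal.rpow_add_le_mul_rpow_add_rpow _ _ (by linarith)).trans (le_of_eq ?_)
      rw [ENNReal.mul_rpow_of_nonneg _ _ hp0.le, ENNReal.ofReal_rpow_of_pos hC1,
        ← ENNReal.ofReal_rpow_of_pos two_pos, ENNReal.ofReal_ofNat]
    refine h1.trans ?_
    rw [lintegral_const_mul' _ _ ENNReal.ofReal_ne_top,
      lintegral_add_right _ ((hMm.pow_const _).const_mul _), lintegral_const_mul' _ _ ENNReal.ofReal_ne_top]
    refine mul_le_mul_right (add_le_add_left ?_ _) _
    have h3 := hnear δ hδ hδ4 Gy (hg.indicator hA) (hg2.indicator hA) _ m hB hm0 (hvol y).le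
    refine h3.trans ?_
    have h4 : ∫⁻ x, ‖Gy x‖ₑ ^ 2 = ∫⁻ x in Metric.closedBall y (2 * ρ), ‖g x‖ₑ ^ 2 := by
      rw [← lintegral_indicator hA]
      refine lintegral_congr fun x => ?_
      by_cases hx : x ∈ Metric.closedBall y (2 * ρ)
      · rw [hGy, Set.indicator_of_mem hx, Set.indicator_of_mem hx]
      · rw [hGy, Set.indicator_of_notMem hx, Set.indicator_of_notMem hx]; simp
    rw [h4]
    refine (mul_le_mul_right (br_holder hp1 hg.1 _) _).trans (le_of_eq ?_)
    rw [hvol2, ENNReal.ofReal_rpow_of_pos (by positivity), hD,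
      ENNReal.ofReal_mul (q := (2 ^ n * m) ^ (p / 2 - 1)) (by positivity)]
    ring
  have hIntg := lintegral_mono (μ := volume) hstep
  rw [br_avg (hSm.pow_const _) hρ0.le, lintegral_const_mul' _ _ ENNReal.ofReal_ne_top,
    lintegral_add_right _ ((br_ball_meas (hMm.pow_const _) _).const_mul _),
    lintegral_const_mul' _ _ ENNReal.ofReal_ne_top, lintegral_const_mul' _ _ ENNReal.ofReal_ne_top,
    br_avg (hMm.pow_const _) hρ0.le, br_avg (hgm.enorm.pow_const _) (by positivity), hve,
    ← ENNReal.ofReal_mul (by positivity), ← ENNReal.ofReal_mul (by positivity), ← hm] at hIntg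
  have hMint := hM (fun z => ‖g z‖ₑ) hgm.enorm hg.2.ne
  have hfin : ENNReal.ofReal m * ∫⁻ x, S x ^ p ≤ ENNReal.ofReal m *
      (ENNReal.ofReal (2 ^ (p - 1) * (D * 2 ^ n + C1 ^ p * C3)) * ∫⁻ x, ‖g x‖ₑ ^ p) := by
    refine hIntg.trans ?_
    have e1 : (2 * ρ) ^ n * v = 2 ^ n * m := by rw [hm, mul_pow]; ring
    rw [e1]
    refine (mul_le_mul_right (add_le_add_right (mul_le_mul_right (mul_le_mul_right hMint _) _) _) _).trans
      (le_of_eq ?_)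
    clear_value D
    rw [ENNReal.ofReal_mul (p := 2 ^ n) (by positivity), ENNReal.ofReal_mul (p := 2 ^ (p - 1)) (by positivity),
      ENNReal.ofReal_add (by positivity) (by positivity), ENNReal.ofReal_mul (p := D) (by positivity),
      ENNReal.ofReal_mul (p := C1 ^ p) (by positivity)]
    ring
  have hfin2 := (ENNReal.mul_le_mul_iff_right (ENNReal.ofReal_pos.2 hm0).ne' ENNReal.ofReal_ne_top).1 hfin
  refine hfin2.trans (mul_le_mul_left (ENNReal.ofReal_le_ofReal ?_) _)
  have e2 : D * 2 ^ n = C2 * ((2:ℝ) ^ n) ^ (p / 2) * v ^ (p / 2 * θ) * δ ^ (-(p * β)) := by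
    have f1 : (2 ^ n * m) ^ (p / 2 - 1) * 2 ^ n = ((2:ℝ) ^ n) ^ (p / 2) * m ^ (p / 2 - 1) := by
      rw [Real.mul_rpow (by positivity) hm0.le, Real.rpow_sub_one (by positivity)]
      field_simp
    have f2 : m ^ (1 - (p / 2) * (1 - θ)) * m ^ (p / 2 - 1) = m ^ (p / 2 * θ) := by
      rw [← Real.rpow_add hm0]; congr 1; ring
    have f3 : m ^ (p / 2 * θ) = v ^ (p / 2 * θ) * δ ^ (-(1 + ε) * n * (p / 2 * θ)) := by
      rw [hm, hρ, ← Real.rpow_natCast, ← Real.rpow_mul hδ.le, Real.mul_rpow (by positivity) hv0.le,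
        ← Real.rpow_mul hδ.le, mul_comm]
    have f4 : δ ^ (p / 2) * δ ^ (-(1 + ε) * n * (p / 2 * θ)) = δ ^ (-(p * β)) := by
      rw [← Real.rpow_add hδ]; congr 1
      rw [hθ, hεd, hβ0]; field_simp; ring
    calc D * 2 ^ n = C2 * δ ^ (p / 2) * m ^ (1 - (p / 2) * (1 - θ)) * ((2 ^ n * m) ^ (p / 2 - 1) * 2 ^ n) := by
          rw [hD]; ring
      _ = C2 * ((2:ℝ) ^ n) ^ (p / 2) * δ ^ (p / 2) * (m ^ (1 - (p / 2) * (1 - θ)) * m ^ (p / 2 - 1)) := by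
          rw [f1]; ring
      _ = C2 * ((2:ℝ) ^ n) ^ (p / 2) * v ^ (p / 2 * θ) * (δ ^ (p / 2) * δ ^ (-(1 + ε) * n * (p / 2 * θ))) := by
          rw [f2, f3]; ring
      _ = _ := by rw [f4]
  have e3 : 1 ≤ δ ^ (-(p * β)) := by
    have : 0 < p * β := mul_pos hp0 (by linarith)
    exact Real.one_le_rpow_of_pos_of_le_one_of_nonpos hδ (by linarith) (by linarith)
  have e4 : C1 ^ p * C3 ≤ C1 ^ p * C3 * δ ^ (-(p * β)) := le_mul_of_one_le_right (by positivity) e3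
  rw [e2, mul_assoc (2 ^ (p - 1)), add_mul]
  gcongr

end L10b

section L11

variable {n : ℕ}

lemma br_fourier_dilate (u : EuclideanSpace ℝ (Fin n) → ℂ) {a : ℝ} (ha : 0 < a) (ξ : EuclideanSpace ℝ (Fin n)) :
    𝓕 (fun y => u (a⁻¹ • y)) ξ = (a ^ n : ℝ) • 𝓕 u (a • ξ) := by
  simp only [Real.fourier_eq']
  have h := Measure.integral_comp_inv_smul_of_nonneg (volume : Measure (EuclideanSpace ℝ (Fin n)))
    (fun z => Complex.exp (↑(-2 * Real.pi * ⟪z, a • ξ⟫) * I) • u z) ha.le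
  rw [finrank_euclideanSpace_fin] at h
  rw [← h]
  refine integral_congr_ae (Eventually.of_forall fun y => ?_)
  simp only [inner_smul_left, inner_smul_right]
  congr 5
  simp
  field_simp

lemma br_scale (m u : EuclideanSpace ℝ (Fin n) → ℂ) {a : ℝ} (ha : 0 < a) (x : EuclideanSpace ℝ (Fin n)) :
    𝓕⁻ (fun ξ => m ξ * 𝓕 (fun y => u (a⁻¹ • y)) ξ) (a • x) = 𝓕⁻ (fun ξ => m (a⁻¹ • ξ) * 𝓕 u ξ) x := by
  simp only [br_fourier_dilate u ha, Real.fourierInv_eq']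
  have h := Measure.integral_comp_smul_of_nonneg (volume : Measure (EuclideanSpace ℝ (Fin n)))
    (fun z => Complex.exp (↑(2 * Real.pi * ⟪z, x⟫) * I) • (m (a⁻¹ • z) * 𝓕 u z)) a (hR := ha.le)
  rw [finrank_euclideanSpace_fin, eq_inv_smul_iff₀ (by positivity), ← integral_smul] at h
  rw [← h]
  refine integral_congr_ae (Eventually.of_forall fun y => ?_)
  simp only [inner_smul_left, inner_smul_right, inv_smul_smul₀ ha.ne', RCLike.conj_to_real, smul_eq_mul, real_smul]
  ring

lemma br_mult2 {m u : EuclideanSpace ℝ (Fin n) → ℂ} (hm : Integrable m) {A : ℝ} (hA : ∀ ξ, ‖m ξ‖ ≤ A)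
    (hu : Integrable u) (hu2 : MemLp u 2) :
    ∫⁻ x, ‖𝓕⁻ (fun ξ => m ξ * 𝓕 u ξ) x‖ₑ ^ 2 = ∫⁻ ξ, ‖m ξ * 𝓕 u ξ‖ₑ ^ 2 := by
  have h1 : Integrable fun ξ => m ξ * 𝓕 u ξ := hm.mul_bdd (br_fourier_continuous hu).aestronglyMeasurable
      (Eventually.of_forall fun ξ => br_fourier_norm_le ξ)
  have h2 : MemLp (fun ξ => m ξ * 𝓕 u ξ) 2 := by
    refine (br_memLp_fourier hu hu2).of_le_mul (c := A) h1.1 (Eventually.of_forall fun ξ => ?_)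
    rw [norm_mul]
    exact mul_le_mul_of_nonneg_right (hA ξ) (norm_nonneg _)
  have hmp := Measure.measurePreserving_neg (volume : Measure (EuclideanSpace ℝ (Fin n)))
  rw [br_fourierInv_eq, br_plancherel h1.comp_neg (h2.comp_measurePreserving hmp)]
  exact lintegral_neg_eq_self (fun ξ => ‖m ξ * 𝓕 u ξ‖ₑ ^ 2)

noncomputable def brQ (Φ : ℝ → ℝ) (k : ℤ) (u : EuclideanSpace ℝ (Fin n) → ℂ) (x : EuclideanSpace ℝ (Fin n)) : ℂ :=
  𝓕⁻ (fun ξ => ((Φ ((8 - ‖((2:ℝ) ^ k)⁻¹ • ξ‖ ^ 2) / 1) : ℝ) : ℂ) * 𝓕 u ξ) x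

lemma brQ_eq (Φ : ℝ → ℝ) (k : ℤ) (u : EuclideanSpace ℝ (Fin n) → ℂ) (x : EuclideanSpace ℝ (Fin n)) :
    brQ Φ k u x = brF Φ 1 8 (fun y => u (((2:ℝ) ^ k)⁻¹ • y)) ((2:ℝ) ^ k • x) := by
  unfold brF brQ
  rw [br_scale (fun ξ => ((Φ ((8 - ‖ξ‖ ^ 2) / 1) : ℝ) : ℂ)) u (by positivity : (0:ℝ) < 2 ^ k)]

lemma br_overlap {Φ : ℝ → ℝ} (hsupp : ∀ t, t ∉ Set.Icc (1 : ℝ) (15 / 2) → Φ t = 0) {A : ℝ}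
    (hA : ∀ t, |Φ t| ≤ A) (ξ : EuclideanSpace ℝ (Fin n)) :
    ∑' k : ℤ, ‖((Φ ((8 - ‖((2:ℝ) ^ k)⁻¹ • ξ‖ ^ 2) / 1) : ℝ) : ℂ)‖ₑ ^ 2 ≤ ENNReal.ofReal (3 * A ^ 2) := by
  have hA0 : 0 ≤ A := (abs_nonneg _).trans (hA 0)
  set T : ℤ → ℝ := fun k => Φ ((8 - ‖((2:ℝ) ^ k)⁻¹ • ξ‖ ^ 2) / 1) with hT
  have hne : ∀ k, T k ≠ 0 → 1 / 2 * (2 ^ k) ^ 2 ≤ ‖ξ‖ ^ 2 ∧ ‖ξ‖ ^ 2 ≤ 7 * ((2:ℝ) ^ k) ^ 2 := by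
    intro k hk
    have h1 : ((8 - ‖((2:ℝ) ^ k)⁻¹ • ξ‖ ^ 2) / 1) ∈ Set.Icc (1:ℝ) (15 / 2) := by
      by_contra h; exact hk (hsupp _ h)
    have h2 : ‖((2:ℝ) ^ k)⁻¹ • ξ‖ ^ 2 = ‖ξ‖ ^ 2 / ((2:ℝ) ^ k) ^ 2 := by
      rw [norm_smul, norm_inv, Real.norm_of_nonneg (by positivity)]; field_simp
    rw [h2, div_one] at h1
    have hpos : (0:ℝ) < ((2:ℝ) ^ k) ^ 2 := by positivity
    constructor
    · have := h1.2
      rw [← le_div_iff₀ hpos]; linarith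
    · have := h1.1
      rw [← div_le_iff₀ hpos]; linarith
  have hb : ∀ k, ‖((T k : ℝ) : ℂ)‖ₑ ^ 2 ≤ ENNReal.ofReal (A ^ 2) := by
    intro k
    rw [← ofReal_norm, Complex.norm_real, ENNReal.ofReal_pow hA0]
    gcongr
    exact hA _
  by_cases h0 : ∃ k0, T k0 ≠ 0
  · obtain ⟨k0, hk0⟩ := h0
    have key : ∀ k l, T k ≠ 0 → T l ≠ 0 → k ≤ l + 1 := by
      intro k l hk hl
      by_contra hcon
      have h1 : l + 2 ≤ k := by lia
      have h2 : (2:ℝ) ^ (l + 2) ≤ 2 ^ k := zpow_le_zpow_right₀ (by norm_num) h1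
      rw [zpow_add₀ (by norm_num)] at h2
      have hlp : (0:ℝ) < 2 ^ l := by positivity
      have h3 := (hne k hk).1
      have h4 := (hne l hl).2
      norm_num at h2
      nlinarith
    rw [tsum_eq_sum (s := Finset.Icc (k0 - 1) (k0 + 1))]
    · refine (Finset.sum_le_card_nsmul _ _ _ fun k _ => hb k).trans (le_of_eq ?_)
      rw [Int.card_Icc, nsmul_eq_mul, ENNReal.ofReal_mul (by norm_num)]
      have : (k0 + 1 + 1 - (k0 - 1)).toNat = 3 := by lia
      rw [this]; norm_num
    · intro k hk
      have : T k = 0 := by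
        by_contra h
        have e1 := key k k0 h hk0
        have e2 := key k0 k hk0 h
        exact hk (Finset.mem_Icc.2 ⟨by lia, by lia⟩)
      change ‖((T k : ℝ) : ℂ)‖ₑ ^ 2 = 0
      rw [this]; simp
  · push Not at h0
    have : ∀ k, ‖((T k : ℝ) : ℂ)‖ₑ ^ 2 = 0 := fun k => by rw [h0 k]; simp
    change ∑' k, ‖((T k : ℝ) : ℂ)‖ₑ ^ 2 ≤ _
    simp only [this, tsum_zero]
    exact zero_le

lemma br_Q2 {Φ : ℝ → ℝ} (hΦ : ContDiff ℝ (⊤ : ℕ∞) Φ) (hsupp : ∀ t, t ∉ Set.Icc (1 : ℝ) (15 / 2) → Φ t = 0) {A : ℝ}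
    (hA : ∀ t, |Φ t| ≤ A) {u : EuclideanSpace ℝ (Fin n) → ℂ} (hu : Integrable u) (hu2 : MemLp u 2) :
    ∑' k : ℤ, ∫⁻ x, ‖brQ Φ k u x‖ₑ ^ 2 ≤ ENNReal.ofReal (3 * A ^ 2) * ∫⁻ x, ‖u x‖ₑ ^ 2 := by
  have hs8 : ∀ t, t ∉ Set.Icc (0 : ℝ) 8 → Φ t = 0 := fun t ht => hsupp t fun h =>
    ht ⟨by linarith [h.1], by linarith [h.2]⟩
  have hIntg := br_symbol_integrable (n := n) hΦ hs8 (δ := 1) (s := 8) one_pos le_rfl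
  have hc := br_fourier_continuous hu
  have hΦc := hΦ.continuous
  have h1 : ∀ k : ℤ, ∫⁻ x, ‖brQ Φ k u x‖ₑ ^ 2 =
      ∫⁻ ξ, ‖((Φ ((8 - ‖((2:ℝ) ^ k)⁻¹ • ξ‖ ^ 2) / 1) : ℝ) : ℂ)‖ₑ ^ 2 * ‖𝓕 u ξ‖ₑ ^ 2 := by
    intro k
    have h2 := br_mult2 (m := fun ξ => ((Φ ((8 - ‖((2:ℝ) ^ k)⁻¹ • ξ‖ ^ 2) / 1) : ℝ) : ℂ))
      (hIntg.comp_smul (R := ((2:ℝ) ^ k)⁻¹) (by positivity)) (A := A)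
      (fun ξ => by rw [Complex.norm_real]; exact hA _) hu hu2
    unfold brQ
    rw [h2]
    refine lintegral_congr fun ξ => ?_
    rw [enorm_mul, mul_pow]
  simp_rw [h1]
  rw [← lintegral_tsum fun k => ?_]
  · rw [← br_plancherel hu hu2, ← lintegral_const_mul' _ _ ENNReal.ofReal_ne_top]
    refine lintegral_mono fun ξ => ?_
    rw [ENNReal.tsum_mul_right]
    exact mul_le_mul_left (br_overlap hsupp hA ξ) _
  · have hcc : Continuous fun ξ : EuclideanSpace ℝ (Fin n) =>
        ((Φ ((8 - ‖((2:ℝ) ^ k)⁻¹ • ξ‖ ^ 2) / 1) : ℝ) : ℂ) := by fun_prop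
    exact ((hcc.measurable.enorm.pow_const 2).mul (hc.measurable.enorm.pow_const 2)).aemeasurable

lemma brM_const (c : ℝ≥0∞) (x : EuclideanSpace ℝ (Fin n)) :
    brM (fun _ => c) x ≤ c * volume (Metric.ball (0 : EuclideanSpace ℝ (Fin n)) 1) := by
  unfold brM
  refine iSup_le fun i => ?_
  rw [setLIntegral_const, br_vol_ball _ (by positivity), mul_left_comm, ← mul_assoc (ENNReal.ofReal _),
    ← ENNReal.ofReal_mul (by positivity), inv_mul_cancel₀ (by positivity), ENNReal.ofReal_one, one_mul]

lemma br_Psup (n : ℕ) {Φ : ℝ → ℝ} (hΦ : ContDiff ℝ (⊤ : ℕ∞) Φ) (hs8 : ∀ t, t ∉ Set.Icc (0 : ℝ) 8 → Φ t = 0) :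
    ∃ C : ℝ, 0 < C ∧ ∀ (u : EuclideanSpace ℝ (Fin n) → ℂ) (t : ℝ), Integrable u → 0 ≤ t → (∀ x, ‖u x‖ₑ ≤ ENNReal.ofReal t) →
      ∀ x, ‖brF Φ 1 8 u x‖ₑ ≤ ENNReal.ofReal (C * t) := by
  obtain ⟨C, hC, h⟩ := br_kernel_maj (n := n) hΦ hs8
  set v := (volume (Metric.ball (0 : EuclideanSpace ℝ (Fin n)) 1)).toReal with hv
  have hvfin : volume (Metric.ball (0 : EuclideanSpace ℝ (Fin n)) 1) ≠ ⊤ := measure_ball_lt_top.ne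
  have hv0 : 0 < v := ENNReal.toReal_pos (Metric.measure_ball_pos _ _ one_pos).ne' hvfin
  have hve : volume (Metric.ball (0 : EuclideanSpace ℝ (Fin n)) 1) = ENNReal.ofReal v :=
    (ENNReal.ofReal_toReal hvfin).symm
  refine ⟨C * (2 ^ (n + 2) * v), by positivity, fun u t hu ht hut x => ?_⟩
  refine (brF_conv_le hΦ hs8 one_pos le_rfl hu x).trans ?_
  have hmaj := br_maj_le_M (u := fun _ : EuclideanSpace ℝ (Fin n) => ENNReal.ofReal t) measurable_const 0 x
  calc _ ≤ ∫⁻ y, ENNReal.ofReal C * (ENNReal.ofReal t *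
        ENNReal.ofReal (((2:ℝ) ^ (0:ℤ)) ^ n * ((1 + (2:ℝ) ^ (0:ℤ) * ‖x - y‖) ^ (n + 1))⁻¹)) := by
        refine lintegral_mono fun y => ?_
        have h1 := ENNReal.ofReal_le_ofReal (h 8 le_rfl (x - y))
        rw [ofReal_norm, ENNReal.ofReal_mul hC.le] at h1
        refine (mul_le_mul' (hut y) h1).trans (le_of_eq ?_)
        simp only [zpow_zero, one_pow, one_mul]; ring
    _ ≤ ENNReal.ofReal C * (ENNReal.ofReal (2 ^ (n + 2)) * (ENNReal.ofReal t * ENNReal.ofReal v)) := by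
        rw [lintegral_const_mul' _ _ ENNReal.ofReal_ne_top]
        refine mul_le_mul_right (hmaj.trans (mul_le_mul_right ?_ _)) _
        rw [← hve]; exact brM_const _ x
    _ = _ := by
        rw [← ENNReal.ofReal_mul ht, ← ENNReal.ofReal_mul (by positivity), ← ENNReal.ofReal_mul (by positivity)]
        congr 1; ring

lemma brQ_continuous {Φ : ℝ → ℝ} (hΦ : ContDiff ℝ (⊤ : ℕ∞) Φ) (hs8 : ∀ t, t ∉ Set.Icc (0 : ℝ) 8 → Φ t = 0)
    (k : ℤ) {u : EuclideanSpace ℝ (Fin n) → ℂ} (hu : Integrable u) : Continuous (brQ Φ k u) := by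
  have hIntg := br_symbol_integrable (n := n) hΦ hs8 (δ := 1) (s := 8) one_pos le_rfl
  have h1 : Integrable fun ξ => ((Φ ((8 - ‖((2:ℝ) ^ k)⁻¹ • ξ‖ ^ 2) / 1) : ℝ) : ℂ) * 𝓕 u ξ :=
    (hIntg.comp_smul (R := ((2:ℝ) ^ k)⁻¹) (by positivity)).mul_bdd (br_fourier_continuous hu).aestronglyMeasurable
      (Eventually.of_forall fun ξ => br_fourier_norm_le ξ)
  have h2 := br_fourier_continuous h1.comp_neg
  have h3 : brQ Φ k u = 𝓕⁻ (fun ξ => ((Φ ((8 - ‖((2:ℝ) ^ k)⁻¹ • ξ‖ ^ 2) / 1) : ℝ) : ℂ) * 𝓕 u ξ) := rfl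
  rw [h3, br_fourierInv_eq]
  exact h2

end L11

section L11b

variable {n : ℕ}

lemma br_Qp (n : ℕ) {p : ℝ} (hp : 2 ≤ p) {Φ : ℝ → ℝ} (hΦ : ContDiff ℝ (⊤ : ℕ∞) Φ)
    (hsupp : ∀ t, t ∉ Set.Icc (1 : ℝ) (15 / 2) → Φ t = 0) {A : ℝ} (hA0 : 0 < A) (hA : ∀ t, |Φ t| ≤ A) :
    ∃ C : ℝ, 0 < C ∧ ∀ u : EuclideanSpace ℝ (Fin n) → ℂ, Measurable u → Integrable u → MemLp u 2 →
      ∑' k : ℤ, ∫⁻ x, ‖brQ Φ k u x‖ₑ ^ p ≤ ENNReal.ofReal C * ∫⁻ x, ‖u x‖ₑ ^ p := by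
  have hs8 : ∀ t, t ∉ Set.Icc (0 : ℝ) 8 → Φ t = 0 := fun t ht => hsupp t fun h =>
    ht ⟨by linarith [h.1], by linarith [h.2]⟩
  rcases eq_or_lt_of_le hp with rfl | hp'
  · refine ⟨3 * A ^ 2, by positivity, fun u hum hu hu2 => ?_⟩
    have := br_Q2 hΦ hsupp hA hu hu2
    simpa only [ENNReal.rpow_ofNat] using this
  obtain ⟨C0, hC0, hsup⟩ := br_Psup n hΦ hs8
  set c := 1 / (2 * C0) with hc
  have hc0 : 0 < c := by positivity
  set K := 4 * (3 * A ^ 2) with hK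
  refine ⟨K * p / (p - 2) * c ^ (-(p - 2)), by
    have : 0 < p - 2 := by linarith
    positivity, fun u hum hu hu2 => ?_⟩
  set F : ℤ × EuclideanSpace ℝ (Fin n) → ℝ≥0∞ := fun z => ‖brQ Φ z.1 u z.2‖ₑ with hF
  have hFm : Measurable F := measurable_from_prod_countable_right fun k =>
    (brQ_continuous hΦ hs8 k hu).measurable.enorm
  have hprod : ∀ G : ℤ × EuclideanSpace ℝ (Fin n) → ℝ≥0∞, Measurable G →
      ∫⁻ z, G z ∂((Measure.count : Measure ℤ).prod volume) = ∑' k : ℤ, ∫⁻ x, G (k, x) := by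
    intro G hG
    rw [lintegral_prod _ hG.aemeasurable, lintegral_count]
  have hmain := br_marcinkiewicz ((Measure.count : Measure ℤ).prod (volume : Measure (EuclideanSpace ℝ (Fin n))))
    (volume : Measure (EuclideanSpace ℝ (Fin n))) hFm (u := fun x => ‖u x‖ₑ) hum.enorm (r := 2) (q := p) (c := c)
    (K := K) two_pos hp' hc0 (by positivity) ?_
  · rw [hprod _ (hFm.pow_const p)] at hmain
    exact hmain
  intro t ht
  set E := {y | ENNReal.ofReal (c * t) < ‖u y‖ₑ} with hE
  have hEm : MeasurableSet E := measurableSet_lt measurable_const hum.enorm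
  set a := E.indicator u with ha
  set b := Eᶜ.indicator u with hb
  have hai : Integrable a := hu.indicator hEm
  have hbi : Integrable b := hu.indicator hEm.compl
  have hbb : ∀ x, ‖b x‖ₑ ≤ ENNReal.ofReal (c * t) := by
    intro x
    by_cases hx : x ∈ E
    · simp [hb, hx]
    · rw [hb, Set.indicator_of_mem (by exact hx)]
      exact not_lt.1 hx
  have hQ : ∀ z : ℤ × EuclideanSpace ℝ (Fin n), F z ≤ ‖brQ Φ z.1 a z.2‖ₑ + ENNReal.ofReal (t / 2) := by
    rintro ⟨k, x⟩
    have hk : ((2:ℝ) ^ k)⁻¹ ≠ 0 := by positivity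
    have h1 : (fun y => u (((2:ℝ) ^ k)⁻¹ • y)) = (fun y => a (((2:ℝ) ^ k)⁻¹ • y)) + fun y => b (((2:ℝ) ^ k)⁻¹ • y) := by
      ext y
      exact congrFun (Set.indicator_self_add_compl E u).symm _
    simp only [hF]
    rw [brQ_eq, brQ_eq, h1, brF_add hΦ hs8 one_pos le_rfl (hai.comp_smul hk) (hbi.comp_smul hk)]
    refine (enorm_add_le _ _).trans (add_le_add_right ?_ _)
    have h2 := hsup _ (c * t) (hbi.comp_smul hk) (by positivity) (fun y => hbb _) ((2:ℝ) ^ k • x)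
    refine h2.trans (le_of_eq ?_)
    congr 1; rw [hc]; field_simp
  set Fa : ℤ × EuclideanSpace ℝ (Fin n) → ℝ≥0∞ := fun z => ‖brQ Φ z.1 a z.2‖ₑ with hFa
  have hFam : Measurable Fa := measurable_from_prod_countable_right fun k =>
    (brQ_continuous hΦ hs8 k hai).measurable.enorm
  have hsub : {z | ENNReal.ofReal t < F z} ⊆ {z | ENNReal.ofReal ((t / 2) ^ 2) ≤ Fa z ^ 2} := by
    intro z hz
    have hz' : ENNReal.ofReal t < F z := hz
    have h1 := hz'.trans_le (hQ z)
    have h2 : ENNReal.ofReal t = ENNReal.ofReal (t / 2) + ENNReal.ofReal (t / 2) := by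
      rw [← ENNReal.ofReal_add (by positivity) (by positivity)]; congr 1; ring
    rw [h2] at h1
    have h3 := lt_of_add_lt_add_right h1
    change ENNReal.ofReal ((t / 2) ^ 2) ≤ Fa z ^ 2
    rw [ENNReal.ofReal_pow (by positivity)]
    gcongr
  have hcheb := mul_meas_ge_le_lintegral₀ (μ := (Measure.count : Measure ℤ).prod volume)
    (hFam.pow_const 2).aemeasurable (ENNReal.ofReal ((t / 2) ^ 2))
  rw [hprod _ (hFam.pow_const 2)] at hcheb
  have hQ2 := br_Q2 hΦ hsupp hA hai (hu2.indicator hEm)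
  have e1 : ∫⁻ x, ‖a x‖ₑ ^ 2 = ∫⁻ x in E, ‖u x‖ₑ ^ (2:ℝ) := by
    rw [← lintegral_indicator hEm]
    refine lintegral_congr fun x => ?_
    by_cases hx : x ∈ E
    · rw [ha, Set.indicator_of_mem hx, Set.indicator_of_mem hx, ENNReal.rpow_ofNat]
    · rw [ha, Set.indicator_of_notMem hx, Set.indicator_of_notMem hx]; simp
  rw [e1] at hQ2
  have e2 : ENNReal.ofReal (t ^ (2:ℝ)) = ENNReal.ofReal 4 * ENNReal.ofReal ((t / 2) ^ 2) := by
    rw [← ENNReal.ofReal_mul (by norm_num)]; congr 1; rw [Real.rpow_ofNat]; ring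
  rw [e2, hK, ENNReal.ofReal_mul (by norm_num), mul_assoc, mul_assoc (ENNReal.ofReal 4)]
  refine mul_le_mul_right ?_ _
  exact (mul_le_mul_right (measure_mono hsub) _).trans (hcheb.trans hQ2)

end L11b

section L12

variable {n : ℕ}

noncomputable def brh (t : ℝ) : ℝ := Real.smoothTransition (t - 1)

lemma brh_smooth : ContDiff ℝ (⊤ : ℕ∞) brh := by
  unfold brh
  exact Real.smoothTransition.contDiff.comp (by fun_prop : ContDiff ℝ (⊤ : ℕ∞) fun t : ℝ => t - 1)

lemma brh_zero {t : ℝ} (ht : t ≤ 1) : brh t = 0 := Real.smoothTransition.zero_of_nonpos (by linarith)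

lemma brh_one {t : ℝ} (ht : 2 ≤ t) : brh t = 1 := Real.smoothTransition.one_of_one_le (by linarith)

lemma br_rpow_mul_smooth (α : ℝ) {χ : ℝ → ℝ} (hχ : ContDiff ℝ (⊤ : ℕ∞) χ) {c : ℝ} (hc : 0 < c)
    (h : ∀ t ≤ c, χ t = 0) : ContDiff ℝ (⊤ : ℕ∞) fun t => t ^ α * χ t := by
  rw [contDiff_iff_contDiffAt]
  intro t
  by_cases ht : t < c
  · have : (fun t => t ^ α * χ t) =ᶠ[𝓝 t] fun _ => 0 := by
      filter_upwards [eventually_lt_nhds ht] with y hy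
      rw [h y hy.le, mul_zero]
    exact contDiffAt_const.congr_of_eventuallyEq this
  · have ht0 : t ≠ 0 := by
      have : c ≤ t := not_lt.1 ht
      linarith
    exact (Real.contDiffAt_rpow_const_of_ne ht0).mul hχ.contDiffAt

noncomputable def brphi (α t : ℝ) : ℝ := t ^ α * (brh (2 * t) - brh t)

noncomputable def breta (α t : ℝ) : ℝ := t ^ α * (brh (8 * t) * (1 - brh (t / 4)))

noncomputable def brPhi (t : ℝ) : ℝ := brh t * (1 - brh (4 * t - 28))

lemma brphi_smooth (α : ℝ) : ContDiff ℝ (⊤ : ℕ∞) (brphi α) := by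
  refine br_rpow_mul_smooth α (c := 1 / 2) (χ := fun t => brh (2 * t) - brh t) ?_ (by norm_num) fun t ht => ?_
  · exact (brh_smooth.comp (by fun_prop : ContDiff ℝ (⊤ : ℕ∞) fun t : ℝ => 2 * t)).sub brh_smooth
  · rw [brh_zero (by linarith), brh_zero (by linarith), sub_zero]

lemma brphi_supp (α : ℝ) : ∀ t, t ∉ Set.Icc (1 / 2 : ℝ) 2 → brphi α t = 0 := by
  intro t ht
  unfold brphi
  rw [Set.mem_Icc, not_and_or] at ht
  rcases ht with ht | ht
  · rw [brh_zero (by linarith), brh_zero (by linarith), sub_zero, mul_zero]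
  · rw [brh_one (by linarith), brh_one (by linarith), sub_self, mul_zero]

lemma breta_smooth (α : ℝ) : ContDiff ℝ (⊤ : ℕ∞) (breta α) := by
  refine br_rpow_mul_smooth α (c := 1 / 8) (χ := fun t => brh (8 * t) * (1 - brh (t / 4))) ?_ (by norm_num) fun t ht => ?_
  · exact (brh_smooth.comp (by fun_prop : ContDiff ℝ (⊤ : ℕ∞) fun t : ℝ => 8 * t)).mul
      (contDiff_const.sub (brh_smooth.comp (by fun_prop : ContDiff ℝ (⊤ : ℕ∞) fun t : ℝ => t / 4)))
  · rw [brh_zero (by linarith), zero_mul]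

lemma breta_supp (α : ℝ) : ∀ t, t ∉ Set.Icc (0 : ℝ) 8 → breta α t = 0 := by
  intro t ht
  unfold breta
  rw [Set.mem_Icc, not_and_or] at ht
  rcases ht with ht | ht
  · rw [brh_zero (by linarith), zero_mul, mul_zero]
  · rw [brh_one (t := t / 4) (by linarith), sub_self, mul_zero, mul_zero]

lemma brPhi_smooth : ContDiff ℝ (⊤ : ℕ∞) brPhi :=
  brh_smooth.mul (contDiff_const.sub (brh_smooth.comp (by fun_prop : ContDiff ℝ (⊤ : ℕ∞) fun t : ℝ => 4 * t - 28)))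

lemma brPhi_supp : ∀ t, t ∉ Set.Icc (1 : ℝ) (15 / 2) → brPhi t = 0 := by
  intro t ht
  unfold brPhi
  rw [Set.mem_Icc, not_and_or] at ht
  rcases ht with ht | ht
  · rw [brh_zero (by linarith), zero_mul]
  · rw [brh_one (t := 4 * t - 28) (by linarith), sub_self, mul_zero]

lemma brPhi_supp8 : ∀ t, t ∉ Set.Icc (0 : ℝ) 8 → brPhi t = 0 := fun t ht => brPhi_supp t fun h =>
    ht ⟨by linarith [h.1], by linarith [h.2]⟩

lemma brPhi_one {t : ℝ} (h1 : 4 ≤ t) (h2 : t ≤ 29 / 4) : brPhi t = 1 := by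
  unfold brPhi
  rw [brh_one (by linarith), brh_zero (t := 4 * t - 28) (by linarith)]; norm_num

lemma br_abs_h (t : ℝ) : 0 ≤ brh t ∧ brh t ≤ 1 :=
  ⟨Real.smoothTransition.nonneg _, Real.smoothTransition.le_one _⟩

lemma brPhi_bdd (t : ℝ) : |brPhi t| ≤ 1 := by
  unfold brPhi
  have h1 := br_abs_h t
  have h2 := br_abs_h (4 * t - 28)
  rw [abs_of_nonneg (mul_nonneg h1.1 (by linarith))]
  exact mul_le_one₀ h1.2 (by linarith) (by linarith)

/-- The dyadic scale `2^{-(j+3)}`. -/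
noncomputable def brd (j : ℕ) : ℝ := (1 / 2) ^ (j + 3)

lemma brd_pos (j : ℕ) : 0 < brd j := by unfold brd; positivity

lemma brd_le (j : ℕ) : brd j ≤ 1 / 8 := by
  unfold brd
  calc (1 / 2 : ℝ) ^ (j + 3) ≤ (1 / 2) ^ 3 := pow_le_pow_of_le_one (by norm_num) (by norm_num) (by lia)
    _ = _ := by norm_num

lemma brd_rpow_summable {γ : ℝ} (hγ : 0 < γ) : Summable fun j => brd j ^ γ := by
  have h : ∀ j, brd j ^ γ = ((1 / 2 : ℝ) ^ γ) ^ 3 * ((1 / 2 : ℝ) ^ γ) ^ j := by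
    intro j
    unfold brd
    rw [← pow_add, ← Real.rpow_natCast, ← Real.rpow_natCast, ← Real.rpow_mul (by norm_num),
      ← Real.rpow_mul (by norm_num)]
    congr 1; push_cast; ring
  simp_rw [h]
  exact (summable_geometric_of_lt_one (by positivity)
    (Real.rpow_lt_one (by norm_num) (by norm_num) hγ)).mul_left _

lemma br_decomp_hasSum {α : ℝ} (hα : 0 < α) {v : ℝ} (hv : v ≤ 4) :
    HasSum (fun j : ℕ => brd j ^ α * brphi α (v / brd j)) ((max v 0) ^ α - breta α (v / 1)) := by
  rcases le_or_gt v 0 with hv0 | hv0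
  · have h1 : ∀ j : ℕ, brd j ^ α * brphi α (v / brd j) = 0 := by
      intro j
      rw [brphi_supp, mul_zero]
      intro h
      have := div_nonpos_of_nonpos_of_nonneg hv0 (brd_pos j).le
      linarith [h.1]
    have h2 : breta α (v / 1) = 0 := by
      unfold breta
      rw [brh_zero (by linarith), zero_mul, mul_zero]
    rw [max_eq_right hv0, Real.zero_rpow hα.ne', h2, sub_zero]
    simp only [h1]
    exact hasSum_zero
  · have hterm : ∀ j : ℕ, brd j ^ α * brphi α (v / brd j) =
        v ^ α * (brh (v / brd (j + 1)) - brh (v / brd j)) := by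
      intro j
      have hd := brd_pos j
      unfold brphi
      have e1 : 2 * (v / brd j) = v / brd (j + 1) := by unfold brd; field_simp; ring
      rw [e1, ← mul_assoc, ← Real.mul_rpow hd.le (by positivity), mul_div_cancel₀ _ hd.ne']
    obtain ⟨N, hN⟩ := exists_nat_gt (2 / v)
    have hbig : ∀ j ≥ N, brh (v / brd j) = 1 := by
      intro j hj
      apply brh_one
      rw [le_div_iff₀ (brd_pos j)]
      have h1 : brd j * N ≤ 1 := by
        unfold brd
        rw [one_div, inv_pow, inv_mul_le_iff₀ (by positivity), mul_one]
        have : (N:ℝ) ≤ j := by exact_mod_cast hj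
        have h2 : (j:ℝ) < 2 ^ j := by exact_mod_cast Nat.lt_two_pow_self
        have h3 : (2:ℝ) ^ j ≤ 2 ^ (j + 3) := pow_le_pow_right₀ (by norm_num) (by lia)
        linarith
      rw [div_lt_iff₀ hv0] at hN
      have hd := brd_pos j
      nlinarith
    have hsum : HasSum (fun j : ℕ => v ^ α * (brh (v / brd (j + 1)) - brh (v / brd j)))
        (∑ j ∈ Finset.range N, v ^ α * (brh (v / brd (j + 1)) - brh (v / brd j))) := by
      apply hasSum_sum_of_ne_finset_zero
      intro j hj
      have hj' : N ≤ j := by simpa using hj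
      rw [hbig j hj', hbig (j + 1) (by lia), sub_self, mul_zero]
    simp only [hterm]
    convert hsum using 1
    rw [← Finset.mul_sum, Finset.sum_range_sub (fun j => brh (v / brd j)), hbig N le_rfl, max_eq_left hv0.le, div_one]
    unfold breta
    have e2 : v / brd 0 = 8 * v := by unfold brd; norm_num; ring
    rw [e2, brh_zero (t := v / 4) (by linarith)]
    ring

lemma br_decomp {α : ℝ} (hα : 0 < α) {s : ℝ} (hs : s ≤ 4) {u : EuclideanSpace ℝ (Fin n) → ℂ}
    (hu : Integrable (𝓕 u)) (x : EuclideanSpace ℝ (Fin n)) :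
    ‖𝓕⁻ (fun ξ => (((max (s - ‖ξ‖ ^ 2) 0) ^ α : ℝ) : ℂ) * 𝓕 u ξ) x‖ₑ ≤
      ‖brF (breta α) 1 s u x‖ₑ + ∑' j : ℕ, ENNReal.ofReal (brd j ^ α) * ‖brF (brphi α) (brd j) s u x‖ₑ := by
  obtain ⟨A, hA0, hA⟩ := br_bdd_of_supp (brphi_smooth α).continuous (brphi_supp α)
  have hφc := (brphi_smooth α).continuous
  have hηc := (breta_smooth α).continuous
  set e : EuclideanSpace ℝ (Fin n) → ℂ := fun ξ => Complex.exp (↑(2 * Real.pi * ⟪ξ, x⟫) * I) with he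
  have hec : Continuous e := by rw [he]; fun_prop
  have hen : ∀ ξ, ‖e ξ‖ = 1 := fun ξ => Complex.norm_exp_ofReal_mul_I _
  set w : EuclideanSpace ℝ (Fin n) → ℂ := fun ξ => e ξ * 𝓕 u ξ with hw
  have hwi : Integrable w := hu.bdd_mul hec.aestronglyMeasurable (Eventually.of_forall fun ξ => (hen ξ).le)
  set Fj : ℕ → EuclideanSpace ℝ (Fin n) → ℂ := fun j ξ =>
    ((brd j ^ α * brphi α ((s - ‖ξ‖ ^ 2) / brd j) : ℝ) : ℂ) * w ξ with hFj
  have hb : ∀ (j : ℕ) (ξ : EuclideanSpace ℝ (Fin n)), ‖((brd j ^ α * brphi α ((s - ‖ξ‖ ^ 2) / brd j) : ℝ) : ℂ)‖ ≤ brd j ^ α * A := by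
    intro j ξ
    have := brd_pos j
    rw [Complex.norm_real, Real.norm_eq_abs, abs_mul, abs_of_nonneg (by positivity)]
    exact mul_le_mul_of_nonneg_left (hA _) (by positivity)
  have hFi : ∀ j, Integrable (Fj j) := fun j => by
    have hc : Continuous fun ξ : EuclideanSpace ℝ (Fin n) =>
      ((brd j ^ α * brphi α ((s - ‖ξ‖ ^ 2) / brd j) : ℝ) : ℂ) := by fun_prop
    exact hwi.bdd_mul hc.aestronglyMeasurable (Eventually.of_forall fun ξ => hb j ξ)
  have hFs : Summable fun j => ∫ ξ, ‖Fj j ξ‖ := by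
    refine Summable.of_nonneg_of_le (fun j => integral_nonneg fun ξ => norm_nonneg (Fj j ξ)) (fun j => ?_)
      (((brd_rpow_summable hα).mul_right A).mul_right (∫ ξ, ‖w ξ‖))
    rw [← integral_const_mul]
    refine integral_mono (hFi j).norm (hwi.norm.const_mul _) fun ξ => ?_
    simp only [hFj, norm_mul]
    exact mul_le_mul_of_nonneg_right (by simpa using hb j ξ) (norm_nonneg _)
  have hS := hasSum_integral_of_summable_integral_norm hFi hFs
  have hts : ∀ ξ, ∑' j, Fj j ξ = (((max (s - ‖ξ‖ ^ 2) 0) ^ α - breta α ((s - ‖ξ‖ ^ 2) / 1) : ℝ) : ℂ) * w ξ := by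
    intro ξ
    have h1 := br_decomp_hasSum hα (v := s - ‖ξ‖ ^ 2) (by nlinarith [sq_nonneg ‖ξ‖])
    have h2 := (Complex.hasSum_ofReal.2 h1).mul_right (w ξ)
    exact h2.tsum_eq
  simp only [hts] at hS
  have hηi : Integrable fun ξ => ((breta α ((s - ‖ξ‖ ^ 2) / 1) : ℝ) : ℂ) * w ξ := by
    obtain ⟨B, hB⟩ := isCompact_Icc.exists_bound_of_continuousOn (hηc.continuousOn (s := Set.Icc (0 : ℝ) 8))
    have hc : Continuous fun ξ : EuclideanSpace ℝ (Fin n) => ((breta α ((s - ‖ξ‖ ^ 2) / 1) : ℝ) : ℂ) := by fun_prop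
    refine hwi.bdd_mul (c := max B 0) hc.aestronglyMeasurable (Eventually.of_forall fun ξ => ?_)
    rw [Complex.norm_real]
    by_cases h : (s - ‖ξ‖ ^ 2) / 1 ∈ Set.Icc (0:ℝ) 8
    · exact (hB _ h).trans (le_max_left _ _)
    · rw [breta_supp α _ h]; simp
  have hri : Integrable fun ξ =>
      (((max (s - ‖ξ‖ ^ 2) 0) ^ α - breta α ((s - ‖ξ‖ ^ 2) / 1) : ℝ) : ℂ) * w ξ := by
    have hc : Continuous fun ξ : EuclideanSpace ℝ (Fin n) => (((max (s - ‖ξ‖ ^ 2) 0) ^ α : ℝ) : ℂ) := by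
      refine Complex.continuous_ofReal.comp (Continuous.rpow_const (by fun_prop) fun ξ => Or.inr hα.le)
    have h1 : Integrable fun ξ => (((max (s - ‖ξ‖ ^ 2) 0) ^ α : ℝ) : ℂ) * w ξ := by
      refine hwi.bdd_mul (c := 4 ^ α) hc.aestronglyMeasurable (Eventually.of_forall fun ξ => ?_)
      rw [Complex.norm_real, Real.norm_of_nonneg (by positivity)]
      exact Real.rpow_le_rpow (le_max_right _ _) (max_le (by nlinarith [sq_nonneg ‖ξ‖]) (by norm_num)) hα.le
    refine (h1.sub hηi).congr (Eventually.of_forall fun ξ => ?_)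
    simp only [Pi.sub_apply]; push_cast; ring
  have hsplit : 𝓕⁻ (fun ξ => (((max (s - ‖ξ‖ ^ 2) 0) ^ α : ℝ) : ℂ) * 𝓕 u ξ) x =
      brF (breta α) 1 s u x + ∑' j, ∫ ξ, Fj j ξ := by
    rw [hS.tsum_eq]
    unfold brF
    simp only [Real.fourierInv_eq']
    rw [← integral_add (by
      refine hηi.congr (Eventually.of_forall fun ξ => ?_)
      simp only [hw, he, smul_eq_mul]; ring) hri]
    refine integral_congr_ae (Eventually.of_forall fun ξ => ?_)
    simp only [hw, he, smul_eq_mul]; push_cast; ring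
  rw [hsplit]
  refine (enorm_add_le _ _).trans (add_le_add_right ?_ _)
  refine (enorm_tsum_le_tsum_enorm).trans (ENNReal.tsum_le_tsum fun j => le_of_eq ?_)
  have hj : ∫ ξ, Fj j ξ = ((brd j ^ α : ℝ) : ℂ) * brF (brphi α) (brd j) s u x := by
    unfold brF
    simp only [Real.fourierInv_eq']
    rw [← integral_const_mul]
    refine integral_congr_ae (Eventually.of_forall fun ξ => ?_)
    simp only [hFj, hw, he, smul_eq_mul]; push_cast; ring
  have hd := brd_pos j
  rw [hj, enorm_mul, ← ofReal_norm, Complex.norm_real, Real.norm_of_nonneg (by positivity)]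

end L12

section L12b

variable {n : ℕ}

lemma br_lint_scale {H : EuclideanSpace ℝ (Fin n) → ℝ≥0∞} (hH : Measurable H) {a : ℝ} (ha : 0 < a) :
    ∫⁻ x, H (a • x) = ENNReal.ofReal ((a ^ n)⁻¹) * ∫⁻ x, H x := by
  have h := lintegral_map (μ := (volume : Measure (EuclideanSpace ℝ (Fin n)))) hH (measurable_const_smul a)
  rw [← h, Measure.map_addHaar_smul volume ha.ne', lintegral_smul_measure, finrank_euclideanSpace_fin,
    abs_of_pos (by positivity), smul_eq_mul]

lemma br_dil (f : SchwartzMap (EuclideanSpace ℝ (Fin n)) ℂ) (k : ℤ) :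
    ∃ g : SchwartzMap (EuclideanSpace ℝ (Fin n)) ℂ, ⇑g = fun y => f (((2:ℝ) ^ k)⁻¹ • y) :=
  ⟨SchwartzMap.compCLMOfContinuousLinearEquiv ℂ
    (ContinuousLinearEquiv.smulLeft (Units.mk0 (((2:ℝ) ^ k)⁻¹) (by positivity))) f, by
      ext y; rfl⟩

lemma br_P_schwartz (g : SchwartzMap (EuclideanSpace ℝ (Fin n)) ℂ) :
    ∃ w : SchwartzMap (EuclideanSpace ℝ (Fin n)) ℂ, ⇑w = brF brPhi 1 8 g ∧
      𝓕 (⇑w) = fun ξ => ((brPhi ((8 - ‖ξ‖ ^ 2) / 1) : ℝ) : ℂ) * 𝓕 (⇑g) ξ := by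
  have hsm := br_symbol_smooth (n := n) brPhi_smooth 1 8
  have hcs := br_symbol_compact (n := n) brPhi_supp8 (δ := 1) (s := 8) one_pos le_rfl
  have hg : ContDiff ℝ (⊤ : ℕ∞) (𝓕 (⇑g)) := by
    rw [← SchwartzMap.fourier_coe]; exact (𝓕 g).smooth ⊤
  have h1 : HasCompactSupport fun ξ => ((brPhi ((8 - ‖ξ‖ ^ 2) / 1) : ℝ) : ℂ) * 𝓕 (⇑g) ξ := hcs.mul_right
  have h2 : ContDiff ℝ (⊤ : ℕ∞) fun ξ => ((brPhi ((8 - ‖ξ‖ ^ 2) / 1) : ℝ) : ℂ) * 𝓕 (⇑g) ξ := hsm.mul hg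
  refine ⟨𝓕⁻ (h1.toSchwartzMap h2), ?_, ?_⟩
  · rw [SchwartzMap.fourierInv_coe]; rfl
  · rw [← SchwartzMap.fourier_coe, FourierTransform.fourier_fourierInv_eq]; rfl

lemma br_PP (α : ℝ) {δ s : ℝ} (hδ : 0 < δ) (hδ8 : δ ≤ 1 / 8) (hs : s ∈ Set.Icc (1:ℝ) 4)
    {g w : EuclideanSpace ℝ (Fin n) → ℂ} (hw : 𝓕 w = fun ξ => ((brPhi ((8 - ‖ξ‖ ^ 2) / 1) : ℝ) : ℂ) * 𝓕 g ξ)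
    (x : EuclideanSpace ℝ (Fin n)) : brF (brphi α) δ s w x = brF (brphi α) δ s g x := by
  unfold brF
  simp only [Real.fourierInv_eq']
  refine integral_congr_ae (Eventually.of_forall fun ξ => ?_)
  simp only []
  congr 1
  rw [hw]
  by_cases h : (s - ‖ξ‖ ^ 2) / δ ∈ Set.Icc (1 / 2 : ℝ) 2
  · have h1 := h.1
    have h2 := h.2
    rw [le_div_iff₀ hδ] at h1
    rw [div_le_iff₀ hδ] at h2
    simp only
    rw [brPhi_one (by linarith [hs.2]) (by linarith [hs.1])]
    simp
  · rw [brphi_supp α _ h]; simp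

lemma br_high (n : ℕ) (hn : 2 ≤ n) {p α β : ℝ} (hp1 : 2 ≤ p)
    (hp2 : p < 2 * ((n : ℝ) + 1) / ((n : ℝ) - 1)) (hβ : ((n : ℝ) - 1) / (2 * ((n : ℝ) + 1)) < β) :
    ∃ C : ℝ, 0 < C ∧ ∀ δ : ℝ, 0 < δ → δ ≤ 1 / 8 → ∀ f : SchwartzMap (EuclideanSpace ℝ (Fin n)) ℂ,
      ∑' k : ℤ, ∫⁻ x, (⨆ s ∈ Set.Icc (1:ℝ) 4,
        ‖brF (brphi α) δ s (fun y => f (((2:ℝ) ^ k)⁻¹ • y)) ((2:ℝ) ^ k • x)‖ₑ) ^ p ≤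
          ENNReal.ofReal (C * δ ^ (-(p * β))) * ∫⁻ x, ‖f x‖ₑ ^ p := by
  obtain ⟨C1, hC1, hS⟩ := br_claimS n hn hp1 hp2 hβ (brphi_smooth α) (brphi_supp α)
  obtain ⟨C2, hC2, hQ⟩ := br_Qp n hp1 brPhi_smooth brPhi_supp one_pos brPhi_bdd
  refine ⟨C1 * C2, by positivity, fun δ hδ hδ8 f => ?_⟩
  have hk : ∀ k : ℤ, ∫⁻ x, (⨆ s ∈ Set.Icc (1:ℝ) 4,
        ‖brF (brphi α) δ s (fun y => f (((2:ℝ) ^ k)⁻¹ • y)) ((2:ℝ) ^ k • x)‖ₑ) ^ p ≤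
      ENNReal.ofReal (C1 * δ ^ (-(p * β))) * ∫⁻ x, ‖brQ brPhi k f x‖ₑ ^ p := by
    intro k
    have hk0 : (0:ℝ) < 2 ^ k := by positivity
    obtain ⟨g, hg⟩ := br_dil f k
    obtain ⟨w, hw1, hw2⟩ := br_P_schwartz g
    have hQe : ∀ x, brQ brPhi k f x = w ((2:ℝ) ^ k • x) := by
      intro x
      rw [brQ_eq, hw1, hg]
    rw [← hg]
    have e1 : ∀ x, (⨆ s ∈ Set.Icc (1:ℝ) 4, ‖brF (brphi α) δ s (⇑g) ((2:ℝ) ^ k • x)‖ₑ) =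
        (fun z => ⨆ s ∈ Set.Icc (1:ℝ) 4, ‖brF (brphi α) δ s (⇑w) z‖ₑ) ((2:ℝ) ^ k • x) := by
      intro x
      simp only
      refine iSup_congr fun s => iSup_congr fun hs => ?_
      rw [br_PP α hδ hδ8 hs hw2]
    simp_rw [e1, hQe]
    have hm := (brF_sup_measurable (brphi_smooth α).continuous (brphi_supp α) hδ w.integrable).pow_const p
    have s1 := br_lint_scale hm hk0
    have s2 := br_lint_scale (w.continuous.measurable.enorm.pow_const p) hk0
    rw [s1, s2, mul_left_comm]
    exact mul_le_mul_right (hS δ hδ (by linarith) w w.continuous.measurable w.integrable (w.memLp 2)) _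
  refine (ENNReal.tsum_le_tsum hk).trans ?_
  rw [ENNReal.tsum_mul_left]
  refine (mul_le_mul_right (hQ f f.continuous.measurable f.integrable (f.memLp 2)) _).trans (le_of_eq ?_)
  rw [← mul_assoc, ← ENNReal.ofReal_mul (by positivity)]
  congr 2; ring

lemma br_low (n : ℕ) (α : ℝ) : ∃ C : ℝ, 0 < C ∧ ∀ f : SchwartzMap (EuclideanSpace ℝ (Fin n)) ℂ,
    ∀ (k : ℤ) (s : ℝ), s ≤ 8 → ∀ x, ‖brF (breta α) 1 s (fun y => f (((2:ℝ) ^ k)⁻¹ • y)) ((2:ℝ) ^ k • x)‖ₑ ≤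
      ENNReal.ofReal C * brM (fun z => ‖f z‖ₑ) x := by
  obtain ⟨C, hC, h⟩ := br_kernel_maj (n := n) (breta_smooth α) (breta_supp α)
  refine ⟨C * 2 ^ (n + 2), by positivity, fun f k s hs x => ?_⟩
  have hk0 : (0:ℝ) < 2 ^ k := by positivity
  obtain ⟨g, hg⟩ := br_dil f k
  refine (brF_conv_le (breta_smooth α) (breta_supp α) one_pos hs (hg ▸ g.integrable) _).trans ?_
  have hfm := f.continuous.measurable
  have hmaj := br_maj_le_M (u := fun z => ‖f z‖ₑ) hfm.enorm k x
  rw [ENNReal.ofReal_mul hC.le, mul_assoc]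
  refine le_trans ?_ (mul_le_mul_right hmaj _)
  rw [← lintegral_const_mul' _ _ ENNReal.ofReal_ne_top]
  set H : EuclideanSpace ℝ (Fin n) → ℝ≥0∞ := fun z => ENNReal.ofReal C * (‖f (((2:ℝ) ^ k)⁻¹ • z)‖ₑ *
    ENNReal.ofReal (((1 + ‖(2:ℝ) ^ k • x - z‖) ^ (n + 1))⁻¹)) with hH
  have hHm : Measurable H := by
    have : Continuous fun z : EuclideanSpace ℝ (Fin n) => ((1 + ‖(2:ℝ) ^ k • x - z‖) ^ (n + 1))⁻¹ :=
      Continuous.inv₀ (by fun_prop) fun z => by positivity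
    exact ((hfm.comp (measurable_const_smul _)).enorm.mul this.measurable.ennreal_ofReal).const_mul _
  calc _ ≤ ∫⁻ z, H z := by
        refine lintegral_mono fun y => ?_
        have h1 := ENNReal.ofReal_le_ofReal (h s hs ((2:ℝ) ^ k • x - y))
        rw [ofReal_norm, ENNReal.ofReal_mul hC.le] at h1
        refine (mul_le_mul_right h1 _).trans (le_of_eq ?_)
        simp only [hH]; ring
    _ = ENNReal.ofReal (((2:ℝ) ^ k) ^ n) * ∫⁻ z, H ((2:ℝ) ^ k • z) := by
        rw [br_lint_scale hHm hk0, ← mul_assoc, ← ENNReal.ofReal_mul (by positivity),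
          mul_inv_cancel₀ (by positivity), ENNReal.ofReal_one, one_mul]
    _ = _ := by
        rw [← lintegral_const_mul' _ _ ENNReal.ofReal_ne_top]
        refine lintegral_congr fun z => ?_
        simp only [hH]
        rw [inv_smul_smul₀ hk0.ne', ← smul_sub, norm_smul, Real.norm_of_nonneg hk0.le,
          ENNReal.ofReal_mul (p := ((2:ℝ) ^ k) ^ n) (by positivity)]
        ring

end L12b

section L13

variable {n : ℕ}

lemma br_R_split {R : ℝ} (hR : 0 < R) : ∃ (k : ℤ) (s : ℝ), s ∈ Set.Icc (1:ℝ) 4 ∧ R ^ 2 = ((2:ℝ) ^ k) ^ 2 * s := by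
  obtain ⟨k, hk1, hk2⟩ := exists_mem_Ico_zpow hR (by norm_num : (1:ℝ) < 2)
  have hk0 : (0:ℝ) < 2 ^ k := by positivity
  rw [zpow_add_one₀ (by norm_num)] at hk2
  refine ⟨k, R ^ 2 / ((2:ℝ) ^ k) ^ 2, ⟨?_, ?_⟩, by field_simp⟩
  · rw [le_div_iff₀ (by positivity), one_mul]
    exact pow_le_pow_left₀ hk0.le hk1 2
  · rw [div_le_iff₀ (by positivity)]
    have := pow_le_pow_left₀ hR.le hk2.le 2
    linarith [mul_pow ((2:ℝ)^k) 2 2]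

lemma br_BR_eq {α R s : ℝ} (k : ℤ) (hR : 0 < R) (hs : 1 ≤ s)
    (hRs : R ^ 2 = ((2:ℝ) ^ k) ^ 2 * s) (u : EuclideanSpace ℝ (Fin n) → ℂ) (x : EuclideanSpace ℝ (Fin n)) :
    bochnerRiesz n α R u x = ((s ^ (-α) : ℝ) : ℂ) *
      𝓕⁻ (fun ξ => (((max (s - ‖ξ‖ ^ 2) 0) ^ α : ℝ) : ℂ) * 𝓕 (fun y => u (((2:ℝ) ^ k)⁻¹ • y)) ξ) ((2:ℝ) ^ k • x) := by
  have hk0 : (0:ℝ) < 2 ^ k := by positivity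
  have hs0 : 0 < s := by linarith
  rw [br_scale (fun ξ => (((max (s - ‖ξ‖ ^ 2) 0) ^ α : ℝ) : ℂ)) u hk0]
  unfold bochnerRiesz
  rw [Real.fourierInv_eq', ← integral_const_mul]
  refine integral_congr_ae (Eventually.of_forall fun ξ => ?_)
  have h1 : max (1 - ‖ξ‖ ^ 2 / R ^ 2) 0 = s⁻¹ * max (s - ‖((2:ℝ) ^ k)⁻¹ • ξ‖ ^ 2) 0 := by
    rw [mul_max_of_nonneg _ _ (by positivity), mul_zero, norm_smul, Real.norm_of_nonneg (by positivity), hRs]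
    congr 1
    field_simp
  have h2 : (max (1 - ‖ξ‖ ^ 2 / R ^ 2) 0) ^ α = s ^ (-α) * (max (s - ‖((2:ℝ) ^ k)⁻¹ • ξ‖ ^ 2) 0) ^ α := by
    rw [h1, Real.mul_rpow (by positivity) (le_max_right _ _), Real.inv_rpow hs0.le, Real.rpow_neg hs0.le]
  simp only [h2, smul_eq_mul]
  rw [real_inner_comm x ξ]
  push_cast
  have : (2 * (Real.pi:ℂ) * (⟪x, ξ⟫ : ℝ) * I) = 2 * Real.pi * I * (⟪x, ξ⟫ : ℝ) := by ring
  rw [this]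
  ring

lemma br_pointwise (n : ℕ) {α : ℝ} (hα : 0 < α) : ∃ C : ℝ, 0 < C ∧
    ∀ (f : SchwartzMap (EuclideanSpace ℝ (Fin n)) ℂ) (R : ℝ), 0 < R → ∀ x,
      ‖bochnerRiesz n α R f x‖ₑ ≤ ENNReal.ofReal C * brM (fun z => ‖f z‖ₑ) x +
        ∑' j : ℕ, ENNReal.ofReal (brd j ^ α) * ⨆ k : ℤ, ⨆ s ∈ Set.Icc (1:ℝ) 4,
          ‖brF (brphi α) (brd j) s (fun y => f (((2:ℝ) ^ k)⁻¹ • y)) ((2:ℝ) ^ k • x)‖ₑ := by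
  obtain ⟨C, hC, h⟩ := br_low n α
  refine ⟨C, hC, fun f R hR x => ?_⟩
  obtain ⟨k, s, hs, hRs⟩ := br_R_split hR
  rw [br_BR_eq k hR hs.1 hRs, enorm_mul]
  have hle : ‖((s ^ (-α) : ℝ) : ℂ)‖ₑ ≤ 1 := by
    rw [← ofReal_norm, Complex.norm_real, Real.norm_of_nonneg (Real.rpow_nonneg (by linarith [hs.1]) _)]
    exact ENNReal.ofReal_le_one.2 (Real.rpow_le_one_of_one_le_of_nonpos hs.1 (by linarith))
  refine (mul_le_mul_left hle _).trans ?_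
  rw [one_mul]
  obtain ⟨g, hg⟩ := br_dil f k
  have hgi : Integrable (𝓕 (⇑g)) := by
    rw [← SchwartzMap.fourier_coe]; exact (𝓕 g).integrable
  rw [hg] at hgi
  refine (br_decomp hα hs.2 hgi _).trans (add_le_add (h f k s (by linarith [hs.2]) x) ?_)
  refine ENNReal.tsum_le_tsum fun j => mul_le_mul_right ?_ _
  refine le_iSup_of_le k ?_
  exact le_iSup₂_of_le s hs le_rfl

/-- Abstract summation. -/
lemma br_sum_sup {p γ b : ℝ} (hp : 0 < p) (S : ℕ → ℤ → ℝ≥0∞) :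
    (∑' j : ℕ, ENNReal.ofReal (brd j ^ (γ + b)) * ⨆ k : ℤ, S j k) ^ p ≤
      (∑' j : ℕ, ENNReal.ofReal (brd j ^ γ)) ^ p *
        ∑' j : ℕ, ENNReal.ofReal (brd j ^ (p * b)) * ∑' k : ℤ, S j k ^ p := by
  set X := ∑' j : ℕ, ENNReal.ofReal (brd j ^ (p * b)) * ∑' k : ℤ, S j k ^ p with hX
  have key : ∀ j, ENNReal.ofReal (brd j ^ b) * (⨆ k : ℤ, S j k) ≤ X ^ (1 / p) := by
    intro j
    rw [ENNReal.mul_iSup]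
    refine iSup_le fun k => ?_
    rw [one_div, ENNReal.le_rpow_inv_iff hp, ENNReal.mul_rpow_of_nonneg _ _ hp.le,
      ENNReal.ofReal_rpow_of_nonneg (Real.rpow_nonneg (brd_pos j).le _) hp.le, ← Real.rpow_mul (brd_pos j).le,
      mul_comm b p]
    refine le_trans ?_ (ENNReal.le_tsum j)
    exact mul_le_mul_right (ENNReal.le_tsum k) _
  have h1 : (∑' j : ℕ, ENNReal.ofReal (brd j ^ (γ + b)) * ⨆ k : ℤ, S j k) ≤
      (∑' j : ℕ, ENNReal.ofReal (brd j ^ γ)) * X ^ (1 / p) := by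
    rw [← ENNReal.tsum_mul_right]
    refine ENNReal.tsum_le_tsum fun j => ?_
    rw [Real.rpow_add (brd_pos j), ENNReal.ofReal_mul (Real.rpow_nonneg (brd_pos j).le _), mul_assoc]
    exact mul_le_mul_right (key j) _
  refine (ENNReal.rpow_le_rpow h1 hp.le).trans (le_of_eq ?_)
  rw [ENNReal.mul_rpow_of_nonneg _ _ hp.le, ← ENNReal.rpow_mul, one_div_mul_cancel hp.ne', ENNReal.rpow_one]

lemma br_main (n : ℕ) (hn : 2 ≤ n) (p α : ℝ)
    (hp1 : 2 ≤ p) (hp2 : p < 2 * ((n : ℝ) + 1) / ((n : ℝ) - 1))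
    (hα : ((n : ℝ) - 1) / (2 * ((n : ℝ) + 1)) < α) :
    ∃ C : ℝ, 0 < C ∧ ∀ f : SchwartzMap (EuclideanSpace ℝ (Fin n)) ℂ,
      ∫⁻ x, (⨆ (R : ℝ) (_ : 0 < R), ‖bochnerRiesz n α R f x‖ₑ) ^ p
        ≤ ENNReal.ofReal C * ∫⁻ x, ‖f x‖ₑ ^ p := by
  have hn' : (2:ℝ) ≤ n := by exact_mod_cast hn
  set β0 := ((n : ℝ) - 1) / (2 * ((n : ℝ) + 1)) with hβ0
  have hβ0' : 0 < β0 := by apply div_pos <;> linarith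
  have hp0 : 0 < p := by linarith
  set β := (β0 + α) / 2 with hβ
  set γ := (α - β) / 2 with hγ
  have hγ0 : 0 < γ := by rw [hγ, hβ]; linarith
  obtain ⟨C1, hC1, hpt⟩ := br_pointwise n (α := α) (by linarith)
  obtain ⟨C2, hC2, hhi⟩ := br_high n hn (α := α) (β := β) hp1 hp2 (by rw [← hβ0, hβ]; linarith)
  obtain ⟨C3, hC3, hM⟩ := brM_strong (n := n) (by lia) (p := p) (by linarith)
  have hs1 := brd_rpow_summable hγ0
  have hs2 := brd_rpow_summable (mul_pos hp0 hγ0)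
  set A1 := ∑' j, brd j ^ γ with hA1
  set A2 := ∑' j, brd j ^ (p * γ) with hA2
  have hA1n : 0 ≤ A1 := tsum_nonneg fun j => Real.rpow_nonneg (brd_pos j).le _
  have hA2n : 0 ≤ A2 := tsum_nonneg fun j => Real.rpow_nonneg (brd_pos j).le _
  refine ⟨2 ^ (p - 1) * (C1 ^ p * C3 + A1 ^ p * (C2 * A2)), by positivity, fun f => ?_⟩
  set I := ∫⁻ x, ‖f x‖ₑ ^ p with hI
  set S : ℕ → ℤ → EuclideanSpace ℝ (Fin n) → ℝ≥0∞ := fun j k x => ⨆ s ∈ Set.Icc (1:ℝ) 4,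
    ‖brF (brphi α) (brd j) s (fun y => f (((2:ℝ) ^ k)⁻¹ • y)) ((2:ℝ) ^ k • x)‖ₑ with hS
  have hSm : ∀ j k, Measurable (S j k) := by
    intro j k
    obtain ⟨g, hg⟩ := br_dil f k
    have := brF_sup_measurable (brphi_smooth α).continuous (brphi_supp α) (brd_pos j) g.integrable
    rw [hg] at this
    exact this.comp (measurable_const_smul ((2:ℝ) ^ k))
  set T : EuclideanSpace ℝ (Fin n) → ℝ≥0∞ := fun x =>
    ∑' j : ℕ, ENNReal.ofReal (brd j ^ (p * (β + γ))) * ∑' k : ℤ, S j k x ^ p with hT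
  have hfm := f.continuous.measurable.enorm
  have hMm : Measurable fun x => brM (fun z => ‖f z‖ₑ) x := brM_measurable hfm
  have hαe : γ + (β + γ) = α := by rw [hγ]; ring
  have hA1' : (∑' j : ℕ, ENNReal.ofReal (brd j ^ γ)) = ENNReal.ofReal A1 :=
    (ENNReal.ofReal_tsum_of_nonneg (fun j => Real.rpow_nonneg (brd_pos j).le _) hs1).symm
  have hA2' : (∑' j : ℕ, ENNReal.ofReal (brd j ^ (p * γ))) = ENNReal.ofReal A2 :=
    (ENNReal.ofReal_tsum_of_nonneg (fun j => Real.rpow_nonneg (brd_pos j).le _) hs2).symm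
  have hpw : ∀ x, (⨆ (R : ℝ) (_ : 0 < R), ‖bochnerRiesz n α R f x‖ₑ) ^ p ≤
      ENNReal.ofReal (2 ^ (p - 1)) * (ENNReal.ofReal (C1 ^ p) * brM (fun z => ‖f z‖ₑ) x ^ p +
        ENNReal.ofReal (A1 ^ p) * T x) := by
    intro x
    have h1 : (⨆ (R : ℝ) (_ : 0 < R), ‖bochnerRiesz n α R f x‖ₑ) ≤
        ENNReal.ofReal C1 * brM (fun z => ‖f z‖ₑ) x +
          ∑' j : ℕ, ENNReal.ofReal (brd j ^ (γ + (β + γ))) * ⨆ k : ℤ, S j k x := by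
      rw [hαe]
      exact iSup₂_le fun R hR => hpt f R hR x
    refine (ENNReal.rpow_le_rpow h1 hp0.le).trans ?_
    refine (ENNReal.rpow_add_le_mul_rpow_add_rpow _ _ (by linarith)).trans ?_
    rw [show (2:ℝ≥0∞) ^ (p - 1) = ENNReal.ofReal (2 ^ (p - 1)) by
      rw [← ENNReal.ofReal_rpow_of_pos (by norm_num)]; simp]
    refine mul_le_mul_right (add_le_add (le_of_eq ?_) ?_) _
    · rw [ENNReal.mul_rpow_of_nonneg _ _ hp0.le, ENNReal.ofReal_rpow_of_nonneg hC1.le hp0.le]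
    · refine (br_sum_sup hp0 (fun j k => S j k x)).trans (le_of_eq ?_)
      rw [hA1', ENNReal.ofReal_rpow_of_nonneg hA1n hp0.le]
  have hTm : Measurable T := Measurable.ennreal_tsum fun j =>
    (Measurable.ennreal_tsum fun k => (hSm j k).pow_const p).const_mul _
  have hTI : ∫⁻ x, T x ≤ ENNReal.ofReal (C2 * A2) * I := by
    simp only [hT]
    rw [lintegral_tsum fun j =>
      ((Measurable.ennreal_tsum fun k => (hSm j k).pow_const p).const_mul _).aemeasurable]
    rw [ENNReal.ofReal_mul hC2.le, ← hA2', ← ENNReal.tsum_mul_left, ← ENNReal.tsum_mul_right]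
    refine ENNReal.tsum_le_tsum fun j => ?_
    rw [lintegral_const_mul' _ _ ENNReal.ofReal_ne_top,
      lintegral_tsum fun k => ((hSm j k).pow_const p).aemeasurable]
    refine (mul_le_mul_right (hhi (brd j) (brd_pos j) (brd_le j) f) _).trans (le_of_eq ?_)
    rw [← mul_assoc, ← ENNReal.ofReal_mul (Real.rpow_nonneg (brd_pos j).le _),
      ← ENNReal.ofReal_mul hC2.le]
    congr 2
    rw [mul_left_comm, ← Real.rpow_add (brd_pos j)]
    congr 2
    ring
  refine (lintegral_mono hpw).trans ?_
  rw [lintegral_const_mul' _ _ ENNReal.ofReal_ne_top, lintegral_add_right _ (hTm.const_mul _),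
    lintegral_const_mul' _ _ ENNReal.ofReal_ne_top, lintegral_const_mul' _ _ ENNReal.ofReal_ne_top,
    ENNReal.ofReal_mul (by positivity), ENNReal.ofReal_add (by positivity) (by positivity),
    ENNReal.ofReal_mul (by positivity), ENNReal.ofReal_mul (p := A1 ^ p) (by positivity), mul_assoc, add_mul,
    mul_assoc, mul_assoc]
  refine mul_le_mul_right (add_le_add (mul_le_mul_right ?_ _) (mul_le_mul_right hTI _)) _
  exact hM _ hfm f.integrable.2.ne

end L13

theorem maximal_bochnerRiesz_Lp_bound (n : ℕ) (hn : 2 ≤ n) (p α : ℝ)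
    (hp1 : 2 ≤ p) (hp2 : p < 2 * ((n : ℝ) + 1) / ((n : ℝ) - 1))
    (hα : ((n : ℝ) - 1) / (2 * ((n : ℝ) + 1)) < α) :
    ∃ C : ℝ, 0 < C ∧ ∀ f : SchwartzMap (EuclideanSpace ℝ (Fin n)) ℂ,
      (∫⁻ x, (⨆ (R : ℝ) (_ : 0 < R), (‖bochnerRiesz n α R f x‖₊ : ℝ≥0∞)) ^ p ∂volume) ^ (1 / p)
        ≤ ENNReal.ofReal C * eLpNorm f (ENNReal.ofReal p) volume := by
  obtain ⟨C, hC, h⟩ := br_main n hn p α hp1 hp2 hα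
  have hp0 : 0 < p := by linarith
  refine ⟨C ^ (1 / p), by positivity, fun f => ?_⟩
  rw [eLpNorm_eq_lintegral_rpow_enorm_toReal (by simpa using hp0) ENNReal.ofReal_ne_top,
    ENNReal.toReal_ofReal hp0.le, ← ENNReal.ofReal_rpow_of_nonneg hC.le (by positivity),
    ← ENNReal.mul_rpow_of_nonneg _ _ (by positivity)]
  exact ENNReal.rpow_le_rpow (h f) (by positivity)
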